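/- Let Ω ⊂ ℝ² be an open set and let H : Ω → ℝ be a Lipschitz function with bounded support. Then for Lebesgue-a.e. h ∈ H(Ω) the level set E_h := H^{-1}(h) satisfies: (1) the family Conn*(E_h) of connected components of E_h containing more than one point is countable, and H¹( E_h \ E_h* ) = 0, where E_h* is the union of all elements of Conn*(E_h); (2) every C ∈ Conn*(E_h) is a simple Ω-closed Lipschitz curve. -/

import Mathlib

open MeasureTheory Set Filter
open scoped Topology ENNReal NNReal

noncomputable section

/-- A simple `Ω`-closed Lipschitz curve `C ⊆ Ω` together with a Lipschitz parametrization: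
either a closed curve (periodic parametrization, injective on one period) or a curve whose
endpoints lie on `∂Ω`.  The curve has finite `H¹`-measure. -/
structure SimpleOmegaClosedCurve (Ω C : Set (EuclideanSpace ℝ (Fin 2))) where
  len : ℝ
  len_pos : 0 < len
  γ : ℝ → EuclideanSpace ℝ (Fin 2)
  K : ℝ≥0
  lip : LipschitzWith K γ
  dom : Set ℝ
  cases : (Function.Periodic γ len ∧ dom = Set.Ico 0 len ∧ Set.InjOn γ dom ∧ C = γ '' dom)
    ∨ (dom = Set.Ioo 0 len ∧ Set.InjOn γ dom ∧ C = γ '' dom ∧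
        γ 0 ∈ frontier Ω ∧ γ len ∈ frontier Ω ∧ γ '' Set.Icc 0 len ⊆ closure Ω)
  sub : C ⊆ Ω
  finlen : μH[1] C ≠ ⊤

/-- The family `Conn*(E)` of connected components of `E` containing more than one point. -/
def ConnStar (E : Set (EuclideanSpace ℝ (Fin 2))) : Set (Set (EuclideanSpace ℝ (Fin 2))) :=
  {C | (∃ x ∈ E, C = connectedComponentIn E x) ∧ ¬ C.Subsingleton}

set_option linter.unusedSectionVars false
set_option linter.unusedSimpArgs false

section Metric
variable {X : Type*} [MetricSpace X] [MeasurableSpace X] [BorelSpace X]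

/-- A connected set that leaves the ball `B(p,r)` has `H¹`-measure at least `r` in the ball. -/
lemma hm_ball_ge {S : Set X} (hS : IsPreconnected S) {p q : X} (hp : p ∈ S) (hq : q ∈ S)
    {r : ℝ} (hr : r ≤ dist p q) :
    ENNReal.ofReal r ≤ μH[1] (S ∩ Metric.ball p r) := by
  have hl : LipschitzWith 1 (fun x => dist p x) := LipschitzWith.dist_right p
  have h1 := (hl.lipschitzOnWith (s := S ∩ Metric.ball p r)).hausdorffMeasure_image_le
    (d := 1) zero_le_one
  have h2 : Ico 0 r ⊆ (fun x => dist p x) '' (S ∩ Metric.ball p r) := by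
    intro t ht
    have hc : IsPreconnected ((fun x => dist p x) '' S) := hS.image _ hl.continuous.continuousOn
    have : t ∈ (fun x => dist p x) '' S := by
      apply hc.ordConnected.out (x := 0) (y := dist p q) ⟨p, hp, by simp⟩ ⟨q, hq, rfl⟩
      exact ⟨ht.1, ht.2.le.trans hr⟩
    obtain ⟨x, hx, rfl⟩ := this
    exact ⟨x, ⟨hx, by rw [Metric.mem_ball, dist_comm]; exact ht.2⟩, rfl⟩
  have h3 := measure_mono (μ := μH[1]) h2
  have h4 : μH[1] (Ico (0:ℝ) r) = ENNReal.ofReal r := by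
    rw [hausdorffMeasure_real, Real.volume_Ico, sub_zero]
  rw [h4] at h3
  refine h3.trans (h1.trans ?_)
  simp

lemma hm_connected_ge {S : Set X} (hS : IsPreconnected S) {p q : X} (hp : p ∈ S) (hq : q ∈ S) :
    ENNReal.ofReal (dist p q) ≤ μH[1] S :=
  (hm_ball_ge hS hp hq le_rfl).trans (measure_mono inter_subset_left)

lemma hm_connected_pos {S : Set X} (hS : IsPreconnected S) {p q : X} (hp : p ∈ S) (hq : q ∈ S)
    (hpq : p ≠ q) : 0 < μH[1] S :=
  lt_of_lt_of_le (by simpa using dist_pos.2 hpq) (hm_connected_ge hS hp hq)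

/-- existence of `ε`-chains -/
def Chain (S : Set X) (ε : ℝ) (x y : X) (N : ℕ) : Prop :=
  ∃ p : ℕ → X, p 0 = x ∧ p N = y ∧ (∀ i, p i ∈ S) ∧ ∀ i < N, dist (p i) (p (i+1)) ≤ ε

lemma chain_trans {S : Set X} {ε : ℝ} {x y z : X} {N M : ℕ} (h1 : Chain S ε x y N)
    (h2 : Chain S ε y z M) : Chain S ε x z (N + M) := by
  obtain ⟨p, p0, pN, pS, pd⟩ := h1
  obtain ⟨q, q0, qN, qS, qd⟩ := h2
  refine ⟨fun i => if i ≤ N then p i else q (i - N), by simp [p0], ?_, ?_, ?_⟩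
  · by_cases hM : M = 0
    · subst hM; simp [pN, ← qN, q0]
    · have : ¬ (N + M ≤ N) := by omega
      simp [this, qN, hM]
  · intro i
    dsimp only
    split_ifs
    · exact pS _
    · exact qS _
  · intro i hi
    dsimp only
    by_cases h : i + 1 ≤ N
    · rw [if_pos h, if_pos (by omega)]
      exact pd i (by omega)
    · rw [if_neg h]
      by_cases h' : i ≤ N
      · have : i = N := by omega
        subst this
        rw [if_pos le_rfl, pN, ← q0]
        have := qd 0 (by omega)
        simpa using this
      · rw [if_neg h']
        have := qd (i - N) (by omega)
        rwa [show i - N + 1 = i + 1 - N by omega] at this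

lemma chain_exists {S : Set X} (hS : IsPreconnected S) {ε : ℝ} (hε : 0 < ε) {x y : X}
    (hx : x ∈ S) (hy : y ∈ S) : ∃ N, Chain S ε x y N := by
  have base : ∀ x ∈ S, ∀ y ∈ S, dist x y ≤ ε → Chain S ε x y 1 := by
    intro x hx y hy h
    refine ⟨fun i => if i = 0 then x else y, by simp, by simp, ?_, ?_⟩
    · intro i
      dsimp only
      split_ifs <;> assumption
    · intro i hi
      have : i = 0 := by omega
      subst this
      simpa using h
  have key := hS.induction₂' (fun x y => x ∈ S → y ∈ S → ∃ N, Chain S ε x y N) ?_ ?_ hx hy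
  · exact key hx hy
  · intro z hz
    filter_upwards [inter_mem_nhdsWithin S (Metric.closedBall_mem_nhds z hε)] with y hy
    refine ⟨fun h1 h2 => ⟨1, base _ h1 _ h2 ?_⟩, fun h1 h2 => ⟨1, base _ h1 _ h2 hy.2⟩⟩
    rw [dist_comm]; exact hy.2
  · intro a b c ha hb hc h1 h2 h3 h4
    obtain ⟨N, hN⟩ := h1 h3 hb
    obtain ⟨M, hM⟩ := h2 hb h4
    exact ⟨_, chain_trans hN hM⟩

/-- short chains, with length bounded by the `H¹` measure. -/
lemma chain_short {S : Set X} (hS : IsPreconnected S) {ε : ℝ} (hε : 0 < ε) {x y : X}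
    (hx : x ∈ S) (hy : y ∈ S) (hxy : ε ≤ dist x y) :
    ∃ N : ℕ, Chain S ε x y N ∧ ENNReal.ofReal (N * ε) ≤ 4 * μH[1] S := by
  classical
  have hex := chain_exists hS hε hx hy
  set N := Nat.find hex with hN
  have hc : Chain S ε x y N := Nat.find_spec hex
  refine ⟨N, hc, ?_⟩
  obtain ⟨p, p0, pN, pS, pd⟩ := hc
  have sep : ∀ i j, i + 2 ≤ j → j ≤ N → ε < dist (p i) (p j) := by
    intro i j hij hj
    by_contra hcon
    push Not at hcon
    have : Chain S ε x y (N - (j - i - 1)) := by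
      refine ⟨fun k => if k ≤ i then p k else p (k + (j - i - 1)), by simp [p0], ?_, ?_, ?_⟩
      · dsimp only
        rw [if_neg (by omega), ← pN]
        congr 1; omega
      · intro k
        dsimp only
        split_ifs <;> exact pS _
      · intro k hk
        dsimp only
        by_cases h : k + 1 ≤ i
        · rw [if_pos h, if_pos (by omega)]; exact pd _ (by omega)
        · rw [if_neg h]
          by_cases h' : k ≤ i
          · have : k = i := by omega
            subst this
            rw [if_pos le_rfl, show k + 1 + (j - k - 1) = j by omega]
            exact hcon
          · rw [if_neg h']
            have := pd (k + (j - i - 1)) (by omega)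
            rwa [show k + (j - i - 1) + 1 = k + 1 + (j - i - 1) by omega] at this
    exact Nat.find_min hex (by omega) this
  set k := N / 2 with hk
  have hdisj : Set.PairwiseDisjoint (↑(Finset.range (k+1)))
      (fun i : ℕ => Metric.ball (p (2 * i)) (ε / 2)) := by
    intro i hi j hj hij
    simp only [Finset.coe_range, mem_Iio] at hi hj
    apply Metric.ball_disjoint_ball
    rcases lt_or_gt_of_ne hij with h | h
    · have := sep (2*i) (2*j) (by omega) (by omega); linarith
    · have := sep (2*j) (2*i) (by omega) (by omega); rw [dist_comm]; linarith
  have hsum : ∑ i ∈ Finset.range (k+1), (μH[1] : Measure X).restrict S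
      (Metric.ball (p (2*i)) (ε/2)) ≤ (μH[1] : Measure X).restrict S univ := by
    rw [← measure_biUnion_finset hdisj (fun i _ => Metric.isOpen_ball.measurableSet)]
    exact measure_mono (subset_univ _)
  have hlow : ∀ i, ENNReal.ofReal (ε/2) ≤ (μH[1] : Measure X).restrict S
      (Metric.ball (p (2*i)) (ε/2)) := by
    intro i
    rw [Measure.restrict_apply Metric.isOpen_ball.measurableSet, inter_comm]
    by_cases h : ε / 2 ≤ dist (p (2*i)) x
    · exact hm_ball_ge hS (pS _) hx h
    · refine hm_ball_ge hS (pS _) hy ?_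
      push Not at h
      have := dist_triangle_left x y (p (2*i))
      linarith
  have h1 : ((k+1 : ℕ) : ℝ≥0∞) * ENNReal.ofReal (ε/2) ≤ μH[1] S := by
    have := (Finset.sum_le_sum (fun i (_ : i ∈ Finset.range (k+1)) => hlow i)).trans hsum
    simpa [Finset.sum_const] using this
  calc ENNReal.ofReal (N * ε) ≤ ENNReal.ofReal (4 * (((k+1 : ℕ) : ℝ) * (ε/2))) := by
        apply ENNReal.ofReal_le_ofReal
        have : (N : ℝ) ≤ 2 * ((k + 1 : ℕ) : ℝ) := by exact_mod_cast (by omega : N ≤ 2 * (k+1))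
        nlinarith
    _ = 4 * (((k+1 : ℕ) : ℝ≥0∞) * ENNReal.ofReal (ε/2)) := by
        rw [ENNReal.ofReal_mul (by norm_num), ENNReal.ofReal_mul (by positivity),
          ENNReal.ofReal_natCast]
        norm_num
    _ ≤ _ := by gcongr

/-- a 1-Lipschitz path of duration `ℓ` in `S` from `x` to `y` -/
def ReachIn (S : Set X) (ℓ : ℝ) (x y : X) (τ : ℝ → X) : Prop :=
  0 ≤ ℓ ∧ τ 0 = x ∧ τ ℓ = y ∧ (∀ t ∈ Icc 0 ℓ, τ t ∈ S) ∧
    ∀ s ∈ Icc 0 ℓ, ∀ t ∈ Icc 0 ℓ, dist (τ s) (τ t) ≤ |s - t|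

lemma reach_limit {S : Set X} (hS : IsCompact S) {ℓ : ℝ} (hℓ : 0 ≤ ℓ) {x y : X}
    (h : ∀ ε > 0, ∃ τ : ℝ → X, dist (τ 0) x ≤ ε ∧ dist (τ ℓ) y ≤ ε ∧
      (∀ t ∈ Icc 0 ℓ, τ t ∈ S) ∧ ∀ s ∈ Icc 0 ℓ, ∀ t ∈ Icc 0 ℓ, dist (τ s) (τ t) ≤ |s - t| + ε) :
    ∃ τ, ReachIn S ℓ x y τ := by
  have h' : ∀ n : ℕ, ∃ τ : ℝ → X, dist (τ 0) x ≤ 1/((n:ℝ)+1) ∧ dist (τ ℓ) y ≤ 1/((n:ℝ)+1) ∧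
      (∀ t ∈ Icc 0 ℓ, τ t ∈ S) ∧
      ∀ s ∈ Icc 0 ℓ, ∀ t ∈ Icc 0 ℓ, dist (τ s) (τ t) ≤ |s - t| + 1/((n:ℝ)+1) :=
    fun n => h _ (by positivity)
  choose τ h0 h1 h2 h3 using h'
  set U : Ultrafilter ℕ := Filter.hyperfilter ℕ
  have hU : (U : Filter ℕ) ≤ atTop := by
    rw [← Nat.cofinite_eq_atTop]; exact Filter.hyperfilter_le_cofinite
  have hlim0 : Tendsto (fun n : ℕ => 1/((n:ℝ)+1)) U (𝓝 0) :=
    tendsto_one_div_add_atTop_nhds_zero_nat.mono_left hU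
  have hl : ∀ t, ∃ z, t ∈ Icc 0 ℓ → z ∈ S ∧ Tendsto (fun n => τ n t) U (𝓝 z) := by
    intro t
    by_cases ht : t ∈ Icc 0 ℓ
    · obtain ⟨z, hz, hz'⟩ := hS.ultrafilter_le_nhds (U.map (fun n => τ n t)) (by
        rw [Filter.le_principal_iff]
        exact Filter.mem_map.2 (Filter.univ_mem' (fun n => h2 n t ht)))
      exact ⟨z, fun _ => ⟨hz, hz'⟩⟩
    · exact ⟨x, fun h => absurd h ht⟩
  choose σ hσ using hl
  refine ⟨σ, hℓ, ?_, ?_, fun t ht => (hσ t ht).1, ?_⟩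
  · have ha := (hσ 0 ⟨le_rfl, hℓ⟩).2.dist (tendsto_const_nhds (x := x))
    have := le_of_tendsto_of_tendsto' ha hlim0 (fun n => h0 n)
    exact dist_le_zero.1 this
  · have ha := (hσ ℓ ⟨hℓ, le_rfl⟩).2.dist (tendsto_const_nhds (x := y))
    have := le_of_tendsto_of_tendsto' ha hlim0 (fun n => h1 n)
    exact dist_le_zero.1 this
  · intro s hs t ht
    have ha := (hσ s hs).2.dist (hσ t ht).2
    have hb : Tendsto (fun n : ℕ => |s - t| + 1/((n:ℝ)+1)) U (𝓝 (|s-t| + 0)) :=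
      tendsto_const_nhds.add hlim0
    have := le_of_tendsto_of_tendsto' ha hb (fun n => h3 n s hs t ht)
    simpa using this

lemma reach_exists {S : Set X} (hS : IsCompact S) (hc : IsPreconnected S) (hf : μH[1] S ≠ ⊤)
    {x y : X} (hx : x ∈ S) (hy : y ∈ S) (hxy : x ≠ y) :
    ∃ τ, ReachIn S (4 * (μH[1] S).toReal) x y τ := by
  apply reach_limit hS (by positivity)
  intro ε₀ hε₀
  set ε := min ε₀ (dist x y)
  have hε : 0 < ε := lt_min hε₀ (dist_pos.2 hxy)
  obtain ⟨N, ⟨p, p0, pN, pS, pd⟩, hN⟩ := chain_short hc hε hx hy (min_le_right _ _)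
  have hN' : N * ε ≤ 4 * (μH[1] S).toReal := by
    have := ENNReal.toReal_mono (ENNReal.mul_ne_top (by norm_num) hf) hN
    rw [ENNReal.toReal_ofReal (by positivity), ENNReal.toReal_mul] at this
    simpa using this
  refine ⟨fun t => p (min N ⌊t / ε⌋₊), ?_, ?_, fun t _ => pS _, ?_⟩
  · simp [p0, hε₀.le]
  · have : N ≤ ⌊4 * (μH[1] S).toReal / ε⌋₊ := by
      apply Nat.le_floor; rw [le_div_iff₀ hε]; exact hN'
    simp [min_eq_left this, pN, hε₀.le]
  · have key : ∀ i j, i ≤ j → j ≤ N → dist (p i) (p j) ≤ (j - i) * ε := by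
      intro i j hij
      induction j, hij using Nat.le_induction with
      | base => intro; simp
      | succ j hj ih =>
        intro h
        have h1 := ih (by omega)
        have h2 := pd j (by omega)
        have := dist_triangle (p i) (p j) (p (j+1))
        push_cast
        linarith
    have main : ∀ s ∈ Icc 0 (4 * (μH[1] S).toReal), ∀ t ∈ Icc 0 (4 * (μH[1] S).toReal), s ≤ t →
        dist (p (min N ⌊s / ε⌋₊)) (p (min N ⌊t / ε⌋₊)) ≤ |s - t| + ε₀ := by
      intro s hs t ht hst
      have hmono : ⌊s / ε⌋₊ ≤ ⌊t/ε⌋₊ := Nat.floor_mono (by gcongr)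
      refine (key _ _ (min_le_min_left _ hmono) (min_le_left _ _)).trans ?_
      have h1 : ((min N ⌊t/ε⌋₊ : ℕ) : ℝ) - (min N ⌊s / ε⌋₊ : ℕ) ≤ ⌊t/ε⌋₊ - ⌊s/ε⌋₊ := by
        have : min N ⌊t/ε⌋₊ + ⌊s/ε⌋₊ ≤ ⌊t/ε⌋₊ + min N ⌊s/ε⌋₊ := by omega
        have : ((min N ⌊t/ε⌋₊ + ⌊s/ε⌋₊ : ℕ) : ℝ) ≤ (⌊t/ε⌋₊ + min N ⌊s/ε⌋₊ : ℕ) := by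
          exact_mod_cast this
        simp only [Nat.cast_add] at this
        linarith
      have h2 : (⌊t/ε⌋₊ : ℝ) ≤ t/ε := Nat.floor_le (div_nonneg ht.1 hε.le)
      have h3 : s / ε < ⌊s/ε⌋₊ + 1 := Nat.lt_floor_add_one _
      have h4 : ((min N ⌊t/ε⌋₊ : ℕ) : ℝ) - (min N ⌊s / ε⌋₊ : ℕ) ≤ t/ε - s/ε + 1 := by linarith
      have h5 := mul_le_mul_of_nonneg_right h4 hε.le
      have h6 : (t/ε - s/ε + 1) * ε = t - s + ε := by field_simp
      rw [abs_sub_comm, abs_of_nonneg (by linarith)]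
      have h7 : ε ≤ ε₀ := min_le_left _ _
      linarith
    intro s hs t ht
    rcases le_total s t with h | h
    · exact main s hs t ht h
    · rw [dist_comm, abs_sub_comm]; exact main t ht s hs h

lemma reach_trans {S : Set X} {ℓ₁ ℓ₂ : ℝ} {x y z : X} {τ₁ τ₂ : ℝ → X} (h₁ : ReachIn S ℓ₁ x y τ₁)
    (h₂ : ReachIn S ℓ₂ y z τ₂) : ∃ τ, ReachIn S (ℓ₁ + ℓ₂) x z τ := by
  obtain ⟨l1, a0, a1, aS, ad⟩ := h₁
  obtain ⟨l2, b0, b1, bS, bd⟩ := h₂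
  refine ⟨fun t => if t ≤ ℓ₁ then τ₁ t else τ₂ (t - ℓ₁), by positivity, by simp [l1, a0], ?_, ?_, ?_⟩
  · by_cases h : ℓ₂ = 0
    · subst h; simp [a1, ← b1, b0]
    · have : ¬ (ℓ₁ + ℓ₂ ≤ ℓ₁) := by
        have := lt_of_le_of_ne l2 (Ne.symm h); linarith
      dsimp only
      rw [if_neg this]; simp [b1]
  · intro t ht
    dsimp only
    split_ifs with h
    · exact aS _ ⟨ht.1, h⟩
    · push Not at h
      exact bS _ ⟨by linarith, by linarith [ht.2]⟩
  · have main : ∀ s ∈ Icc 0 (ℓ₁ + ℓ₂), ∀ t ∈ Icc 0 (ℓ₁ + ℓ₂), s ≤ t →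
      dist (if s ≤ ℓ₁ then τ₁ s else τ₂ (s - ℓ₁)) (if t ≤ ℓ₁ then τ₁ t else τ₂ (t - ℓ₁))
        ≤ |s - t| := by
      intro s hs t ht hst
      by_cases h1 : t ≤ ℓ₁
      · rw [if_pos h1, if_pos (hst.trans h1)]
        exact ad _ ⟨hs.1, hst.trans h1⟩ _ ⟨ht.1, h1⟩
      · rw [if_neg h1]
        push Not at h1
        by_cases h2 : s ≤ ℓ₁
        · rw [if_pos h2]
          have e1 := ad s ⟨hs.1, h2⟩ ℓ₁ ⟨l1, le_rfl⟩
          have e2 := bd 0 ⟨le_rfl, l2⟩ (t - ℓ₁) ⟨by linarith, by linarith [ht.2]⟩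
          rw [a1] at e1
          rw [b0] at e2
          have := dist_triangle (τ₁ s) y (τ₂ (t - ℓ₁))
          rw [abs_sub_comm, abs_of_nonneg (by linarith)] at e1 e2 ⊢
          linarith
        · rw [if_neg h2]
          push Not at h2
          have := bd (s - ℓ₁) ⟨by linarith, by linarith [hs.2]⟩ (t - ℓ₁)
            ⟨by linarith, by linarith [ht.2]⟩
          simpa using this
    intro s hs t ht
    rcases le_total s t with h | h
    · exact main s hs t ht h
    · rw [dist_comm, abs_sub_comm]; exact main t ht s hs h

lemma ReachIn.continuousOn {S : Set X} {ℓ : ℝ} {x y : X} {τ : ℝ → X} (h : ReachIn S ℓ x y τ) :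
    ContinuousOn τ (Icc 0 ℓ) := by
  have : LipschitzOnWith 1 τ (Icc 0 ℓ) := LipschitzOnWith.of_dist_le_mul (by
    intro s hs t ht
    have := h.2.2.2.2 s hs t ht
    simpa [Real.dist_eq] using this)
  exact this.continuousOn

/-- sub-paths -/
lemma reach_sub {S : Set X} {ℓ : ℝ} {x y : X} {τ : ℝ → X} (h : ReachIn S ℓ x y τ) {s t : ℝ}
    (hs : 0 ≤ s) (hst : s ≤ t) (ht : t ≤ ℓ) :
    ReachIn S (t - s) (τ s) (τ t) (fun u => τ (s + u)) := by
  obtain ⟨l1, a0, a1, aS, ad⟩ := h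
  refine ⟨by linarith, by simp, by simp, ?_, ?_⟩
  · intro u hu
    exact aS _ ⟨by linarith [hu.1], by linarith [hu.2]⟩
  · intro u hu v hv
    have := ad (s+u) ⟨by linarith [hu.1], by linarith [hu.2]⟩ (s+v)
      ⟨by linarith [hv.1], by linarith [hv.2]⟩
    simpa using this

lemma reach_mono {S T : Set X} (hST : S ⊆ T) {ℓ : ℝ} {x y : X} {τ : ℝ → X}
    (h : ReachIn S ℓ x y τ) : ReachIn T ℓ x y τ :=
  ⟨h.1, h.2.1, h.2.2.1, fun t ht => hST (h.2.2.2.1 t ht), h.2.2.2.2⟩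

/-- Good arcs: geodesics in continua of finite length. -/
lemma exists_arc {S : Set X} (hS : IsCompact S) (hc : IsPreconnected S) (hf : μH[1] S ≠ ⊤)
    {x y : X} (hx : x ∈ S) (hy : y ∈ S) (hxy : x ≠ y) :
    ∃ ℓ > 0, ∃ τ, ReachIn S ℓ x y τ ∧ InjOn τ (Icc 0 ℓ) ∧
      ∀ s t, 0 ≤ s → s ≤ t → t ≤ ℓ → ENNReal.ofReal (t - s) ≤ 4 * μH[1] (τ '' Icc s t) := by
  set L := {ℓ : ℝ | ∃ τ, ReachIn S ℓ x y τ} with hL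
  have hne : L.Nonempty := ⟨_, reach_exists hS hc hf hx hy hxy⟩
  have hbdd : BddBelow L := ⟨0, fun ℓ ⟨τ, h⟩ => h.1⟩
  set ℓ := sInf L with hℓ
  have hℓ0 : 0 ≤ ℓ := le_csInf hne (fun ℓ ⟨τ, h⟩ => h.1)
  have hmem : ℓ ∈ L := by
    apply reach_limit hS hℓ0
    intro ε hε
    obtain ⟨m, ⟨τ, l1, a0, a1, aS, ad⟩, hm⟩ := exists_lt_of_csInf_lt hne
      (lt_add_of_pos_right (sInf L) hε)
    have hle : ℓ ≤ m := csInf_le hbdd ⟨τ, l1, a0, a1, aS, ad⟩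
    refine ⟨τ, by simp [a0, hε.le], ?_, fun t ht => aS t ⟨ht.1, ht.2.trans hle⟩, ?_⟩
    · have := ad ℓ ⟨hℓ0, hle⟩ m ⟨l1, le_rfl⟩
      rw [a1, abs_sub_comm, abs_of_nonneg (by linarith)] at this
      linarith
    · intro s hs t ht
      have := ad s ⟨hs.1, hs.2.trans hle⟩ t ⟨ht.1, ht.2.trans hle⟩
      linarith
  obtain ⟨τ, hτ⟩ := hmem
  have hpos : 0 < ℓ := by
    rcases hℓ0.lt_or_eq with h | h
    · exact h
    · exfalso; apply hxy
      rw [← hτ.2.1, ← hτ.2.2.1, ← h]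
  have splice : ∀ s t ℓ', 0 ≤ s → s ≤ t → t ≤ ℓ → (∃ σ, ReachIn S ℓ' (τ s) (τ t) σ) →
      t - s ≤ ℓ' := by
    rintro s t ℓ' hs hst ht ⟨σ, hσ⟩
    have r1 := reach_sub hτ le_rfl hs (hst.trans ht)
    have r3 := reach_sub hτ (hs.trans hst) ht le_rfl
    obtain ⟨_, r12⟩ := reach_trans r1 hσ
    obtain ⟨φ, hφ⟩ := reach_trans r12 r3
    rw [hτ.2.1, hτ.2.2.1] at hφ
    have := csInf_le hbdd (show _ ∈ L from ⟨φ, hφ⟩)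
    linarith
  have hinj : InjOn τ (Icc 0 ℓ) := by
    have key : ∀ s ∈ Icc 0 ℓ, ∀ t ∈ Icc 0 ℓ, s ≤ t → τ s = τ t → s = t := by
      intro s hs t ht hst h
      have := splice s t 0 hs.1 hst ht.2 ⟨fun _ => τ s, le_rfl, rfl, h, fun _ _ => hτ.2.2.2.1 s hs,
        fun a _ b _ => by simp⟩
      linarith
    intro s hs t ht h
    rcases le_total s t with h' | h'
    · exact key s hs t ht h' h
    · exact (key t ht s hs h' h.symm).symm
  refine ⟨ℓ, hpos, τ, hτ, hinj, ?_⟩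
  intro s t hs hst ht
  rcases hst.eq_or_lt with rfl | hlt
  · simp
  have hsub : Icc s t ⊆ Icc 0 ℓ := Icc_subset_Icc hs ht
  have hTS : τ '' Icc s t ⊆ S := by
    rintro _ ⟨u, hu, rfl⟩; exact hτ.2.2.2.1 u (hsub hu)
  have hTf : μH[1] (τ '' Icc s t) ≠ ⊤ := ne_top_of_le_ne_top hf (measure_mono hTS)
  have hcont := hτ.continuousOn.mono hsub
  obtain ⟨σ, hσ⟩ := reach_exists (isCompact_Icc.image_of_continuousOn hcont)
    (isPreconnected_Icc.image _ hcont) hTf ⟨s, ⟨le_rfl, hst⟩, rfl⟩ ⟨t, ⟨hst, le_rfl⟩, rfl⟩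
    (fun h => hlt.ne (hinj (hsub ⟨le_rfl, hst⟩) (hsub ⟨hst, le_rfl⟩) h))
  have := splice s t _ hs hst ht ⟨σ, reach_mono hTS hσ⟩
  calc ENNReal.ofReal (t - s) ≤ ENNReal.ofReal (4 * (μH[1] (τ '' Icc s t)).toReal) :=
        ENNReal.ofReal_le_ofReal this
    _ = _ := by
      rw [ENNReal.ofReal_mul (by norm_num), ENNReal.ofReal_toReal hTf]
      norm_num

end Metric

section P2
variable {X : Type*} [MetricSpace X] [MeasurableSpace X] [BorelSpace X]

lemma cc_closed {M : Set X} (hM : IsClosed M) (x : X) : IsClosed (connectedComponentIn M x) := by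
  by_cases hx : x ∈ M
  · have h1 : closure (connectedComponentIn M x) ⊆ connectedComponentIn M x := by
      apply IsPreconnected.subset_connectedComponentIn
      · exact isPreconnected_connectedComponentIn.closure
      · exact subset_closure (mem_connectedComponentIn hx)
      · exact closure_minimal (connectedComponentIn_subset M x) hM
    exact isClosed_of_closure_subset h1
  · rw [connectedComponentIn_eq_empty hx]; exact isClosed_empty

lemma cc_compact {M : Set X} (hM : IsCompact M) (x : X) : IsCompact (connectedComponentIn M x) :=
  hM.of_isClosed_subset (cc_closed hM.isClosed x) (connectedComponentIn_subset M x)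

lemma clopen_sep {M N : Set X} {x : X} (hM : IsCompact M) (hx : x ∈ M) (hN : IsClosed N)
    (hd : Disjoint N (connectedComponentIn M x)) :
    ∃ A ⊆ M, IsCompact A ∧ IsCompact (M \ A) ∧ connectedComponentIn M x ⊆ A ∧ Disjoint A N := by
  haveI : CompactSpace M := isCompact_iff_compactSpace.1 hM
  set x' : M := ⟨x, hx⟩
  have hcc := connectedComponentIn_eq_image hx
  have hI := connectedComponent_eq_iInter_isClopen x'
  set N' : Set M := Subtype.val ⁻¹' N
  have hN' : IsClosed N' := hN.preimage continuous_subtype_val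
  have hNe : N' ∩ ⋂ s : { s : Set M // IsClopen s ∧ x' ∈ s }, (s : Set M) = ∅ := by
    rw [← hI]
    rw [Set.eq_empty_iff_forall_notMem]
    rintro y ⟨hy1, hy2⟩
    refine Set.disjoint_left.1 hd hy1 ?_
    rw [hcc]; exact ⟨y, hy2, rfl⟩
  haveI : Nonempty { s : Set M // IsClopen s ∧ x' ∈ s } := ⟨⟨univ, isClopen_univ, mem_univ _⟩⟩
  obtain ⟨s, hs⟩ := hN'.isCompact.elim_directed_family_closed
    (fun s : { s : Set M // IsClopen s ∧ x' ∈ s } => (s : Set M))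
    (fun s => s.2.1.1) hNe (by
      intro s t
      refine ⟨⟨s.1 ∩ t.1, s.2.1.inter t.2.1, s.2.2, t.2.2⟩, ?_, ?_⟩
      · exact Set.inter_subset_left
      · exact Set.inter_subset_right)
  refine ⟨Subtype.val '' s.1, ?_, ?_, ?_, ?_, ?_⟩
  · rintro _ ⟨y, _, rfl⟩; exact y.2
  · exact (s.2.1.1.isCompact).image continuous_subtype_val
  · have : M \ Subtype.val '' s.1 = Subtype.val '' (s.1)ᶜ := by
      ext y; constructor
      · rintro ⟨h1, h2⟩
        exact ⟨⟨y, h1⟩, fun h => h2 ⟨_, h, rfl⟩, rfl⟩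
      · rintro ⟨z, hz, rfl⟩
        refine ⟨z.2, ?_⟩
        rintro ⟨w, hw, hwz⟩
        exact hz (Subtype.ext hwz ▸ hw)
    rw [this]
    exact (s.2.1.compl.1.isCompact).image continuous_subtype_val
  · rw [hcc, hI]
    exact Set.image_mono (Set.iInter_subset _ s)
  · rw [Set.disjoint_left]
    rintro _ ⟨y, hy, rfl⟩ hyN
    have : y ∈ N' ∩ s.1 := ⟨hyN, hy⟩
    rw [hs] at this; exact this

/-- Boundary bumping: component in a closed ball either is whole, or meets the sphere. -/
lemma bump [ProperSpace X] {Ω F C : Set X} (hF : IsClosed F) {x y : X} {r : ℝ}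
    (hr : Metric.closedBall x r ⊆ Ω) (hC : IsPreconnected C) (hCE : C ⊆ Ω ∩ F)
    (hy : y ∈ C) (hyr : dist y x < r) :
    C ⊆ connectedComponentIn (Ω ∩ F ∩ Metric.closedBall x r) y ∨
    ∃ z ∈ connectedComponentIn (Ω ∩ F ∩ Metric.closedBall x r) y, dist z x = r := by
  by_contra hcon
  push Not at hcon
  obtain ⟨h1, h2⟩ := hcon
  have hMeq : Ω ∩ F ∩ Metric.closedBall x r = F ∩ Metric.closedBall x r := by
    ext z; constructor
    · rintro ⟨⟨_, h⟩, h'⟩; exact ⟨h, h'⟩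
    · rintro ⟨h, h'⟩; exact ⟨⟨hr h', h⟩, h'⟩
  have hM : IsCompact (Ω ∩ F ∩ Metric.closedBall x r) := by
    rw [hMeq]; exact (isCompact_closedBall x r).inter_left hF
  have hyM : y ∈ Ω ∩ F ∩ Metric.closedBall x r := ⟨hCE hy, by
    rw [Metric.mem_closedBall]; exact hyr.le⟩
  obtain ⟨A, hAM, hA, hMA, hDA, hAN⟩ := clopen_sep hM hyM (N := Metric.sphere x r)
    Metric.isClosed_sphere (by
      rw [Set.disjoint_left]; intro z hz hz'; exact h2 z hz' hz)
  have hU : IsOpen (Metric.ball x r \ ((Ω ∩ F ∩ Metric.closedBall x r) \ A)) :=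
    Metric.isOpen_ball.sdiff hMA.isClosed
  have hV : IsOpen Aᶜ := hA.isClosed.isOpen_compl
  have hyA : y ∈ A := hDA (mem_connectedComponentIn hyM)
  have hAb : A ⊆ Metric.ball x r := by
    intro z hz
    have hz1 := (hAM hz).2
    rw [Metric.mem_closedBall] at hz1
    rw [Metric.mem_ball]
    refine lt_of_le_of_ne hz1 fun h => ?_
    exact Set.disjoint_left.1 hAN hz h
  have key := isPreconnected_iff_subset_of_disjoint.1 hC _ _ hU hV (by
      intro z hz
      by_cases hzA : z ∈ A
      · left; exact ⟨hAb hzA, fun h => h.2 hzA⟩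
      · right; exact hzA) (by
      rw [Set.eq_empty_iff_forall_notMem]
      rintro z ⟨hzC, ⟨hz1, hz2⟩, hz3⟩
      exact hz2 ⟨⟨hCE hzC, Metric.ball_subset_closedBall hz1⟩, hz3⟩)
  rcases key with h | h
  · exact h1 (hC.subset_connectedComponentIn hy fun z hz =>
      ⟨hCE hz, Metric.ball_subset_closedBall (h hz).1⟩)
  · exact h hy hyA

lemma cont_joined [ProperSpace X] {Ω F : Set X} (hΩ : IsOpen Ω) (hF : IsClosed F)
    (hfin : μH[1] (Ω ∩ F) ≠ ⊤) {x0 x y : X} (hx : x ∈ connectedComponentIn (Ω ∩ F) x0)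
    (hy : y ∈ connectedComponentIn (Ω ∩ F) x0) :
    ∃ K ⊆ connectedComponentIn (Ω ∩ F) x0, IsCompact K ∧ IsPreconnected K ∧ x ∈ K ∧ y ∈ K := by
  set C := connectedComponentIn (Ω ∩ F) x0 with hCdef
  have hCc : IsPreconnected C := isPreconnected_connectedComponentIn
  have hCE : C ⊆ Ω ∩ F := connectedComponentIn_subset _ _
  have hCx : ∀ x ∈ C, C = connectedComponentIn (Ω ∩ F) x := fun x hx => connectedComponentIn_eq hx
  refine hCc.induction₂' (fun x y => ∃ K ⊆ C, IsCompact K ∧ IsPreconnected K ∧ x ∈ K ∧ y ∈ K)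
    ?_ ?_ hx hy
  · intro x hx
    obtain ⟨r, hr0, hr⟩ := Metric.nhds_basis_closedBall.mem_iff.1 (hΩ.mem_nhds (hCE hx).1)
    set M := Ω ∩ F ∩ Metric.closedBall x r with hMdef
    have hMeq : M = F ∩ Metric.closedBall x r := by
      ext z; constructor
      · rintro ⟨⟨_, h⟩, h'⟩; exact ⟨h, h'⟩
      · rintro ⟨h, h'⟩; exact ⟨⟨hr h', h⟩, h'⟩
    have hM : IsCompact M := by
      rw [hMeq]; exact (isCompact_closedBall x r).inter_left hF
    have hDC : ∀ y ∈ C ∩ Metric.closedBall x r, connectedComponentIn M y ⊆ C := by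
      intro y hy
      rw [hCx y hy.1]
      exact connectedComponentIn_mono y inter_subset_left
    -- family of bad components
    let T : Set (Set X) := {D | ∃ y ∈ C ∩ Metric.ball x (r/2), D = connectedComponentIn M y ∧ x ∉ D}
    have hTbig : ∀ D ∈ T, ENNReal.ofReal (r/2) ≤ μH[1] D := by
      rintro D ⟨y, ⟨hyC, hyr⟩, rfl, hxD⟩
      rw [Metric.mem_ball] at hyr
      rcases bump hF hr hCc hCE hyC (by linarith) with h | ⟨z, hz, hzr⟩
      · exact absurd (h hx) hxD
      · have hyM : y ∈ M := ⟨hCE hyC, by rw [Metric.mem_closedBall]; linarith⟩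
        refine le_trans (ENNReal.ofReal_le_ofReal ?_) (hm_connected_ge
          isPreconnected_connectedComponentIn (mem_connectedComponentIn hyM) hz)
        have := dist_triangle z y x
        rw [dist_comm z y] at this
        linarith
    have hTd : ∀ D ∈ T, ∀ D' ∈ T, D ≠ D' → Disjoint D D' := by
      rintro D ⟨y, _, rfl, _⟩ D' ⟨y', _, rfl, _⟩ hne
      by_contra h
      rw [Set.not_disjoint_iff] at h
      obtain ⟨z, hz, hz'⟩ := h
      exact hne ((connectedComponentIn_eq hz).trans (connectedComponentIn_eq hz').symm)
    have hTcl : ∀ D ∈ T, IsClosed D := by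
      rintro D ⟨y, _, rfl, _⟩; exact cc_closed hM.isClosed y
    have hTfin : T.Finite := by
      have := Measure.finite_const_le_meas_of_disjoint_iUnion (ι := T) (μH[1] : Measure X)
        (ε := ENNReal.ofReal (r/2)) (by simpa using by linarith) (As := fun D => (D : Set X))
        (fun D => (hTcl D D.2).measurableSet)
        (fun D D' h => hTd D D.2 D' D'.2 (fun h' => h (Subtype.ext h')))
        (by
          refine ne_top_of_le_ne_top hfin (measure_mono ?_)
          refine iUnion_subset fun D => ?_
          obtain ⟨y, _, h, _⟩ := D.2
          rw [h]
          exact (connectedComponentIn_subset _ _).trans inter_subset_left)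
      have h2 : {i : T | ENNReal.ofReal (r/2) ≤ μH[1] (i : Set X)} = univ := by
        ext i; simpa using hTbig i i.2
      rw [h2] at this
      exact Set.finite_coe_iff.1 (Set.finite_univ_iff.1 this)
    have hTU : IsClosed (⋃₀ T) := by
      rw [sUnion_eq_biUnion]; exact Set.Finite.isClosed_biUnion hTfin hTcl
    have hxT : x ∉ ⋃₀ T := by
      rintro ⟨D, ⟨y, _, _, h⟩, hxD⟩; exact h hxD
    have hnb : ∀ᶠ y in 𝓝[C] x, y ∈ C ∧ y ∈ Metric.ball x (r/2) ∧ y ∉ ⋃₀ T := by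
      filter_upwards [self_mem_nhdsWithin,
        mem_nhdsWithin_of_mem_nhds (Metric.ball_mem_nhds x (half_pos hr0)),
        mem_nhdsWithin_of_mem_nhds (hTU.isOpen_compl.mem_nhds hxT)] with y h1 h2 h3
      exact ⟨h1, h2, h3⟩
    filter_upwards [hnb] with y ⟨hyC, hyr, hyT⟩
    have hyr' : y ∈ Metric.closedBall x r :=
      Metric.ball_subset_closedBall (Metric.ball_subset_ball (by linarith) hyr)
    have hyM : y ∈ M := ⟨hCE hyC, hyr'⟩
    have hxD : x ∈ connectedComponentIn M y := by
      by_contra h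
      exact hyT ⟨_, ⟨y, ⟨hyC, hyr⟩, rfl, h⟩, mem_connectedComponentIn hyM⟩
    refine ⟨⟨_, hDC y ⟨hyC, hyr'⟩, cc_compact hM y, isPreconnected_connectedComponentIn, hxD,
      mem_connectedComponentIn hyM⟩, ⟨_, hDC y ⟨hyC, hyr'⟩, cc_compact hM y,
      isPreconnected_connectedComponentIn, 
      mem_connectedComponentIn hyM, hxD⟩⟩
  · rintro x y z _ _ _ ⟨K, hK, hKc, hKp, hx, hy⟩ ⟨K', hK', hKc', hKp', hy', hz⟩
    exact ⟨K ∪ K', union_subset hK hK', hKc.union hKc', IsPreconnected.union y hy hy' hKp hKp',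
      Or.inl hx, Or.inr hz⟩

lemma cc_eq_closure {E : Set X} {x : X} (hx : x ∈ E) :
    connectedComponentIn E x = closure (connectedComponentIn E x) ∩ E := by
  apply Subset.antisymm
  · exact subset_inter subset_closure (connectedComponentIn_subset _ _)
  · apply IsPreconnected.subset_connectedComponentIn
    · exact isPreconnected_connectedComponentIn.subset_closure
        (subset_inter subset_closure (connectedComponentIn_subset _ _)) inter_subset_left
    · exact ⟨subset_closure (mem_connectedComponentIn hx), hx⟩
    · exact inter_subset_right

lemma connstar_countable {E : Set X} (hE : MeasurableSet E) (hfin : μH[1] E ≠ ⊤) :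
    {C | (∃ x ∈ E, C = connectedComponentIn E x) ∧ ¬ C.Subsingleton}.Countable := by
  set T := {C | (∃ x ∈ E, C = connectedComponentIn E x) ∧ ¬ C.Subsingleton}
  have := Measure.countable_meas_pos_of_disjoint_of_meas_iUnion_ne_top (ι := T)
    (μ := (μH[1] : Measure X)) (As := fun D => (D : Set X)) (by
      rintro ⟨C, ⟨x, hx, rfl⟩, h⟩
      dsimp only
      rw [cc_eq_closure hx]
      exact isClosed_closure.measurableSet.inter hE) (by
      rintro ⟨C, ⟨x, hx, rfl⟩, h⟩ ⟨C', ⟨x', hx', rfl⟩, h'⟩ hne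
      by_contra hh
      simp only [Function.onFun] at hh
      rw [Set.not_disjoint_iff] at hh
      obtain ⟨z, hz, hz'⟩ := hh
      exact hne (Subtype.ext ((connectedComponentIn_eq hz).trans (connectedComponentIn_eq hz').symm)))
      (by
        refine ne_top_of_le_ne_top hfin (measure_mono ?_)
        refine iUnion_subset fun D => ?_
        obtain ⟨x, _, h⟩ := D.2.1
        rw [h]; exact connectedComponentIn_subset _ _)
  have h2 : {i : T | 0 < μH[1] (i : Set X)} = univ := by
    ext ⟨C, ⟨x, hx, rfl⟩, h⟩
    simp only [mem_setOf_eq, mem_univ, iff_true]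
    rw [Set.not_subsingleton_iff] at h
    obtain ⟨p, hp, q, hq, hpq⟩ := h
    exact hm_connected_pos isPreconnected_connectedComponentIn hp hq hpq
  rw [h2] at this
  exact Set.countable_coe_iff.1 (Set.countable_univ_iff.1 this)

end P2

section P3
variable {X : Type*} [MetricSpace X] [MeasurableSpace X] [BorelSpace X]

/-- Upper integral bound for the slices of `A` by level sets of `f`. -/
def Pm (f : X → ℝ) (A : Set X) (c : ℝ≥0∞) : Prop :=
  ∃ g : ℝ → ℝ≥0∞, Measurable g ∧ (∀ h, μH[1] (A ∩ f ⁻¹' {h}) ≤ g h) ∧ ∫⁻ h, g h ≤ c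

lemma Pm.mono {f : X → ℝ} {A B : Set X} {c d : ℝ≥0∞} (h : Pm f A c) (hBA : B ⊆ A) (hcd : c ≤ d) :
    Pm f B d := by
  obtain ⟨g, hg, h1, h2⟩ := h
  exact ⟨g, hg, fun t => (measure_mono (inter_subset_inter_left _ hBA)).trans (h1 t), h2.trans hcd⟩

lemma Pm.iUnion {f : X → ℝ} {A : ℕ → Set X} (hA : Monotone A) {c : ℝ≥0∞} (h : ∀ n, Pm f (A n) c) :
    Pm f (⋃ n, A n) c := by
  choose g hg h1 h2 using h
  refine ⟨fun t => liminf (fun n => g n t) atTop, Measurable.liminf hg, ?_, ?_⟩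
  · intro t
    rw [iUnion_inter]
    have hm : Monotone fun n => A n ∩ f ⁻¹' {t} := fun i j hij =>
      inter_subset_inter_left _ (hA hij)
    rw [hm.measure_iUnion]
    refine iSup_le fun n => ?_
    refine le_liminf_of_le (by isBoundedDefault) ?_
    filter_upwards [eventually_ge_atTop n] with m hmn
    exact (measure_mono (hm hmn)).trans (h1 m t)
  · refine (lintegral_liminf_le hg).trans ?_
    refine liminf_le_of_frequently_le' (Frequently.of_forall h2)

lemma Pm.ae_zero {f : X → ℝ} {A : Set X} (h : ∀ n : ℕ, ∃ c, Pm f A c ∧ c ≤ ((n : ℝ≥0∞) + 1)⁻¹) :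
    ∀ᵐ t : ℝ, μH[1] (A ∩ f ⁻¹' {t}) = 0 := by
  have h' : ∀ n : ℕ, Pm f A ((n : ℝ≥0∞) + 1)⁻¹ := fun n => by
    obtain ⟨c, h1, h2⟩ := h n
    exact h1.mono subset_rfl h2
  choose g hg h1 h2 using h'
  have hle : ∀ t, μH[1] (A ∩ f ⁻¹' {t}) ≤ ⨅ n, g n t := fun t => le_iInf fun n => h1 n t
  have h0 : ∫⁻ t, ⨅ n, g n t = 0 := by
    refine le_antisymm ?_ bot_le
    have : ∀ n : ℕ, ∫⁻ t, ⨅ n, g n t ≤ ((n : ℝ≥0∞) + 1)⁻¹ := fun n =>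
      (lintegral_mono fun t => iInf_le _ n).trans (h2 n)
    have h3 : Tendsto (fun n : ℕ => ((n + 1 : ℕ) : ℝ≥0∞)⁻¹) atTop (𝓝 0) :=
      ENNReal.tendsto_inv_nat_nhds_zero.comp (tendsto_add_atTop_nat 1)
    refine ge_of_tendsto' h3 fun n => ?_
    simpa using this n
  rw [lintegral_eq_zero_iff (Measurable.iInf hg)] at h0
  filter_upwards [h0] with t ht
  exact le_antisymm ((hle t).trans ht.le) bot_le

lemma Pm.ae_fin {f : X → ℝ} {A : Set X} {c : ℝ≥0∞} (h : Pm f A c) (hc : c ≠ ⊤) :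
    ∀ᵐ t : ℝ, μH[1] (A ∩ f ⁻¹' {t}) ≠ ⊤ := by
  obtain ⟨g, hg, h1, h2⟩ := h
  filter_upwards [ae_lt_top hg (ne_top_of_le_ne_top hc h2)] with t ht
  exact ne_top_of_le_ne_top ht.ne (h1 t)

lemma pm_lip {f : X → ℝ} {A : Set X} {ε : ℝ≥0} {r0 : ℝ} (hr0 : 0 < r0)
    (hf : ∀ x ∈ A, ∀ y ∈ A, dist x y < r0 → |f x - f y| ≤ ε * dist x y)
    (hA : μH[2] A ≠ ⊤) : Pm f A (2 * ε * μH[2] A) := by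
  -- covers
  have hcov : ∀ n : ℕ, ∃ t : ℕ → Set X, A ⊆ ⋃ i, t i ∧
      (∀ i, Metric.ediam (t i) ≤ min (ENNReal.ofReal (r0/2)) ((n + 1 : ℕ) : ℝ≥0∞)⁻¹) ∧
      ∑' i, ⨆ _ : (t i).Nonempty, Metric.ediam (t i) ^ (2:ℝ) ≤ μH[2] A + ((n + 1 : ℕ) : ℝ≥0∞)⁻¹ := by
    intro n
    have hpos : 0 < min (ENNReal.ofReal (r0/2)) ((n + 1 : ℕ) : ℝ≥0∞)⁻¹ := by
      refine lt_min ?_ ?_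
      · simpa using by linarith
      · rw [ENNReal.inv_pos]; exact ENNReal.natCast_ne_top _
    have h1 := Measure.hausdorffMeasure_apply 2 A
    have h2 : (⨅ (t : ℕ → Set X) (_ : A ⊆ ⋃ n, t n) (_ : ∀ i, Metric.ediam (t i) ≤
        min (ENNReal.ofReal (r0/2)) ((n + 1 : ℕ) : ℝ≥0∞)⁻¹),
          ∑' n, ⨆ _ : (t n).Nonempty, Metric.ediam (t n) ^ (2:ℝ)) <
          μH[2] A + ((n + 1 : ℕ) : ℝ≥0∞)⁻¹ := by
      refine lt_of_le_of_lt ?_ (ENNReal.lt_add_right hA (b := ((n + 1 : ℕ) : ℝ≥0∞)⁻¹) ?_)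
      · rw [h1]
        exact le_iSup₂ (f := fun (r : ℝ≥0∞) (_ : 0 < r) => 
          ⨅ (t : ℕ → Set X) (_ : A ⊆ ⋃ n, t n) (_ : ∀ n, Metric.ediam (t n) ≤ r),
          ∑' n, ⨆ _ : (t n).Nonempty, Metric.ediam (t n) ^ (2:ℝ)) _ hpos
      · rw [Ne, ENNReal.inv_eq_zero]; exact ENNReal.natCast_ne_top _
    simp only [iInf_lt_iff] at h2
    obtain ⟨t, ht1, ht2, ht3⟩ := h2
    exact ⟨t, ht1, ht2, ht3.le⟩
  choose t ht1 ht2 ht3 using hcov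
  classical
  -- centre points
  let p : ℕ → ℕ → ℝ := fun n i => if h : (t n i ∩ A).Nonempty then f h.some else 0
  let J : ℕ → ℕ → Set ℝ := fun n i => 
    if (t n i ∩ A).Nonempty then Metric.closedBall (p n i) (ε * (Metric.ediam (t n i)).toReal) else ∅
  have hJm : ∀ n i, MeasurableSet (J n i) := by
    intro n i; simp only [J]; split_ifs
    · exact Metric.isClosed_closedBall.measurableSet
    · exact MeasurableSet.empty
  have hfinite : ∀ n i, Metric.ediam (t n i) ≠ ⊤ := fun n i =>
    ne_top_of_le_ne_top ENNReal.ofReal_ne_top ((ht2 n i).trans (min_le_left _ _))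
  have hJ : ∀ n i x, x ∈ t n i → x ∈ A → f x ∈ J n i := by
    intro n i x hx hxA
    have hne : (t n i ∩ A).Nonempty := ⟨x, hx, hxA⟩
    simp only [J, p, if_pos hne, dif_pos hne]
    rw [Metric.mem_closedBall, Real.dist_eq]
    have hd : edist x hne.some ≤ Metric.ediam (t n i) :=
      Metric.edist_le_ediam_of_mem hx hne.some_mem.1
    have hd' : dist x hne.some ≤ (Metric.ediam (t n i)).toReal := by
      rw [dist_edist]; exact ENNReal.toReal_mono (hfinite n i) hd
    have hd2 : dist x hne.some ≤ r0/2 := by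
      rw [dist_edist]
      refine ENNReal.toReal_le_of_le_ofReal (by linarith) (hd.trans ((ht2 n i).trans (min_le_left _ _)))
    refine (hf x hxA _ hne.some_mem.2 (by linarith)).trans ?_
    gcongr
  have hJv : ∀ n i, volume (J n i) ≤ 2 * ε * (⨆ _ : (t n i).Nonempty, Metric.ediam (t n i)) := by
    intro n i; simp only [J]; split_ifs with h
    · rw [Real.volume_closedBall, iSup_pos h.left]
      rw [ENNReal.ofReal_mul (by norm_num), ENNReal.ofReal_mul (by positivity),
        ENNReal.ofReal_toReal (hfinite n i), mul_assoc]
      simp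
    · simp
  let G : ℕ → ℝ → ℝ≥0∞ := fun n h => ∑' i, (J n i).indicator (fun _ => Metric.ediam (t n i)) h
  have hGm : ∀ n, Measurable (G n) := fun n =>
    Measurable.ennreal_tsum fun i => measurable_const.indicator (hJm n i)
  have hlim : Tendsto (fun n : ℕ => ((n + 1 : ℕ) : ℝ≥0∞)⁻¹) atTop (𝓝 0) :=
      ENNReal.tendsto_inv_nat_nhds_zero.comp (tendsto_add_atTop_nat 1)
  refine ⟨fun h => liminf (fun n => G n h) atTop, Measurable.liminf hGm, ?_, ?_⟩
  · intro h
    refine (Measure.hausdorffMeasure_le_liminf_tsum (ι := fun _ => ℕ) 1 _ _ hlim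
      (fun n i => t n i ∩ (A ∩ f ⁻¹' {h})) ?_ ?_).trans ?_
    · refine Eventually.of_forall fun n i => ?_
      exact (Metric.ediam_mono inter_subset_left).trans ((ht2 n i).trans (min_le_right _ _))
    · refine Eventually.of_forall fun n x hx => ?_
      obtain ⟨i, hi⟩ := mem_iUnion.1 (ht1 n hx.1)
      exact mem_iUnion.2 ⟨i, hi, hx⟩
    · refine liminf_le_liminf (Eventually.of_forall fun n => ?_)
      refine ENNReal.tsum_le_tsum fun i => ?_
      rw [ENNReal.rpow_one]
      rcases (t n i ∩ (A ∩ f ⁻¹' {h})).eq_empty_or_nonempty with he | ⟨x, hx1, hx2, hx3⟩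
      · rw [he]; simp
      · have : h ∈ J n i := by
          have := hJ n i x hx1 hx2
          rwa [show f x = h from hx3] at this
        rw [indicator_of_mem this]
        exact Metric.ediam_mono inter_subset_left
  · refine (lintegral_liminf_le hGm).trans ?_
    have hb : ∀ n, ∫⁻ h, G n h ≤ 2 * ε * (μH[2] A + ((n + 1 : ℕ) : ℝ≥0∞)⁻¹) := by
      intro n
      simp only [G]
      rw [lintegral_tsum fun i => (measurable_const.indicator (hJm n i)).aemeasurable]
      have : ∀ i, ∫⁻ h, (J n i).indicator (fun _ => Metric.ediam (t n i)) h ≤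
          2 * ε * (⨆ _ : (t n i).Nonempty, Metric.ediam (t n i) ^ (2:ℝ)) := by
        intro i
        rw [lintegral_indicator (hJm n i), setLIntegral_const]
        refine (mul_le_mul_right (hJv n i) _).trans ?_
        by_cases hne : (t n i).Nonempty
        · rw [iSup_pos hne, iSup_pos hne, ENNReal.rpow_two, sq]
          exact le_of_eq (by ring)
        · simp [hne]
      refine (ENNReal.tsum_le_tsum this).trans ?_
      rw [ENNReal.tsum_mul_left]
      gcongr
      exact ht3 n
    refine (liminf_le_liminf (Eventually.of_forall hb)).trans ?_
    refine (Tendsto.liminf_eq ?_).le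
    have : Tendsto (fun n : ℕ => 2 * (ε : ℝ≥0∞) * (μH[2] A + ((n + 1 : ℕ) : ℝ≥0∞)⁻¹)) atTop
        (𝓝 (2 * ε * (μH[2] A + 0))) := by
      refine ENNReal.Tendsto.const_mul (tendsto_const_nhds.add hlim) (Or.inr ?_)
      exact ENNReal.mul_ne_top (by norm_num) ENNReal.coe_ne_top
    simpa using this

lemma level_ae {f : ℂ → ℝ} {K : ℝ≥0} (hf : LipschitzWith K f) {S : Set ℂ}
    (hS : Bornology.IsBounded S) :
    ∀ᵐ h : ℝ, μH[1] (S ∩ f ⁻¹' {h}) ≠ ⊤ ∧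
      μH[1] (S ∩ {x | ¬ (DifferentiableAt ℝ f x ∧ fderiv ℝ f x ≠ 0)} ∩ f ⁻¹' {h}) = 0 := by
  haveI hH : (μH[2] : Measure ℂ).IsAddHaarMeasure := by
    have := MeasureTheory.isAddHaarMeasure_hausdorffMeasure (E := ℂ)
    simpa [Complex.finrank_real_complex] using this
  have hSf : (μH[2] : Measure ℂ) S ≠ ⊤ := hS.measure_lt_top.ne
  have hlip : ∀ x ∈ S, ∀ y ∈ S, dist x y < 1 → |f x - f y| ≤ K * dist x y := fun x _ y _ _ => by
    rw [← Real.dist_eq]; exact hf.dist_le_mul x y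
  have h1 := (pm_lip one_pos hlip hSf).ae_fin
    (ENNReal.mul_ne_top (ENNReal.mul_ne_top (by norm_num) ENNReal.coe_ne_top) hSf)
  have h2 : ∀ᵐ h : ℝ, μH[1] (({x | ¬ DifferentiableAt ℝ f x}) ∩ f ⁻¹' {h}) = 0 := by
    have hnull : (μH[2] : Measure ℂ) {x | ¬ DifferentiableAt ℝ f x} = 0 :=
      hf.ae_differentiableAt
    apply Pm.ae_zero
    intro n
    refine ⟨_, pm_lip one_pos (ε := K) (fun x _ y _ _ => by
      rw [← Real.dist_eq]; exact hf.dist_le_mul x y) (by rw [hnull]; simp), ?_⟩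
    rw [hnull]; simp
  have h3 : ∀ᵐ h : ℝ, μH[1] ((S ∩ {x | DifferentiableAt ℝ f x ∧ fderiv ℝ f x = 0}) ∩ f ⁻¹' {h}) = 0 := by
    apply Pm.ae_zero
    intro n
    obtain ⟨ε, hε0, hε⟩ : ∃ ε : ℝ≥0, 0 < ε ∧ 2 * (ε:ℝ≥0∞) * μH[2] S ≤ ((n : ℝ≥0∞) + 1)⁻¹ := by
      obtain ⟨c, hc0, hc⟩ := ENNReal.exists_nnreal_pos_mul_lt (a := 2 * μH[2] S)
        (b := ((n : ℝ≥0∞) + 1)⁻¹) (ENNReal.mul_ne_top (by norm_num) hSf) (by simp)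
      refine ⟨c, hc0, ?_⟩
      calc 2 * (c:ℝ≥0∞) * μH[2] S = c * (2 * μH[2] S) := by ring
        _ ≤ _ := hc.le
    refine ⟨_, ?_, hε⟩
    let Z : ℕ → Set ℂ := fun m => S ∩ {x | ∀ y, dist y x < 1/((m:ℝ)+1) → |f y - f x| ≤ ε * dist y x}
    have hZ : Monotone Z := by
      intro i j hij x hx
      refine ⟨hx.1, fun y hy => hx.2 y (hy.trans_le ?_)⟩
      have : (i:ℝ) ≤ j := by exact_mod_cast hij
      gcongr
    have hP : Pm f (⋃ m, Z m) (2 * (ε:ℝ≥0∞) * μH[2] S) := by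
      apply Pm.iUnion hZ
      intro m
      have hZS : (μH[2] : Measure ℂ) (Z m) ≤ μH[2] S := measure_mono inter_subset_left
      refine (pm_lip (r0 := 1/((m:ℝ)+1)) (by positivity) (ε := ε) ?_
        (ne_top_of_le_ne_top hSf hZS)).mono subset_rfl (by gcongr)
      intro x hx y hy hxy
      exact hy.2 x hxy
    refine hP.mono ?_ le_rfl
    rintro x ⟨hxS, hxd, hx0⟩
    have hd := hxd.hasFDerivAt
    rw [hx0] at hd
    have hlo := (hasFDerivAt_iff_isLittleO.1 hd).def (c := ε) (by exact_mod_cast hε0)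
    obtain ⟨δ, hδ, hb⟩ := Metric.eventually_nhds_iff.1 hlo
    obtain ⟨m, hm⟩ := exists_nat_one_div_lt hδ
    refine mem_iUnion.2 ⟨m, hxS, fun y hy => ?_⟩
    have := hb (hy.trans hm)
    simpa [dist_eq_norm] using this
  filter_upwards [h1, h2, h3] with h a1 a2 a3
  refine ⟨a1, ?_⟩
  refine measure_mono_null ?_ (measure_union_null a2 a3)
  rintro x ⟨⟨hxS, hx⟩, hxh⟩
  by_cases hd : DifferentiableAt ℝ f x
  · right
    exact ⟨⟨hxS, hd, by by_contra h; exact hx ⟨hd, h⟩⟩, hxh⟩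
  · left; exact ⟨hd, hxh⟩

end P3

section P4a

lemma log_lift {G : ℝ × ℝ → ℂ} (hG : Continuous G) (h0 : ∀ p, G p ≠ 0) :
    ∃ L : ℝ × ℝ → ℂ, Continuous L ∧ ∀ p, Complex.exp (L p) = G p := by
  obtain ⟨f, ⟨-, hf⟩, -⟩ := Complex.isCoveringMapOn_exp.existsUnique_continuousMap_lifts
    (⟨G, hG⟩ : C(ℝ × ℝ, ℂ)) (a₀ := (0, 0)) (e₀ := Complex.log (G (0,0))) (Complex.exp_log (h0 _)) 
    (fun x ↦ h0 x)
  exact ⟨f, f.continuous, fun p => congr_fun hf p⟩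

lemma exp_one_const {s : Set ℝ} (hs : IsPreconnected s) {D : ℝ → ℂ} (hD : ContinuousOn D s)
    {k : ℂ} (h1 : ∀ t ∈ s, Complex.exp (D t) = k) {a b : ℝ} (ha : a ∈ s) (hb : b ∈ s) : D a = D b := by
  have hne : ∀ t ∈ s, ∃ n : ℤ, D t - D a = n * (2 * Real.pi * Complex.I) := by
    intro t ht
    rw [← Complex.exp_eq_one_iff, Complex.exp_sub, h1 t ht, h1 a ha]
    refine div_self ?_
    rw [← h1 a ha]; exact Complex.exp_ne_zero _
  have hT : DiscreteTopology (range ((↑) : ℤ → ℝ)) :=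
    (Int.isClosedEmbedding_coe_real.isEmbedding.toHomeomorph).symm.isEmbedding.discreteTopology
  have hpi : (2 * Real.pi) ≠ 0 := by positivity
  have hm : MapsTo (fun t => (D t - D a).im / (2 * Real.pi)) s (range ((↑) : ℤ → ℝ)) := by
    intro t ht
    obtain ⟨n, hn⟩ := hne t ht
    refine ⟨n, ?_⟩
    simp only [hn]
    simp
  have hc : ContinuousOn (fun t => (D t - D a).im / (2 * Real.pi)) s := by
    refine ContinuousOn.div_const (Complex.continuous_im.comp_continuousOn ?_) _
    exact hD.sub continuousOn_const
  have := hs.constant_of_mapsTo ⟨hT⟩ hc hm ha hb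
  simp only [sub_self, Complex.zero_im, zero_div] at this
  obtain ⟨n, hn⟩ := hne b hb
  rw [hn] at this
  have hn0 : (n : ℝ) = 0 := by
    simpa using this.symm
  have hn1 : (n : ℂ) = 0 := by exact_mod_cast hn0
  rw [hn1, zero_mul, sub_eq_zero] at hn
  exact hn.symm

lemma log_change {s : Set ℝ} (hs : IsPreconnected s) {L G : ℝ → ℂ} (hL : ContinuousOn L s)
    (hG : ContinuousOn G s) (hLG : ∀ t ∈ s, Complex.exp (L t) = G t) {c : ℂ} 
    (hsl : ∀ t ∈ s, c * G t ∈ Complex.slitPlane) {a b : ℝ} (ha : a ∈ s) (hb : b ∈ s) :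
    L b - L a = Complex.log (c * G b) - Complex.log (c * G a) := by
  have hc : ContinuousOn (fun t => L t - Complex.log (c * G t)) s :=
    hL.sub ((continuousOn_const.mul hG).clog hsl)
  have hx : ∀ t ∈ s, Complex.exp (L t - Complex.log (c * G t)) = c⁻¹ := by
    intro t ht
    have hne : c * G t ≠ 0 := Complex.slitPlane_ne_zero (hsl t ht)
    rw [Complex.exp_sub, Complex.exp_log hne, hLG t ht]
    have h1 := left_ne_zero_of_mul hne
    have h2 := right_ne_zero_of_mul hne
    field_simp
  have := exp_one_const hs hc hx ha hb
  linear_combination (-1 : ℂ) * this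

/-- Degree lemma. -/
lemma degree_lemma {f : ℂ → ℝ} (hf : Continuous f) {A B : Set ℂ} (hA : IsClosed A) (hB : IsClosed B)
    {r0 R : ℝ} (hr0 : 0 < r0) (hR : 0 < R) (hAB : ∀ z ∈ A, z ∈ B → z = 0)
    (hz : ∀ z, ‖z‖ ≤ R → f z = 0 → z ∈ A ∨ z ∈ B)
    (hAr : ∀ z, 0 < ‖z‖ → ‖z‖ ≤ r0 → f z = 0 → z ∈ A → z.re < 0)
    (hBr : ∀ z, 0 < ‖z‖ → ‖z‖ ≤ r0 → f z = 0 → z ∈ B → 0 < z.re)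
    (hp : ∀ ρ : ℝ, 0 < ρ → ρ ≤ r0 → 0 < f (ρ * Complex.I))
    (hn : ∀ ρ : ℝ, 0 < ρ → ρ ≤ r0 → f (-(ρ * Complex.I)) < 0)
    (hs : ∀ z, ‖z‖ = R → f z = 0 → z ∉ A) : False := by
  set ρ := min r0 R with hρ
  have hρ0 : 0 < ρ := lt_min hr0 hR
  have hρr : ρ ≤ r0 := min_le_left _ _
  have hρR : ρ ≤ R := min_le_right _ _
  have hcl : IsClosed {z : ℂ | ρ ≤ ‖z‖} := isClosed_le continuous_const continuous_norm
  obtain ⟨u, hu0, hu1, -⟩ := exists_continuous_zero_one_of_isClosed (hA.inter hcl) (hB.inter hcl) (by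
    rw [Set.disjoint_left]
    rintro z ⟨h1, h2⟩ ⟨h3, -⟩
    have := hAB z h1 h3
    subst this
    simp only [mem_ofPred_eq, norm_zero] at h2
    linarith)
  let cl : ℝ → ℝ := fun t => max ρ (min R t)
  have hclc : Continuous cl := by fun_prop
  have hcl1 : ∀ t, ρ ≤ cl t := fun t => le_max_left _ _
  have hcl2 : ∀ t, cl t ≤ R := fun t => max_le hρR (min_le_left _ _)
  let g : ℂ → ℂ := fun z => ((2 * u z - 1 : ℝ) : ℂ) + (f z : ℂ) * Complex.I
  have hg : Continuous g := by
    have := u.continuous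
    fun_prop
  have hgre : ∀ z, (g z).re = 2 * u z - 1 := fun z => by simp [g]
  have hgim : ∀ z, (g z).im = f z := fun z => by simp [g]
  let zz : ℝ × ℝ → ℂ := fun p => (cl p.1 : ℂ) * Complex.exp (p.2 * Complex.I)
  have hzz : Continuous zz := by
    have : Continuous fun p : ℝ × ℝ => cl p.1 := hclc.comp continuous_fst
    fun_prop
  have hzn : ∀ p, ‖zz p‖ = cl p.1 := fun p => by
    simp only [zz, norm_mul, Complex.norm_exp_ofReal_mul_I, mul_one, Complex.norm_real, Real.norm_eq_abs]
    exact abs_of_pos (hρ0.trans_le (hcl1 _))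
  have hzre : ∀ p, (zz p).re = cl p.1 * Real.cos p.2 := fun p => by
    simp only [zz, Complex.re_ofReal_mul, Complex.exp_ofReal_mul_I_re]
  have hgA : ∀ z, ρ ≤ ‖z‖ → z ∈ A → (g z).re = -1 := fun z h1 h2 => by
    rw [hgre, hu0 ⟨h2, h1⟩]; simp
  have hgB : ∀ z, ρ ≤ ‖z‖ → z ∈ B → (g z).re = 1 := fun z h1 h2 => by
    rw [hgre, hu1 ⟨h2, h1⟩]; norm_num
  have hne : ∀ p, g (zz p) ≠ 0 := by
    intro p h0
    have h1 : f (zz p) = 0 := by rw [← hgim, h0]; simp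
    have hn1 : ρ ≤ ‖zz p‖ := by rw [hzn]; exact hcl1 _
    rcases hz (zz p) (by rw [hzn]; exact hcl2 _) h1 with h | h
    · have := hgA _ hn1 h; rw [h0] at this; simp at this
    · have := hgB _ hn1 h; rw [h0] at this; simp at this
  obtain ⟨L, hLc, hL⟩ := log_lift (hg.comp hzz) hne
  have hper : ∀ t, zz (t, 3 * Real.pi / 2) = zz (t, -(Real.pi/2)) := by
    intro t
    simp only [zz]
    congr 1
    rw [Complex.exp_eq_exp_iff_exists_int]
    refine ⟨1, ?_⟩
    push_cast; ring
  -- difference constant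
  have hconst := exp_one_const (s := univ) isPreconnected_univ
    (D := fun t => L (t, 3 * Real.pi / 2) - L (t, -(Real.pi/2))) (by
      apply Continuous.continuousOn; fun_prop) (k := 1) (by
      intro t _
      rw [Complex.exp_sub, hL, hL]
      simp only [Function.comp]
      rw [hper]; exact div_self (hne _)) (mem_univ R) (mem_univ ρ)
  have hclR : cl R = R := by simp [cl, hρR]
  have hclρ : cl ρ = ρ := by simp [cl, hρR]
  have hpi := Real.pi_pos
  have hslit : ∀ t c, ∀ a b : ℝ, a ≤ b → (∀ θ ∈ Icc a b, c * g (zz (t, θ)) ∈ Complex.slitPlane) →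
      L (t, b) - L (t, a) = Complex.log (c * g (zz (t, b))) - Complex.log (c * g (zz (t, a))) := by
    intro t c a b hab h
    exact log_change (s := Icc a b) isPreconnected_Icc (L := fun θ => L (t, θ))
      (G := fun θ => g (zz (t, θ))) (by apply Continuous.continuousOn; fun_prop)
      (by apply Continuous.continuousOn; fun_prop) (fun θ _ => hL _) h
      (left_mem_Icc.2 hab) (right_mem_Icc.2 hab)
  have e1 := hslit R 1 (-(Real.pi/2)) (3 * Real.pi/2) (by linarith) (by
    intro θ _
    rw [one_mul, Complex.mem_slitPlane_iff]
    by_cases h : f (zz (R, θ)) = 0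
    · left
      have hnR : ‖zz (R, θ)‖ = R := by rw [hzn, hclR]
      rcases hz _ hnR.le h with h' | h'
      · exact absurd h' (hs _ hnR h)
      · rw [hgB _ (by rw [hnR]; exact hρR) h']; norm_num
    · right; rw [hgim]; exact h)
  rw [hper, sub_self] at e1
  have hnρ : ∀ θ, ‖zz (ρ, θ)‖ = ρ := fun θ => by rw [hzn, hclρ]
  have e2 := hslit ρ 1 (-(Real.pi/2)) (Real.pi/2) (by linarith) (by
    intro θ hθ
    rw [one_mul, Complex.mem_slitPlane_iff]
    by_cases h : f (zz (ρ, θ)) = 0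
    · left
      rcases hz _ (by rw [hnρ]; exact hρR) h with h' | h'
      · have := hAr _ (by rw [hnρ]; exact hρ0) (by rw [hnρ]; exact hρr) h h'
        rw [hzre, hclρ] at this
        have h3 := Real.cos_nonneg_of_mem_Icc hθ
        nlinarith
      · rw [hgB _ (by rw [hnρ]) h']; norm_num
    · right; rw [hgim]; exact h)
  have e3 := hslit ρ (-1) (Real.pi/2) (3 * Real.pi/2) (by linarith) (by
    intro θ hθ
    rw [neg_one_mul, Complex.mem_slitPlane_iff]
    by_cases h : f (zz (ρ, θ)) = 0
    · left
      rcases hz _ (by rw [hnρ]; exact hρR) h with h' | h'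
      · rw [Complex.neg_re, hgA _ (by rw [hnρ]) h']; norm_num
      · have := hBr _ (by rw [hnρ]; exact hρ0) (by rw [hnρ]; exact hρr) h h'
        rw [hzre, hclρ] at this
        have h3 := Real.cos_nonpos_of_pi_div_two_le_of_le hθ.1 (by linarith [hθ.2])
        simp only at this
        nlinarith
    · right; rw [Complex.neg_im, hgim]; simpa using h)
  have hzt : zz (ρ, Real.pi/2) = ρ * Complex.I := by
    simp only [zz, hclρ]
    push_cast
    rw [Complex.exp_pi_div_two_mul_I]
  have hzb : zz (ρ, -(Real.pi/2)) = -(ρ * Complex.I) := by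
    simp only [zz, hclρ]
    push_cast
    rw [← neg_div, Complex.exp_neg_pi_div_two_mul_I]; ring
  rw [hper] at e3
  rw [hzt, hzb] at e2 e3
  have i1 : 0 < (g (ρ * Complex.I)).im := by rw [hgim]; exact hp ρ hρ0 hρr
  have i2 : (g (-(ρ * Complex.I))).im < 0 := by rw [hgim]; exact hn ρ hρ0 hρr
  have a1 := congrArg Complex.im e1
  have a2 := congrArg Complex.im e2
  have a3 := congrArg Complex.im e3
  have a4 := congrArg Complex.im hconst
  simp only [Complex.sub_im, Complex.log_im, one_mul, neg_one_mul, Complex.zero_im] at a1 a2 a3 a4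
  rw [Complex.arg_neg_eq_arg_sub_pi_of_im_pos i1, Complex.arg_neg_eq_arg_add_pi_of_im_neg i2] at a3
  linarith

lemma arg_chord {R φ : ℝ} (hR : 0 < R) (h0 : 0 < φ) (h1 : φ < 2 * Real.pi) :
    Complex.arg ((R : ℂ) * (1 - Complex.exp (φ * Complex.I))) = (φ - Real.pi)/2 := by
  have hs : 0 < Real.sin (φ/2) := Real.sin_pos_of_pos_of_lt_pi (by linarith) (by linarith)
  have : (R : ℂ) * (1 - Complex.exp (φ * Complex.I)) =
      ((R * (2 * Real.sin (φ/2)) : ℝ) : ℂ) * (Real.cos ((φ - Real.pi)/2) + Real.sin ((φ - Real.pi)/2) * Complex.I) := by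
    have e : (φ - Real.pi)/2 = φ/2 - Real.pi/2 := by ring
    rw [e, Real.cos_sub_pi_div_two, Real.sin_sub_pi_div_two]
    have e2 : φ = 2 * (φ/2) := by ring
    rw [Complex.exp_mul_I, ← Complex.ofReal_cos, ← Complex.ofReal_sin]
    conv_lhs => rw [e2, Real.cos_two_mul, Real.sin_two_mul]
    have hsq := Real.sin_sq_add_cos_sq (φ/2)
    generalize Real.sin (φ/2) = S at *
    generalize Real.cos (φ/2) = C at *
    apply Complex.ext
    · simp [-Complex.ofReal_sin, -Complex.ofReal_cos, ← Complex.ofReal_pow]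
      norm_cast
      linear_combination (-2 * R) * hsq
    · simp [-Complex.ofReal_sin, -Complex.ofReal_cos, ← Complex.ofReal_pow]
      norm_cast
      ring
  rw [this, Complex.ofReal_cos, Complex.ofReal_sin, Complex.arg_mul_cos_add_sin_mul_I (by positivity)]
  constructor <;> linarith

lemma crossing0 {R a0 b0 a1 b1 : ℝ} (hR : 0 < R) (h1 : a0 < b0) (h2 : b0 < a1) (h3 : a1 < b1)
    (h4 : b1 < a0 + 2 * Real.pi) {α β : ℝ → ℂ} (hα : Continuous α) (hβ : Continuous β)
    (hαR : ∀ t, ‖α t‖ ≤ R) (hβR : ∀ t, ‖β t‖ ≤ R)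
    (hα0 : α 0 = R * Complex.exp (a0 * Complex.I)) (hα1 : α 1 = R * Complex.exp (a1 * Complex.I))
    (hβ0 : β 0 = R * Complex.exp (b0 * Complex.I)) (hβ1 : β 1 = R * Complex.exp (b1 * Complex.I)) :
    ∃ s t, α s = β t := by
  by_contra hcon
  push Not at hcon
  obtain ⟨L, hLc, hL⟩ := log_lift (G := fun p => α p.1 - β p.2) (by fun_prop)
    (fun p => sub_ne_zero.2 (hcon _ _))
  have hre : ∀ (a : ℝ) (z : ℂ), ‖z‖ ≤ R → z ≠ R * Complex.exp (a * Complex.I) →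
      Complex.exp (-(a * Complex.I)) * (R * Complex.exp (a * Complex.I) - z) ∈ Complex.slitPlane := by
    intro a z hz hne
    rw [Complex.mem_slitPlane_iff]
    left
    have e : Complex.exp (-(a * Complex.I)) * (R * Complex.exp (a * Complex.I) - z) =
        R - Complex.exp (-(a * Complex.I)) * z := by
      rw [mul_sub, mul_left_comm, ← Complex.exp_add]; simp
    rw [e]
    set v := Complex.exp (-(a * Complex.I)) * z with hv
    have hvn : ‖v‖ ≤ R := by
      rw [hv, norm_mul, show -((a:ℂ) * Complex.I) = ((-a : ℝ) : ℂ) * Complex.I by push_cast; ring,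
        Complex.norm_exp_ofReal_mul_I, one_mul]; exact hz
    have hvR : v ≠ R := by
      intro h
      apply hne
      rw [← h, hv, mul_right_comm, ← Complex.exp_add]; simp
    simp only [Complex.sub_re, Complex.ofReal_re, sub_pos]
    refine lt_of_le_of_ne ((Complex.re_le_norm v).trans hvn) ?_
    intro h
    apply hvR
    have him : v.im = 0 := by
      have h5 : ‖v‖ ^ 2 = v.re * v.re + v.im * v.im := by
        rw [Complex.sq_norm, Complex.normSq_apply]
      have : ‖v‖ ^ 2 ≤ R ^ 2 := by gcongr
      rw [h5, h] at this
      nlinarith [mul_self_nonneg v.im]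
    exact Complex.ext h him
  have hch : ∀ a b : ℝ, Complex.exp (-(a * Complex.I)) * (R * Complex.exp (a * Complex.I) -
      R * Complex.exp (b * Complex.I)) = R * (1 - Complex.exp ((b - a : ℝ) * Complex.I)) := by
    intro a b
    rw [mul_sub, mul_left_comm, mul_left_comm _ (R:ℂ), ← Complex.exp_add, ← Complex.exp_add]
    push_cast
    rw [show -(a * Complex.I) + a * Complex.I = 0 by ring, Complex.exp_zero,
      show -((a:ℂ) * Complex.I) + b * Complex.I = (b - a) * Complex.I by ring]
    ring
  have hch2 : ∀ a b : ℝ, Complex.exp (-(a * Complex.I)) * (R * Complex.exp (a * Complex.I) -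
      R * Complex.exp (b * Complex.I)) = R * (1 - Complex.exp ((b - a + 2 * Real.pi : ℝ) * Complex.I)) := by
    intro a b
    rw [hch]
    congr 2
    rw [Complex.exp_eq_exp_iff_exists_int]
    refine ⟨-1, ?_⟩
    push_cast; ring
  have m0 : (0:ℝ) ∈ Icc (0:ℝ) 1 := by simp
  have m1 : (1:ℝ) ∈ Icc (0:ℝ) 1 := by simp
  have c1 := log_change (s := Icc (0:ℝ) 1) isPreconnected_Icc (L := fun s => L (s, 0))
    (G := fun s => α s - β 0) (by apply Continuous.continuousOn; fun_prop)
    (by apply Continuous.continuousOn; fun_prop) (fun s _ => hL _)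
    (c := - Complex.exp (-(b0 * Complex.I))) (by
      intro s _
      have := hre b0 (α s) (hαR s) (by rw [← hβ0]; exact hcon s 0)
      rw [← hβ0] at this
      rw [neg_mul, ← mul_neg, neg_sub]; exact this) m0 m1
  have c2 := log_change (s := Icc (0:ℝ) 1) isPreconnected_Icc (L := fun t => L (1, t))
    (G := fun t => α 1 - β t) (by apply Continuous.continuousOn; fun_prop)
    (by apply Continuous.continuousOn; fun_prop) (fun s _ => hL _)
    (c := Complex.exp (-(a1 * Complex.I))) (by
      intro t _
      have := hre a1 (β t) (hβR t) (by rw [← hα1]; exact (hcon 1 t).symm)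
      rw [← hα1] at this
      exact this) m0 m1
  have c3 := log_change (s := Icc (0:ℝ) 1) isPreconnected_Icc (L := fun s => L (s, 1))
    (G := fun s => α s - β 1) (by apply Continuous.continuousOn; fun_prop)
    (by apply Continuous.continuousOn; fun_prop) (fun s _ => hL _)
    (c := - Complex.exp (-(b1 * Complex.I))) (by
      intro s _
      have := hre b1 (α s) (hαR s) (by rw [← hβ1]; exact hcon s 1)
      rw [← hβ1] at this
      rw [neg_mul, ← mul_neg, neg_sub]; exact this) m0 m1
  have c4 := log_change (s := Icc (0:ℝ) 1) isPreconnected_Icc (L := fun t => L (0, t))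
    (G := fun t => α 0 - β t) (by apply Continuous.continuousOn; fun_prop)
    (by apply Continuous.continuousOn; fun_prop) (fun s _ => hL _)
    (c := Complex.exp (-(a0 * Complex.I))) (by
      intro t _
      have := hre a0 (β t) (hβR t) (by rw [← hα0]; exact (hcon 0 t).symm)
      rw [← hα0] at this
      exact this) m0 m1
  have hneg : ∀ E x y : ℂ, -E * (x - y) = E * (y - x) := fun E x y => by ring
  simp only [hneg] at c1 c2 c3 c4
  rw [hα0, hα1, hβ0, hch b0 a1, hch2 b0 a0] at c1
  rw [hα1, hβ0, hβ1, hch a1 b1, hch2 a1 b0] at c2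
  rw [hα0, hα1, hβ1, hch2 b1 a1, hch2 b1 a0] at c3
  rw [hα0, hβ0, hβ1, hch a0 b1, hch a0 b0] at c4
  have d1 := congrArg Complex.im c1
  have d2 := congrArg Complex.im c2
  have d3 := congrArg Complex.im c3
  have d4 := congrArg Complex.im c4
  have hpi := Real.pi_pos
  simp only [Complex.sub_im, Complex.log_im] at d1 d2 d3 d4
  rw [arg_chord hR (by linarith) (by linarith), arg_chord hR (by linarith) (by linarith)] at d1 d2 d3 d4
  linarith

/-- Crossing chords in a disc meet. -/
lemma crossing {c : ℂ} {R a0 b0 a1 b1 : ℝ} (hR : 0 < R) (h1 : a0 < b0) (h2 : b0 < a1) (h3 : a1 < b1)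
    (h4 : b1 < a0 + 2 * Real.pi) {S T : Set ℂ} (hS : S ⊆ Metric.closedBall c R)
    (hT : T ⊆ Metric.closedBall c R)
    (hα : JoinedIn S (c + R * Complex.exp (a0 * Complex.I)) (c + R * Complex.exp (a1 * Complex.I)))
    (hβ : JoinedIn T (c + R * Complex.exp (b0 * Complex.I)) (c + R * Complex.exp (b1 * Complex.I))) :
    (S ∩ T).Nonempty := by
  obtain ⟨α, hα'⟩ := hα
  obtain ⟨β, hβ'⟩ := hβ
  have hαS : ∀ t, α.extend t ∈ S := fun t => by
    have : α.extend t ∈ range α.extend := ⟨t, rfl⟩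
    rw [Path.extend_range] at this
    obtain ⟨s, hs⟩ := this
    rw [← hs]; exact hα' s
  have hβS : ∀ t, β.extend t ∈ T := fun t => by
    have : β.extend t ∈ range β.extend := ⟨t, rfl⟩
    rw [Path.extend_range] at this
    obtain ⟨s, hs⟩ := this
    rw [← hs]; exact hβ' s
  obtain ⟨s, t, hst⟩ := crossing0 hR h1 h2 h3 h4 (α := fun t => α.extend t - c)
    (β := fun t => β.extend t - c) (by fun_prop) (by fun_prop)
    (fun t => by have := hS (hαS t); rwa [mem_closedBall_iff_norm] at this)
    (fun t => by have := hT (hβS t); rwa [mem_closedBall_iff_norm] at this)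
    (by simp) (by simp) (by simp) (by simp)
  have : α.extend s = β.extend t := sub_left_injective hst
  exact ⟨_, hαS s, this ▸ hβS t⟩

end P4a

section P4b

/-- the coordinate along the tangent direction -/
def xi (x w y : ℂ) : ℝ := ((y - x) * (starRingEnd ℂ) w).re

lemma xi_cont (x w : ℂ) : Continuous (xi x w) := by
  unfold xi; fun_prop

lemma xi_neg (x w y : ℂ) : xi x (-w) y = - xi x w y := by
  simp only [xi, map_neg, mul_neg, Complex.neg_re]

lemma xi_self (x w : ℂ) : xi x w x = 0 := by simp [xi]

/-- Regular points. -/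
structure Reg (f : ℂ → ℝ) (x w : ℂ) (r0 : ℝ) : Prop where
  hw : ‖w‖ = 1
  hr0 : 0 < r0
  hne : ∀ y, 0 < ‖y - x‖ → ‖y - x‖ ≤ r0 → f y = f x → xi x w y ≠ 0
  hpos : ∀ ρ : ℝ, 0 < ρ → ρ ≤ r0 → f x < f (x + ρ * (Complex.I * w))
  hneg : ∀ ρ : ℝ, 0 < ρ → ρ ≤ r0 → f (x - ρ * (Complex.I * w)) < f x

lemma Reg.neg {f : ℂ → ℝ} {x w : ℂ} {r0 : ℝ} (h : Reg f x w r0) : Reg (-f) x (-w) r0 where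
  hw := by rw [norm_neg]; exact h.hw
  hr0 := h.hr0
  hne := by
    intro y h1 h2 h3
    rw [xi_neg]
    simp only [Pi.neg_apply, neg_inj] at h3
    simpa using h.hne y h1 h2 h3
  hpos := by
    intro ρ h1 h2
    have := h.hneg ρ h1 h2
    simp only [Pi.neg_apply, mul_neg, ← sub_eq_add_neg]
    linarith
  hneg := by
    intro ρ h1 h2
    have := h.hpos ρ h1 h2
    simp only [Pi.neg_apply, mul_neg, sub_neg_eq_add]
    linarith

lemma reg_of_diff {f : ℂ → ℝ} {x : ℂ} (hd : DifferentiableAt ℝ f x) (h0 : fderiv ℝ f x ≠ 0) :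
    ∃ w r0, Reg f x w r0 := by
  set L := fderiv ℝ f x with hL
  set g : ℂ := (L 1 : ℂ) + (L Complex.I : ℂ) * Complex.I with hg
  have hLv : ∀ v : ℂ, L v = (v * (starRingEnd ℂ) g).re := by
    intro v
    have : v = v.re • (1:ℂ) + v.im • Complex.I := by
      apply Complex.ext <;> simp
    conv_lhs => rw [this, map_add, map_smul, map_smul]
    simp [hg]
  have hg0 : g ≠ 0 := by
    intro h
    apply h0
    ext v
    rw [hLv, h]; simp
  have hc : 0 < ‖g‖ := norm_pos_iff.2 hg0
  have hcc : (‖g‖ : ℂ) ≠ 0 := by exact_mod_cast hc.ne'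
  set c := ‖g‖ with hcdef
  set w : ℂ := -Complex.I * (g / c) with hw
  have hIw : Complex.I * w = g / c := by
    rw [hw, ← mul_assoc, mul_neg, Complex.I_mul_I]; simp
  have hwn : ‖w‖ = 1 := by
    rw [hw]; simp [hc.ne']
    rw [← hcdef]; field_simp
    exact (abs_of_pos hc).symm
  have hLc : ∀ v : ℂ, L v = c * (v * (starRingEnd ℂ) w).im := by
    intro v
    have : g = c * (Complex.I * w) := by rw [hIw]; field_simp
    rw [hLv, this]
    simp
    ring
  have hlo := (hasFDerivAt_iff_isLittleO.1 hd.hasFDerivAt).def (c := c/2) (half_pos hc)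
  obtain ⟨δ, hδ, hb⟩ := Metric.eventually_nhds_iff.1 hlo
  have hb' : ∀ y, ‖y - x‖ ≤ δ/2 → |f y - f x - L (y - x)| ≤ c/2 * ‖y - x‖ := by
    intro y hy
    have := @hb y (by rw [dist_eq_norm]; linarith)
    simpa using this
  have hwi : w * (starRingEnd ℂ) w = 1 := by
    rw [Complex.mul_conj, Complex.normSq_eq_norm_sq, hwn]; simp
  refine ⟨w, δ/2, hwn, half_pos hδ, ?_, ?_, ?_⟩
  · intro y h1 h2 h3 h4
    have h5 := hb' y h2
    rw [h3, sub_self, zero_sub, abs_neg, hLc, abs_mul, abs_of_pos hc] at h5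
    unfold xi at h4
    have h6 : ‖(y - x) * (starRingEnd ℂ) w‖ = |((y - x) * (starRingEnd ℂ) w).im| := by
      set z := (y - x) * (starRingEnd ℂ) w
      have : z = z.im * Complex.I := by apply Complex.ext <;> simp [h4]
      conv_lhs => rw [this]
      simp
    rw [← h6, norm_mul, RCLike.norm_conj, hwn, mul_one] at h5
    nlinarith
  · intro ρ h1 h2
    have hv : ‖x + ρ * (Complex.I * w) - x‖ = ρ := by
      simp [hwn, abs_of_pos h1]
    have h5 := hb' (x + ρ * (Complex.I * w)) (by rw [hv]; exact h2)
    rw [hv, hLc] at h5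
    have h6 : ((x + ρ * (Complex.I * w) - x) * (starRingEnd ℂ) w).im = ρ := by
      have : (x + ρ * (Complex.I * w) - x) * (starRingEnd ℂ) w = ρ * Complex.I * (w * (starRingEnd ℂ) w) := by ring
      rw [this, hwi]; simp
    rw [h6] at h5
    have := (abs_le.1 h5).1
    nlinarith
  · intro ρ h1 h2
    have hv : ‖x - ρ * (Complex.I * w) - x‖ = ρ := by
      simp [hwn, abs_of_pos h1]
    have h5 := hb' (x - ρ * (Complex.I * w)) (by rw [hv]; exact h2)
    rw [hv, hLc] at h5
    have h6 : ((x - ρ * (Complex.I * w) - x) * (starRingEnd ℂ) w).im = -ρ := by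
      have : (x - ρ * (Complex.I * w) - x) * (starRingEnd ℂ) w = -ρ * Complex.I * (w * (starRingEnd ℂ) w) := by ring
      rw [this, hwi]; simp
    rw [h6] at h5
    have := (abs_le.1 h5).2
    nlinarith

/-- closed ball with an open half disc removed -/
def coreM (f : ℂ → ℝ) (x w : ℂ) (r R : ℝ) : Set ℂ :=
  {y | f y = f x ∧ ‖y - x‖ ≤ R ∧ ¬ (‖y - x‖ < r ∧ 0 < xi x w y)}

lemma coreM_compact {f : ℂ → ℝ} (hf : Continuous f) (x w : ℂ) (r R : ℝ) : IsCompact (coreM f x w r R) := by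
  have hb : IsCompact (Metric.closedBall x R) := isCompact_closedBall x R
  refine hb.of_isClosed_subset ?_ ?_
  · have h1 : IsClosed {y | f y = f x} := isClosed_eq hf continuous_const
    have h2 : IsClosed {y : ℂ | ‖y - x‖ ≤ R} := isClosed_le (by fun_prop) continuous_const
    have h3 : IsOpen {y : ℂ | ‖y - x‖ < r ∧ 0 < xi x w y} :=
      have h31 : IsOpen {y : ℂ | ‖y - x‖ < r} := isOpen_lt (by fun_prop) continuous_const
      have h32 : IsOpen {y : ℂ | 0 < xi x w y} := isOpen_lt continuous_const (xi_cont x w)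
      h31.inter h32
    exact h1.inter (h2.inter h3.isClosed_compl)
  · intro y hy
    rw [mem_closedBall_iff_norm]; exact hy.2.1

lemma core_lemma {f : ℂ → ℝ} (hf : Continuous f) {x w : ℂ} {r0 r R : ℝ} (hreg : Reg f x w r0)
    (hr : 0 < r) (hrr : r ≤ r0) (hrR : r ≤ R) :
    ∃ z ∈ connectedComponentIn (coreM f x w r R) x, ‖z - x‖ = R ∨ (‖z - x‖ = r ∧ 0 ≤ xi x w z) := by
  by_contra hcon
  push Not at hcon
  set M := coreM f x w r R with hM
  have hMc : IsCompact M := coreM_compact hf x w r R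
  have hxM : x ∈ M := ⟨rfl, by simpa using hr.le.trans hrR, by simp [xi_self]⟩
  have hN : IsClosed ({z : ℂ | ‖z - x‖ = R} ∪ {z | ‖z - x‖ = r ∧ 0 ≤ xi x w z}) := by
    refine IsClosed.union (isClosed_eq (by fun_prop) continuous_const) ?_
    exact (isClosed_eq (by fun_prop) continuous_const).inter (isClosed_le continuous_const (xi_cont x w))
  obtain ⟨A, hAM, hA, hMA, hPA, hAN⟩ := clopen_sep hMc hxM hN (by
    rw [Set.disjoint_left]
    rintro z hz hzP
    rcases hz with h | ⟨h, h'⟩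
    · exact (hcon z hzP).1 h
    · exact absurd h' (not_le.2 ((hcon z hzP).2 h)))
  have hxA : x ∈ A := hPA (mem_connectedComponentIn hxM)
  have hANR : ∀ z ∈ A, ‖z - x‖ ≠ R := fun z hz h => Set.disjoint_left.1 hAN hz (Or.inl h)
  have hANr : ∀ z ∈ A, ‖z - x‖ = r → xi x w z < 0 := fun z hz h => by
    by_contra h'
    exact Set.disjoint_left.1 hAN hz (Or.inr ⟨h, not_lt.1 h'⟩)
  set B : Set ℂ := (M \ A) ∪ {y | f y = f x ∧ ‖y - x‖ ≤ r ∧ 0 ≤ xi x w y} with hBdef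
  have hB : IsClosed B := by
    refine hMA.isClosed.union ?_
    have h31 : IsClosed {y : ℂ | ‖y - x‖ ≤ r} := isClosed_le (by fun_prop) continuous_const
    have h32 : IsClosed {y : ℂ | 0 ≤ xi x w y} := isClosed_le continuous_const (xi_cont x w)
    have h33 : IsClosed {y : ℂ | f y = f x} := isClosed_eq hf continuous_const
    exact h33.inter (h31.inter h32)
  obtain ⟨δ, hδ, hδb⟩ := Metric.isOpen_iff.1 hMA.isClosed.isOpen_compl x (fun h => h.2 hxA)
  set r1 := min (r/2) (δ/2) with hr1
  have hr10 : 0 < r1 := lt_min (half_pos hr) (half_pos hδ)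
  have hr1r : r1 < r := (min_le_left _ _).trans_lt (by linarith)
  have hr1δ : r1 < δ := (min_le_right _ _).trans_lt (by linarith)
  let φ : ℂ → ℂ := fun z => x + z * w
  have hφ : Continuous φ := by fun_prop
  have hφn : ∀ z, ‖φ z - x‖ = ‖z‖ := fun z => by simp [φ, hreg.hw]
  have hwi : w * (starRingEnd ℂ) w = 1 := by
    rw [Complex.mul_conj, Complex.normSq_eq_norm_sq, hreg.hw]; simp
  have hφx : ∀ z, xi x w (φ z) = z.re := fun z => by
    simp only [xi, φ, add_sub_cancel_left, mul_assoc, hwi, mul_one]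
  refine degree_lemma (f := fun z => f (φ z) - f x) (by fun_prop) (hA.isClosed.preimage hφ)
    (hB.preimage hφ) (r0 := r1) (R := R) hr10 (hr.trans_le hrR) ?_ ?_ ?_ ?_ ?_ ?_ ?_
  · intro z hzA hzB
    rcases hzB with h | ⟨h1, h2, h3⟩
    · exact absurd hzA h.2
    · have hzM := hAM hzA
      by_contra hz0
      have hlt : ‖φ z - x‖ < r := by
        refine lt_of_le_of_ne h2 fun h => ?_
        exact absurd (hANr _ hzA h) (not_lt.2 h3)
      have h4 : xi x w (φ z) ≤ 0 := by
        by_contra h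
        exact hzM.2.2 ⟨hlt, not_le.1 h⟩
      have hp : 0 < ‖φ z - x‖ := by rw [hφn]; exact norm_pos_iff.2 hz0
      exact hreg.hne (φ z) hp (h2.trans hrr) h1 (le_antisymm h4 h3)
  · intro z hz h0
    have h0' : f (φ z) = f x := by linarith
    by_cases h : ‖φ z - x‖ < r ∧ 0 < xi x w (φ z)
    · right; right; exact ⟨h0', h.1.le, h.2.le⟩
    · have : φ z ∈ M := ⟨h0', by rw [hφn]; exact hz, h⟩
      by_cases hzA : φ z ∈ A
      · left; exact hzA
      · right; left; exact ⟨this, hzA⟩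
  · intro z h1 h2 h0 hzA
    have h0' : f (φ z) = f x := by linarith
    have hzM := hAM hzA
    rw [← hφx]
    have := hreg.hne (φ z) (by rwa [hφn]) (by rw [hφn]; linarith) h0'
    refine lt_of_le_of_ne ?_ this
    by_contra h
    exact hzM.2.2 ⟨by rw [hφn]; linarith, not_le.1 h⟩
  · intro z h1 h2 h0 hzB
    have h0' : f (φ z) = f x := by linarith
    rw [← hφx]
    have := hreg.hne (φ z) (by rwa [hφn]) (by rw [hφn]; linarith) h0'
    refine lt_of_le_of_ne ?_ this.symm
    rcases hzB with h | h
    · exact absurd h (hδb (by rw [mem_ball_iff_norm, hφn]; linarith))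
    · exact h.2.2
  · intro ρ h1 h2
    have := hreg.hpos ρ h1 (by linarith)
    simp only [φ]
    rw [mul_assoc]
    linarith
  · intro ρ h1 h2
    have := hreg.hneg ρ h1 (by linarith)
    simp only [φ]
    rw [neg_mul, mul_assoc, ← sub_eq_add_neg]
    linarith
  · intro z hz _ hzA
    exact hANR _ hzA (by rw [hφn]; exact hz)

/-- A nontrivial continuum through `a`. -/
structure Leg {X : Type*} [TopologicalSpace X] (E : Set X) (a : X) (K : Set X) : Prop where
  sub : K ⊆ E
  comp : IsCompact K
  conn : IsPreconnected K
  mem : a ∈ K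
  nontriv : ∃ z ∈ K, z ≠ a

lemma Leg.mono {X : Type*} [TopologicalSpace X] {E E' : Set X} {a : X} {K : Set X} (h : Leg E a K)
    (hE : K ⊆ E') : Leg E' a K := ⟨hE, h.comp, h.conn, h.mem, h.nontriv⟩

def Triod {X : Type*} [TopologicalSpace X] (E : Set X) : Prop :=
  ∃ a K1 K2 K3, Leg E a K1 ∧ Leg E a K2 ∧ Leg E a K3 ∧ K1 ∩ K2 ⊆ {a} ∧ K1 ∩ K3 ⊆ {a} ∧ K2 ∩ K3 ⊆ {a}

lemma leg_arc {X : Type*} [TopologicalSpace X] {E : Set X} {τ : ℝ → X} {s t u : ℝ} (hst : s < t)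
    (hc : ContinuousOn τ (Icc s t)) (hi : InjOn τ (Icc s t)) (hE : ∀ v ∈ Icc s t, τ v ∈ E)
    (hu : u ∈ Icc s t) : Leg E (τ u) (τ '' Icc s t) where
  sub := by rintro _ ⟨v, hv, rfl⟩; exact hE v hv
  comp := isCompact_Icc.image_of_continuousOn hc
  conn := isPreconnected_Icc.image _ hc
  mem := ⟨u, hu, rfl⟩
  nontriv := by
    by_cases h : u = s
    · refine ⟨τ t, ⟨t, right_mem_Icc.2 hst.le, rfl⟩, fun h' => ?_⟩
      have := hi (right_mem_Icc.2 hst.le) hu h'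
      linarith
    · refine ⟨τ s, ⟨s, left_mem_Icc.2 hst.le, rfl⟩, fun h' => ?_⟩
      exact h (hi (left_mem_Icc.2 hst.le) hu h').symm

lemma side_leg {f : ℂ → ℝ} (hf : Continuous f) {x w : ℂ} {r0 r : ℝ} (hreg : Reg f x w r0)
    (hr : 0 < r) (hrr : r ≤ r0) {E : Set ℂ} (hE : ∀ y, ‖y - x‖ ≤ r → f y = f x → y ∈ E)
    (hfin : μH[1] E ≠ ⊤) :
    ∃ K, Leg E x K ∧ ∀ y ∈ K, y ≠ x → ‖y - x‖ < r ∧ 0 < xi x w y := by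
  obtain ⟨z, hz, hzr⟩ := core_lemma (f := -f) (by fun_prop) hreg.neg hr hrr le_rfl
  set M := coreM (-f) x (-w) r r with hM
  have hMc : IsCompact M := coreM_compact (by fun_prop) x (-w) r r
  have hxM : x ∈ M := ⟨rfl, by simpa using hr.le, by simp [xi_self]⟩
  have hzr' : ‖z - x‖ = r := by rcases hzr with h | h; exacts [h, h.1]
  have hzx : x ≠ z := by
    rintro rfl; simp at hzr'; linarith
  have hMf : ∀ y ∈ M, f y = f x := fun y hy => by
    have := hy.1; simpa using this
  have hPE : connectedComponentIn M x ⊆ E := by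
    intro y hy
    have hy := connectedComponentIn_subset _ _ hy
    exact hE y hy.2.1 (hMf y hy)
  obtain ⟨ℓ, hℓ, τ, hτ, hinj, -⟩ := exists_arc (cc_compact hMc x) isPreconnected_connectedComponentIn
    (ne_top_of_le_ne_top hfin (measure_mono hPE)) (mem_connectedComponentIn hxM) hz hzx
  set s := min ℓ (r/2) with hs
  have hs0 : 0 < s := lt_min hℓ (half_pos hr)
  have hsub : Icc 0 s ⊆ Icc 0 ℓ := Icc_subset_Icc_right (min_le_left _ _)
  have h0 : (0:ℝ) ∈ Icc 0 ℓ := ⟨le_rfl, hℓ.le⟩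
  have hτ0 : τ 0 = x := hτ.2.1
  refine ⟨τ '' Icc 0 s, ?_, ?_⟩
  · have := leg_arc (E := E) (u := 0) hs0 (hτ.continuousOn.mono hsub) (hinj.mono hsub)
      (fun v hv => hPE (hτ.2.2.2.1 v (hsub hv))) (left_mem_Icc.2 hs0.le)
    rwa [hτ0] at this
  · rintro _ ⟨t, ht, rfl⟩ hne
    have hd : ‖τ t - x‖ < r := by
      have := hτ.2.2.2.2 t (hsub ht) 0 h0
      rw [hτ0, dist_eq_norm, sub_zero, abs_of_nonneg ht.1] at this
      have h2 := ht.2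
      have h3 : s ≤ r/2 := min_le_right _ _
      linarith
    refine ⟨hd, ?_⟩
    have hyM := connectedComponentIn_subset _ _ (hτ.2.2.2.1 t (hsub ht))
    have h4 := hyM.2.2
    rw [xi_neg] at h4
    have h5 : 0 ≤ xi x w (τ t) := by
      by_contra h
      exact h4 ⟨hd, by linarith [not_le.1 h]⟩
    refine lt_of_le_of_ne h5 (Ne.symm ?_)
    exact hreg.hne _ (norm_pos_iff.2 (sub_ne_zero.2 hne)) (by linarith) (hMf _ hyM)

lemma nonend_core {f : ℂ → ℝ} (hf : Continuous f) {x w : ℂ} {r0 R : ℝ} (hreg : Reg f x w r0)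
    (hR : 0 < R) {E : Set ℂ} (hE : ∀ y, ‖y - x‖ ≤ R → f y = f x → y ∈ E) (hfin : μH[1] E ≠ ⊤)
    (hT : ¬ Triod E) {γ : ℝ → ℂ} {s t1 : ℝ} (ht1 : 0 ≤ t1) (ht1s : t1 < s)
    (hγc : ContinuousOn γ (Icc 0 s)) (hγi : InjOn γ (Icc 0 s)) (hγs : γ s = x)
    (hγf : ∀ t ∈ Icc 0 s, f (γ t) = f x) (hγR : ∀ t ∈ Icc 0 s, ‖γ t - x‖ < R)
    (hside : ∀ t ∈ Ico t1 s, xi x w (γ t) < 0) :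
    ∃ K, Leg E (γ 0) K ∧ K ∩ γ '' Icc 0 s ⊆ {γ 0} := by
  have hs0 : 0 < s := by linarith
  have hss : s ∈ Icc 0 s := ⟨hs0.le, le_rfl⟩
  have hsub1 : Icc 0 t1 ⊆ Icc 0 s := Icc_subset_Icc_right ht1s.le
  -- choose r
  obtain ⟨r, hr, hrr, hrR, hrγ⟩ : ∃ r > 0, r ≤ r0 ∧ r ≤ R ∧ ∀ t ∈ Icc 0 t1, r < ‖γ t - x‖ := by
    have hcp : IsCompact (γ '' Icc 0 t1) := isCompact_Icc.image_of_continuousOn (hγc.mono hsub1)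
    have hx : x ∉ γ '' Icc 0 t1 := by
      rintro ⟨t, ht, htx⟩
      have := hγi (hsub1 ht) hss (htx.trans hγs.symm)
      have := ht.2
      linarith
    obtain ⟨δ, hδ, hδb⟩ := Metric.isOpen_iff.1 hcp.isClosed.isOpen_compl x hx
    refine ⟨min (δ/2) (min r0 R), lt_min (half_pos hδ) (lt_min hreg.hr0 hR),
      (min_le_right _ _).trans (min_le_left _ _), (min_le_right _ _).trans (min_le_right _ _), ?_⟩
    intro t ht
    by_contra h
    refine hδb ?_ ⟨t, ht, rfl⟩
    rw [mem_ball_iff_norm]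
    have := min_le_left (δ/2) (min r0 R)
    linarith [not_lt.1 h]
  set M := coreM f x w r R with hM
  have hMc : IsCompact M := coreM_compact hf x w r R
  have hxM : x ∈ M := ⟨rfl, by simpa using hr.le.trans hrR, by simp [xi_self]⟩
  have hME : M ⊆ E := fun y hy => hE y hy.2.1 hy.1
  set Γ := γ '' Icc 0 s with hΓ
  have hΓc : IsCompact Γ := isCompact_Icc.image_of_continuousOn hγc
  have hΓM : Γ ⊆ M := by
    rintro _ ⟨t, ht, rfl⟩
    refine ⟨hγf t ht, (hγR t ht).le, ?_⟩
    rintro ⟨h1, h2⟩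
    by_cases h3 : t ≤ t1
    · have := hrγ t ⟨ht.1, h3⟩; linarith
    · rcases ht.2.lt_or_eq with h4 | h4
      · have := hside t ⟨(not_le.1 h3).le, h4⟩; linarith
      · rw [h4, hγs, xi_self] at h2; linarith
  obtain ⟨z, hz, hzr⟩ := core_lemma hf hreg hr hrr hrR
  rw [← hM] at hz
  have hzΓ : z ∉ Γ := by
    rintro ⟨t, ht, rfl⟩
    rcases hzr with h | ⟨h1, h2⟩
    · have := hγR t ht; linarith
    · by_cases h3 : t ≤ t1
      · have := hrγ t ⟨ht.1, h3⟩; linarith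
      · rcases ht.2.lt_or_eq with h4 | h4
        · have := hside t ⟨(not_le.1 h3).le, h4⟩; linarith
        · rw [h4, hγs, sub_self, norm_zero] at h1; linarith
  have hxΓ : x ∈ Γ := ⟨s, hss, hγs⟩
  have hxz : x ≠ z := fun h => hzΓ (h ▸ hxΓ)
  have hPM : connectedComponentIn M x ⊆ M := connectedComponentIn_subset _ _
  obtain ⟨m, hm, β, hβ, hinj, -⟩ := exists_arc (cc_compact hMc x) isPreconnected_connectedComponentIn
    (ne_top_of_le_ne_top hfin (measure_mono (hPM.trans hME))) (mem_connectedComponentIn hxM) hz hxz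
  have hβc := hβ.continuousOn
  -- last time in Γ
  have hcpt : IsCompact (Icc 0 m ∩ β ⁻¹' Γ) := by
    refine isCompact_Icc.of_isClosed_subset ?_ inter_subset_left
    exact hβc.preimage_isClosed_of_isClosed isClosed_Icc hΓc.isClosed
  obtain ⟨t2, ⟨ht2, ht2Γ⟩, ht2max⟩ := hcpt.exists_isGreatest
    ⟨0, ⟨le_rfl, hm.le⟩, by rw [mem_preimage, hβ.2.1]; exact hxΓ⟩
  have ht2m : t2 < m := by
    refine lt_of_le_of_ne ht2.2 fun h => hzΓ ?_
    rw [← hβ.2.2.1, ← h]; exact ht2Γ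
  have hsub2 : Icc t2 m ⊆ Icc 0 m := Icc_subset_Icc_left ht2.1
  set K := β '' Icc t2 m with hK
  have hKM : K ⊆ M := by
    rintro _ ⟨v, hv, rfl⟩; exact hPM (hβ.2.2.2.1 v (hsub2 hv))
  have hKleg : Leg E (β t2) K := leg_arc ht2m (hβc.mono hsub2) (hinj.mono hsub2)
    (fun v hv => hME (hPM (hβ.2.2.2.1 v (hsub2 hv)))) (left_mem_Icc.2 ht2m.le)
  have hKΓ : K ∩ Γ ⊆ {β t2} := by
    rintro _ ⟨⟨v, hv, rfl⟩, hvΓ⟩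
    have := ht2max ⟨hsub2 hv, hvΓ⟩
    have : v = t2 := le_antisymm this hv.1
    rw [this]; rfl
  obtain ⟨s', hs', hs'e⟩ := ht2Γ
  rw [← hs'e] at hKΓ hKleg
  rcases hs'.1.eq_or_lt with h0 | h0
  · exact ⟨K, by rw [h0]; exact hKleg, by rw [h0]; exact hKΓ⟩
  exfalso
  apply hT
  rcases hs'.2.eq_or_lt with h1 | h1
  · -- p = x
    have hpx : γ s' = x := by rw [h1, hγs]
    rw [hpx] at hKleg hKΓ
    obtain ⟨U, hU, hUs⟩ := side_leg hf hreg hr hrr (E := E)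
      (fun y h1 h2 => hE y (h1.trans hrR) h2) hfin
    have hUM : ∀ y ∈ U, y ∈ M → y = x := by
      intro y hy hyM
      by_contra hne
      exact hyM.2.2 (hUs y hy hne)
    have hΓleg : Leg E (γ s) Γ := leg_arc hs0 hγc hγi
      (fun v hv => hME (hΓM ⟨v, hv, rfl⟩)) hss
    rw [hγs] at hΓleg
    refine ⟨x, K, Γ, U, hKleg, hΓleg, hU, hKΓ, ?_, ?_⟩
    · rintro y ⟨h1, h2⟩; exact hUM y h2 (hKM h1)
    · rintro y ⟨h1, h2⟩; exact hUM y h2 (hΓM h1)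
  · have hsa : Icc 0 s' ⊆ Icc 0 s := Icc_subset_Icc_right hs'.2
    have hsb : Icc s' s ⊆ Icc 0 s := Icc_subset_Icc_left hs'.1
    refine ⟨γ s', K, γ '' Icc 0 s', γ '' Icc s' s, hKleg,
      leg_arc h0 (hγc.mono hsa) (hγi.mono hsa) (fun v hv => hME (hΓM ⟨v, hsa hv, rfl⟩))
        (right_mem_Icc.2 h0.le),
      leg_arc h1 (hγc.mono hsb) (hγi.mono hsb) (fun v hv => hME (hΓM ⟨v, hsb hv, rfl⟩))
        (left_mem_Icc.2 h1.le), ?_, ?_, ?_⟩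
    · exact (inter_subset_inter_right _ (image_mono hsa)).trans hKΓ
    · exact (inter_subset_inter_right _ (image_mono hsb)).trans hKΓ
    · rintro _ ⟨⟨v, hv, rfl⟩, ⟨u, hu, huv⟩⟩
      have := hγi (hsb hu) (hsa hv) huv
      have : v = s' := le_antisymm hv.2 (this ▸ hu.1)
      rw [this]; rfl

end P4b

section P4c

lemma Leg.sub_cc {X : Type*} [TopologicalSpace X] {E : Set X} {a x0 : X} {K : Set X} (h : Leg E a K)
    (ha : a ∈ connectedComponentIn E x0) : K ⊆ connectedComponentIn E x0 := by
  rw [connectedComponentIn_eq ha]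
  exact h.conn.subset_connectedComponentIn h.mem h.sub

lemma reg_nontrivial {Ω : Set ℂ} (hΩ : IsOpen Ω) {f : ℂ → ℝ} (hf : Continuous f) {h : ℝ}
    (hfin : μH[1] (Ω ∩ f ⁻¹' {h}) ≠ ⊤) {x w : ℂ} {r0 : ℝ} (hx : x ∈ Ω ∩ f ⁻¹' {h})
    (hreg : Reg f x w r0) : ¬ (connectedComponentIn (Ω ∩ f ⁻¹' {h}) x).Subsingleton := by
  obtain ⟨R, hR0, hR⟩ := Metric.nhds_basis_closedBall.mem_iff.1 (hΩ.mem_nhds hx.1)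
  have hfx : f x = h := hx.2
  obtain ⟨K, hK, -⟩ := side_leg hf hreg (r := min R r0) (lt_min hR0 hreg.hr0) (min_le_right _ _)
    (E := Ω ∩ f ⁻¹' {h}) (fun y h1 h2 => ⟨hR (by
      rw [mem_closedBall_iff_norm]; exact h1.trans (min_le_left _ _)), h2.trans hfx⟩) hfin
  obtain ⟨z, hz, hzx⟩ := hK.nontriv
  have hs := hK.sub_cc (mem_connectedComponentIn hx)
  intro hsub
  exact hzx (hsub (hs hz) (hs hK.mem))

lemma nonend {Ω : Set ℂ} (hΩ : IsOpen Ω) {f : ℂ → ℝ} (hf : Continuous f) {h : ℝ}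
    (hfin : μH[1] (Ω ∩ f ⁻¹' {h}) ≠ ⊤) (hT : ¬ Triod (Ω ∩ f ⁻¹' {h}))
    (hreg : μH[1] (Ω ∩ {x | ¬ ∃ w r0, Reg f x w r0} ∩ f ⁻¹' {h}) = 0) {x0 a b : ℂ}
    (ha : a ∈ connectedComponentIn (Ω ∩ f ⁻¹' {h}) x0)
    (hb : b ∈ connectedComponentIn (Ω ∩ f ⁻¹' {h}) x0) (hab : a ≠ b) :
    ∃ K1 K2, Leg (connectedComponentIn (Ω ∩ f ⁻¹' {h}) x0) a K1 ∧
      Leg (connectedComponentIn (Ω ∩ f ⁻¹' {h}) x0) a K2 ∧ K1 ∩ K2 ⊆ {a} := by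
  set E := Ω ∩ f ⁻¹' {h} with hEdef
  have hCE : connectedComponentIn E x0 ⊆ E := connectedComponentIn_subset _ _
  have hFcl : IsClosed (f ⁻¹' {h}) := isClosed_singleton.preimage hf
  obtain ⟨K, hKC, hKc, hKp, haK, hbK⟩ := cont_joined hΩ hFcl hfin ha hb
  obtain ⟨ℓ, hℓ, γ, hγ, hinj, -⟩ := exists_arc hKc hKp
    (ne_top_of_le_ne_top hfin (measure_mono (hKC.trans hCE))) haK hbK hab
  obtain ⟨R2, hR20, hR2⟩ := Metric.nhds_basis_closedBall.mem_iff.1 (hΩ.mem_nhds (hCE ha).1)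
  set R := R2/2 with hRdef
  have hR0 : 0 < R := half_pos hR20
  set s0 := min ℓ (R/2) with hs0def
  have hs0 : 0 < s0 := lt_min hℓ (half_pos hR0)
  have hs0ℓ : s0 ≤ ℓ := min_le_left _ _
  have hs0R : s0 ≤ R/2 := min_le_right _ _
  have hγ0 : γ 0 = a := hγ.2.1
  have hγE : ∀ t ∈ Icc 0 ℓ, γ t ∈ E := fun t ht => hCE (hKC (hγ.2.2.2.1 t ht))
  have hγd := hγ.2.2.2.2
  have hγc := hγ.continuousOn
  -- regular point
  obtain ⟨s, hs, w, r0, hr⟩ : ∃ s ∈ Icc (s0/3) (2*s0/3), ∃ w r0, Reg f (γ s) w r0 := by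
    by_contra hcon
    push Not at hcon
    have hsub : Icc (s0/3) (2*s0/3) ⊆ Icc 0 ℓ := Icc_subset_Icc (by linarith) (by linarith)
    have hle : γ '' Icc (s0/3) (2*s0/3) ⊆ Ω ∩ {x | ¬ ∃ w r0, Reg f x w r0} ∩ f ⁻¹' {h} := by
      rintro _ ⟨t, ht, rfl⟩
      have := hγE t (hsub ht)
      refine ⟨⟨this.1, ?_⟩, this.2⟩
      rintro ⟨w, r0, h'⟩
      exact hcon t ht w r0 h'
    have h0 := measure_mono_null hle hreg
    have hm1 : s0/3 ∈ Icc (s0/3) (2*s0/3) := left_mem_Icc.2 (by linarith)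
    have hm2 : 2*s0/3 ∈ Icc (s0/3) (2*s0/3) := right_mem_Icc.2 (by linarith)
    have hpos := hm_connected_pos (isPreconnected_Icc.image _ (hγc.mono hsub))
      (mem_image_of_mem _ hm1) (mem_image_of_mem _ hm2) (fun h => by
        have := hinj (hsub hm1) (hsub hm2) h
        linarith)
    rw [h0] at hpos
    exact lt_irrefl _ hpos
  have hspos : 0 < s := by linarith [hs.1]
  have hsℓ : s ≤ ℓ := by linarith [hs.2]
  have hsR : s < R := by linarith [hs.2]
  have hsub : Icc 0 s ⊆ Icc 0 ℓ := Icc_subset_Icc_right hsℓ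
  have hsmem : s ∈ Icc 0 ℓ := ⟨hspos.le, hsℓ⟩
  have hx : γ s ∈ E := hγE s hsmem
  have hxh : f (γ s) = h := hx.2
  have hE' : ∀ y, ‖y - γ s‖ ≤ R → f y = h → y ∈ E := by
    intro y h1 h2
    refine ⟨hR2 ?_, h2⟩
    rw [Metric.mem_closedBall]
    have h3 := hγd s hsmem 0 ⟨le_rfl, hℓ.le⟩
    rw [hγ0, sub_zero, abs_of_pos hspos] at h3
    have h4 := dist_triangle y (γ s) a
    rw [dist_eq_norm y (γ s)] at h4
    linarith
  have hdist : ∀ t ∈ Icc 0 s, ‖γ t - γ s‖ ≤ s - t := by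
    intro t ht
    have h3 := hγd t (hsub ht) s hsmem
    rw [dist_eq_norm, abs_of_nonpos (by linarith [ht.2])] at h3
    linarith
  have hγR : ∀ t ∈ Icc 0 s, ‖γ t - γ s‖ < R := by
    intro t ht
    have := hdist t ht
    linarith [ht.1]
  set t1 := max 0 (s - r0) with ht1def
  have ht10 : 0 ≤ t1 := le_max_left _ _
  have ht1s : t1 < s := max_lt hspos (by linarith [hr.hr0])
  have ht1r : s - r0 ≤ t1 := le_max_right _ _
  have hsubc : Ico t1 s ⊆ Icc 0 s := fun t ht => ⟨ht10.trans ht.1, ht.2.le⟩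
  have hne : ∀ t ∈ Ico t1 s, xi (γ s) w (γ t) ≠ 0 := by
    intro t ht
    have htm := hsubc ht
    refine hr.hne _ ?_ ?_ ?_
    · refine norm_pos_iff.2 (sub_ne_zero.2 fun h => ?_)
      have := hinj (hsub htm) hsmem h
      linarith [ht.2]
    · linarith [hdist t htm, ht.1]
    · exact (hγE t (hsub htm)).2.trans hxh.symm
  have hci : ContinuousOn (fun t => xi (γ s) w (γ t)) (Ico t1 s) :=
    (xi_cont _ _).comp_continuousOn (hγc.mono (hsubc.trans hsub))
  have hsign : (∀ t ∈ Ico t1 s, xi (γ s) w (γ t) < 0) ∨ (∀ t ∈ Ico t1 s, 0 < xi (γ s) w (γ t)) := by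
    by_contra hcon
    push Not at hcon
    obtain ⟨⟨t, ht, h1⟩, ⟨t', ht', h2⟩⟩ := hcon
    obtain ⟨u, hu, hu0⟩ := isPreconnected_Ico.intermediate_value ht' ht hci ⟨h2, h1⟩
    exact hne u hu hu0
  have key : ∃ K, Leg E (γ 0) K ∧ K ∩ γ '' Icc 0 s ⊆ {γ 0} := by
    rcases hsign with hsg | hsg
    · exact nonend_core hf hr hR0 (fun y h1 h2 => hE' y h1 (h2.trans hxh)) hfin hT ht10 ht1s
        (hγc.mono hsub) (hinj.mono hsub) rfl (fun t ht => (hγE t (hsub ht)).2.trans hxh.symm) hγR hsg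
    · refine nonend_core (f := -f) (by fun_prop) hr.neg hR0
        (fun y h1 h2 => hE' y h1 ((neg_injective (by simpa using h2)).trans hxh)) hfin hT ht10 ht1s
        (hγc.mono hsub) (hinj.mono hsub) rfl (fun t ht => ?_) hγR ?_
      · have : f (γ t) = f (γ s) := (hγE t (hsub ht)).2.trans hxh.symm
        simp [this]
      · intro t ht
        rw [xi_neg]; linarith [hsg t ht]
  obtain ⟨K2, hK2, hK2i⟩ := key
  have hK1 : Leg E (γ 0) (γ '' Icc 0 s) := leg_arc hspos (hγc.mono hsub) (hinj.mono hsub)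
    (fun t ht => hγE t (hsub ht)) (left_mem_Icc.2 hspos.le)
  rw [hγ0] at hK1 hK2 hK2i
  exact ⟨_, _, hK1.mono (hK1.sub_cc ha), hK2.mono (hK2.sub_cc ha), by rwa [inter_comm]⟩

/-! ### Moore's triod theorem -/

def pt (c : ℂ) (R θ : ℝ) : ℂ := c + R * Complex.exp (θ * Complex.I)

def MooreData (E : Set ℂ) (d : ℕ × ℚ × ℚ × ℚ) : Prop :=
  ∃ c : ℂ, c = TopologicalSpace.denseSeq ℂ d.1 ∧ 0 < (d.2.1 : ℝ) ∧
  ∃ θ1 θ2 θ3 : ℝ, -Real.pi < θ1 ∧ θ1 < d.2.2.1 ∧ (d.2.2.1 : ℝ) < θ2 ∧ θ2 < d.2.2.2 ∧ (d.2.2.2 : ℝ) < θ3 ∧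
    θ3 ≤ Real.pi ∧
    JoinedIn (E ∩ Metric.closedBall c d.2.1) (pt c d.2.1 θ1) (pt c d.2.1 θ2) ∧
    JoinedIn (E ∩ Metric.closedBall c d.2.1) (pt c d.2.1 θ1) (pt c d.2.1 θ3)

lemma moore_disjoint {E E' : Set ℂ} {d : ℕ × ℚ × ℚ × ℚ} (h : MooreData E d) (h' : MooreData E' d) :
    (E ∩ E').Nonempty := by
  obtain ⟨c, hc, hR, θ1, θ2, θ3, a1, a2, a3, a4, a5, a6, J2, J3⟩ := h
  obtain ⟨c', hc', -, φ1, φ2, φ3, b1, b2, b3, b4, b5, b6, J2', J3'⟩ := h'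
  rw [← hc] at hc'
  subst hc'
  have hsub : (E ∩ Metric.closedBall c' (d.2.1:ℝ)) ∩ (E' ∩ Metric.closedBall c' (d.2.1:ℝ)) ⊆ E ∩ E' :=
    fun x hx => ⟨hx.1.1, hx.2.1⟩
  refine Set.Nonempty.mono hsub ?_
  rcases lt_trichotomy θ1 φ1 with hlt | heq | hgt
  · exact crossing hR hlt (by linarith) (by linarith) (by linarith) inter_subset_right
      inter_subset_right J2 J3'
  · subst heq
    exact ⟨_, J2.source_mem, J2'.source_mem⟩
  · rw [inter_comm]
    exact crossing hR hgt (by linarith) (by linarith) (by linarith) inter_subset_right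
      inter_subset_right J2' J3

lemma first_hit {g : ℝ → ℝ} {ℓ R : ℝ} (hℓ : 0 ≤ ℓ) (hg : ContinuousOn g (Icc 0 ℓ)) (h0 : g 0 < R)
    (h1 : R < g ℓ) : ∃ t ∈ Icc 0 ℓ, g t = R ∧ 0 < t ∧ ∀ s ∈ Icc 0 t, g s ≤ R := by
  have hc : IsCompact (Icc 0 ℓ ∩ g ⁻¹' (Ici R)) :=
    isCompact_Icc.of_isClosed_subset (hg.preimage_isClosed_of_isClosed isClosed_Icc isClosed_Ici)
      inter_subset_left
  obtain ⟨t, ⟨ht, htR⟩, hmin⟩ := hc.exists_isLeast ⟨ℓ, ⟨hℓ, le_rfl⟩, h1.le⟩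
  have hlt : ∀ s ∈ Ico 0 t, g s < R := by
    intro s hs
    by_contra h
    have := hmin ⟨⟨hs.1, hs.2.le.trans ht.2⟩, not_lt.1 h⟩
    linarith [hs.2]
  have ht0 : 0 < t := by
    refine lt_of_le_of_ne ht.1 fun h => ?_
    rw [← h] at htR
    exact absurd htR (not_le.2 h0)
  have hgt : g t = R := by
    refine le_antisymm ?_ htR
    by_contra h
    obtain ⟨u, hu, hu2⟩ := isPreconnected_Icc.intermediate_value (left_mem_Icc.2 ht0.le)
      (right_mem_Icc.2 ht0.le) (hg.mono (Icc_subset_Icc_right ht.2)) (⟨h0.le, htR⟩ : R ∈ Icc (g 0) (g t))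
    rcases hu.2.lt_or_eq with h3 | h3
    · have := hlt u ⟨hu.1, h3⟩; linarith
    · rw [h3] at hu2; linarith
  refine ⟨t, ht, hgt, ht0, fun s hs => ?_⟩
  rcases hs.2.lt_or_eq with h3 | h3
  · exact (hlt s ⟨hs.1, h3⟩).le
  · rw [h3, hgt]

lemma leg_exit {E K : Set ℂ} {a z : ℂ} (hfin : μH[1] E ≠ ⊤) (hK : Leg E a K) (hz : z ∈ K) {c : ℂ} {R : ℝ}
    (ha : dist a c < R) (hzR : R < dist z c) :
    ∃ e ∈ K, e ≠ a ∧ dist e c = R ∧ JoinedIn (E ∩ Metric.closedBall c R) a e := by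
  have haz : a ≠ z := by rintro rfl; linarith
  obtain ⟨ℓ, hℓ, τ, hτ, hinj, -⟩ := exists_arc hK.comp hK.conn
    (ne_top_of_le_ne_top hfin (measure_mono hK.sub)) hK.mem hz haz
  have hτc := hτ.continuousOn
  obtain ⟨t, ht, htR, ht0, hle⟩ := first_hit (g := fun t => dist (τ t) c) (R := R) hℓ.le
    ((continuous_id.dist continuous_const).comp_continuousOn hτc) (by rw [hτ.2.1]; exact ha) (by rw [hτ.2.2.1]; exact hzR)
  refine ⟨τ t, hτ.2.2.2.1 t ht, ?_, htR, ?_⟩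
  · rintro h
    rw [h] at htR
    linarith
  · have hmaps : ∀ u ∈ unitInterval, t * u ∈ Icc 0 t := fun u hu =>
      ⟨mul_nonneg ht0.le hu.1, mul_le_of_le_one_right ht0.le hu.2⟩
    refine JoinedIn.ofLine (f := fun u => τ (t * u)) ?_ (by simp [hτ.2.1]) (by simp) ?_
    · refine hτc.comp (by fun_prop) fun u hu => ?_
      exact ⟨(hmaps u hu).1, (hmaps u hu).2.trans ht.2⟩
    · rintro _ ⟨u, hu, rfl⟩
      have := hmaps u hu
      exact ⟨hK.sub (hτ.2.2.2.1 _ ⟨this.1, this.2.trans ht.2⟩), hle _ this⟩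

lemma moore_exists {E : Set ℂ} (hfin : μH[1] E ≠ ⊤) (hT : Triod E) : ∃ d, MooreData E d := by
  obtain ⟨a, K1, K2, K3, L1, L2, L3, I12, I13, I23⟩ := hT
  obtain ⟨z1, hz1, hz1a⟩ := L1.nontriv
  obtain ⟨z2, hz2, hz2a⟩ := L2.nontriv
  obtain ⟨z3, hz3, hz3a⟩ := L3.nontriv
  set δ := min (dist z1 a) (min (dist z2 a) (dist z3 a)) with hδ
  have hδ0 : 0 < δ := lt_min (dist_pos.2 hz1a) (lt_min (dist_pos.2 hz2a) (dist_pos.2 hz3a))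
  have hδ1 : δ ≤ dist z1 a := min_le_left _ _
  have hδ2 : δ ≤ dist z2 a := (min_le_right _ _).trans (min_le_left _ _)
  have hδ3 : δ ≤ dist z3 a := (min_le_right _ _).trans (min_le_right _ _)
  obtain ⟨n, hn⟩ := (TopologicalSpace.denseRange_denseSeq ℂ).exists_dist_lt a
    (show 0 < δ/4 by linarith)
  obtain ⟨R, hR1, hR2⟩ := exists_rat_btwn (show δ/4 < δ/2 by linarith)
  set c := TopologicalSpace.denseSeq ℂ n with hc
  have hR0 : (0:ℝ) < R := by linarith
  have hex : ∀ z, δ ≤ dist z a → (R:ℝ) < dist z c := by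
    intro z hz
    have := dist_triangle z c a
    rw [dist_comm c a] at this
    linarith
  obtain ⟨e1, he1, he1a, hd1, J1⟩ := leg_exit hfin L1 hz1 (by linarith) (hex _ hδ1)
  obtain ⟨e2, he2, he2a, hd2, J2⟩ := leg_exit hfin L2 hz2 (by linarith) (hex _ hδ2)
  obtain ⟨e3, he3, he3a, hd3, J3⟩ := leg_exit hfin L3 hz3 (by linarith) (hex _ hδ3)
  have h12 : e1 ≠ e2 := fun h => he1a (I12 ⟨he1, h ▸ he2⟩)
  have h13 : e1 ≠ e3 := fun h => he1a (I13 ⟨he1, h ▸ he3⟩)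
  have h23 : e2 ≠ e3 := fun h => he2a (I23 ⟨he2, h ▸ he3⟩)
  have hpt : ∀ e, dist e c = R → e = pt c R (Complex.arg (e - c)) := by
    intro e he
    rw [dist_eq_norm] at he
    have := Complex.norm_mul_exp_arg_mul_I (e - c)
    rw [he] at this
    unfold pt; rw [show (((R:ℝ)):ℂ) = ((R:ℝ):ℂ) from rfl, this]; ring
  rw [hpt e1 hd1] at J1 h12 h13
  rw [hpt e2 hd2] at J2 h12 h23
  rw [hpt e3 hd3] at J3 h13 h23
  have main : ∀ α β γ : ℝ, -Real.pi < α → α < β → β < γ → γ ≤ Real.pi →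
      JoinedIn (E ∩ Metric.closedBall c R) a (pt c R α) →
      JoinedIn (E ∩ Metric.closedBall c R) a (pt c R β) →
      JoinedIn (E ∩ Metric.closedBall c R) a (pt c R γ) → ∃ d, MooreData E d := by
    intro α β γ h1 h2 h3 h4 jα jβ jγ
    obtain ⟨p1, hp1, hp1'⟩ := exists_rat_btwn h2
    obtain ⟨p2, hp2, hp2'⟩ := exists_rat_btwn h3
    exact ⟨(n, R, p1, p2), c, hc, hR0, α, β, γ, h1, hp1, hp1', hp2, hp2', h4, jα.symm.trans jβ,
      jα.symm.trans jγ⟩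
  set θ1 := Complex.arg (e1 - c)
  set θ2 := Complex.arg (e2 - c)
  set θ3 := Complex.arg (e3 - c)
  have n12 : θ1 ≠ θ2 := fun h => h12 (by rw [h])
  have n13 : θ1 ≠ θ3 := fun h => h13 (by rw [h])
  have n23 : θ2 ≠ θ3 := fun h => h23 (by rw [h])
  have l1 : -Real.pi < θ1 := Complex.neg_pi_lt_arg _
  have l2 : -Real.pi < θ2 := Complex.neg_pi_lt_arg _
  have l3 : -Real.pi < θ3 := Complex.neg_pi_lt_arg _
  have u1 : θ1 ≤ Real.pi := Complex.arg_le_pi _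
  have u2 : θ2 ≤ Real.pi := Complex.arg_le_pi _
  have u3 : θ3 ≤ Real.pi := Complex.arg_le_pi _
  rcases lt_or_gt_of_ne n12 with a12 | a12 <;> rcases lt_or_gt_of_ne n13 with a13 | a13 <;>
    rcases lt_or_gt_of_ne n23 with a23 | a23
  · exact main _ _ _ l1 a12 a23 u3 J1 J2 J3
  · exact main _ _ _ l1 a13 a23 u2 J1 J3 J2
  · linarith
  · exact main _ _ _ l3 a13 a12 u2 J3 J1 J2
  · exact main _ _ _ l2 a12 a13 u3 J2 J1 J3
  · linarith
  · exact main _ _ _ l2 a23 a13 u1 J2 J3 J1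
  · exact main _ _ _ l3 a23 a12 u1 J3 J2 J1

lemma moore_countable {Ω : Set ℂ} (f : ℂ → ℝ) :
    {h : ℝ | μH[1] (Ω ∩ f ⁻¹' {h}) ≠ ⊤ ∧ Triod (Ω ∩ f ⁻¹' {h})}.Countable := by
  set T := {h : ℝ | μH[1] (Ω ∩ f ⁻¹' {h}) ≠ ⊤ ∧ Triod (Ω ∩ f ⁻¹' {h})}
  choose d hd using fun h : T => moore_exists h.2.1 h.2.2
  have : Function.Injective d := by
    intro h h' hh
    have h2 := hd h'
    rw [← hh] at h2
    obtain ⟨x, hx1, hx2⟩ := moore_disjoint (hd h) h2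
    have e1 : f x = h := hx1.2
    have e2 : f x = h' := hx2.2
    exact Subtype.ext (e1.symm.trans e2)
  exact Set.countable_coe_iff.1 this.countable

end P4c

section P5

structure ArcAt (C : Set ℂ) (τ : ℝ → ℂ) (s t u : ℝ) : Prop where
  lt : s < t
  cont : ContinuousOn τ (Icc s t)
  inj : InjOn τ (Icc s t)
  maps : ∀ v ∈ Icc s t, τ v ∈ C
  mem : u ∈ Icc s t

lemma triod_mk {C : Set ℂ} {τ1 τ2 τ3 : ℝ → ℂ} {s1 t1 u1 s2 t2 u2 s3 t3 u3 : ℝ} {x : ℂ}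
    (h1 : ArcAt C τ1 s1 t1 u1) (h2 : ArcAt C τ2 s2 t2 u2) (h3 : ArcAt C τ3 s3 t3 u3)
    (e1 : τ1 u1 = x) (e2 : τ2 u2 = x) (e3 : τ3 u3 = x)
    (d12 : ∀ v ∈ Icc s1 t1, ∀ w ∈ Icc s2 t2, τ1 v = τ2 w → τ1 v = x)
    (d13 : ∀ v ∈ Icc s1 t1, ∀ w ∈ Icc s3 t3, τ1 v = τ3 w → τ1 v = x)
    (d23 : ∀ v ∈ Icc s2 t2, ∀ w ∈ Icc s3 t3, τ2 v = τ3 w → τ2 v = x) : Triod C := by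
  refine ⟨x, τ1 '' Icc s1 t1, τ2 '' Icc s2 t2, τ3 '' Icc s3 t3, ?_, ?_, ?_, ?_, ?_, ?_⟩
  · rw [← e1]; exact leg_arc h1.lt h1.cont h1.inj h1.maps h1.mem
  · rw [← e2]; exact leg_arc h2.lt h2.cont h2.inj h2.maps h2.mem
  · rw [← e3]; exact leg_arc h3.lt h3.cont h3.inj h3.maps h3.mem
  · rintro _ ⟨⟨v, hv, rfl⟩, ⟨w, hw, h⟩⟩; exact d12 v hv w hw h.symm
  · rintro _ ⟨⟨v, hv, rfl⟩, ⟨w, hw, h⟩⟩; exact d13 v hv w hw h.symm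
  · rintro _ ⟨⟨v, hv, rfl⟩, ⟨w, hw, h⟩⟩; exact d23 v hv w hw h.symm

lemma ArcAt.mono {C : Set ℂ} {τ : ℝ → ℂ} {s t u s' t' u' : ℝ} (h : ArcAt C τ s t u) (hs : s ≤ s')
    (ht : t' ≤ t) (hst : s' < t') (hu : u' ∈ Icc s' t') : ArcAt C τ s' t' u' where
  lt := hst
  cont := h.cont.mono (Icc_subset_Icc hs ht)
  inj := h.inj.mono (Icc_subset_Icc hs ht)
  maps := fun v hv => h.maps v (Icc_subset_Icc hs ht hv)
  mem := hu

/-- Two arcs issuing from the same point in a triod-free set. -/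
lemma two_arcs {C : Set ℂ} (hT : ¬ Triod C) {γ σ : ℝ → ℂ} {s b u0 : ℝ}
    (hγ : ArcAt C γ s b b) (hσ : ArcAt C σ 0 u0 0) (he : γ b = σ 0)
    (hs : ∀ u ∈ Icc 0 u0, σ u ≠ γ s) :
    (∀ u ∈ Ioc 0 u0, ∀ t ∈ Icc s b, σ u ≠ γ t) ∨
      ∃ t1 ∈ Ico s b, ∀ t ∈ Icc t1 b, γ t ∈ σ '' Icc 0 u0 := by
  by_cases hno : ∀ u ∈ Ioc 0 u0, ∀ t ∈ Icc s b, σ u ≠ γ t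
  · exact Or.inl hno
  right
  push Not at hno
  obtain ⟨uh, huh, th, hth, hhit⟩ := hno
  have hSc : IsClosed (σ '' Icc 0 u0) := (isCompact_Icc.image_of_continuousOn hσ.cont).isClosed
  set T := Icc s b ∩ γ ⁻¹' (σ '' Icc 0 u0) with hTdef
  have hTcl : IsClosed T := hγ.cont.preimage_isClosed_of_isClosed isClosed_Icc hSc
  have hTc : IsCompact T := isCompact_Icc.of_isClosed_subset hTcl inter_subset_left
  have hthT : th ∈ T := ⟨hth, uh, ⟨huh.1.le, huh.2⟩, hhit⟩
  have hthb : th < b := by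
    refine lt_of_le_of_ne hth.2 fun h => ?_
    rw [h, he] at hhit
    have := hσ.inj ⟨huh.1.le, huh.2⟩ hσ.mem hhit
    linarith [huh.1]
  obtain ⟨ti, htiT, hmin⟩ := hTc.exists_isLeast ⟨th, hthT⟩
  have htib : ti < b := (hmin hthT).trans_lt hthb
  obtain ⟨ui, hui, hσui⟩ := htiT.2
  have hsti : s < ti := by
    refine lt_of_le_of_ne htiT.1.1 fun h => ?_
    rw [← h] at hσui
    exact hs ui hui hσui
  have hposof : ∀ u ∈ Icc 0 u0, ∀ t ∈ Icc s b, t < b → σ u = γ t → 0 < u := by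
    intro u hu t ht htb h
    refine lt_of_le_of_ne hu.1 fun h0 => ?_
    rw [← h0, ← he] at h
    have := hγ.inj hγ.mem ht h
    linarith
  have hui0 : 0 < ui := hposof ui hui ti htiT.1 htib hσui
  -- points of `γ` before `ti` are not on `σ`
  have hbefore : ∀ t ∈ Icc s ti, ∀ u ∈ Icc 0 u0, γ t = σ u → t = ti := by
    intro t ht u hu h
    have : t ∈ T := ⟨⟨ht.1, ht.2.trans htib.le⟩, u, hu, h.symm⟩
    exact le_antisymm ht.2 (hmin this)
  have A1 : ArcAt C γ s ti ti := hγ.mono le_rfl htib.le hsti ⟨hsti.le, le_rfl⟩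
  have A2 : ArcAt C σ 0 ui ui := hσ.mono le_rfl hui.2 hui0 ⟨hui0.le, le_rfl⟩
  have huiu0 : ui = u0 := by
    by_contra hne
    have hlt : ui < u0 := lt_of_le_of_ne hui.2 hne
    have A3 : ArcAt C σ ui u0 ui := hσ.mono hui0.le le_rfl hlt ⟨le_rfl, hlt.le⟩
    refine hT (triod_mk (x := γ ti) A1 A2 A3 rfl hσui hσui ?_ ?_ ?_)
    · intro v hv w hw h
      rw [hbefore v hv w ⟨hw.1, hw.2.trans hui.2⟩ h]
    · intro v hv w hw h
      rw [hbefore v hv w ⟨hui0.le.trans hw.1, hw.2⟩ h]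
    · intro v hv w hw h
      have := hσ.inj ⟨hv.1, hv.2.trans hui.2⟩ ⟨hui0.le.trans hw.1, hw.2⟩ h
      have : v = ui := le_antisymm hv.2 (this ▸ hw.1)
      rw [this, hσui]
  refine ⟨ti, ⟨hsti.le, htib⟩, fun t ht => ?_⟩
  by_contra hnot
  have htb : t < b := by
    refine lt_of_le_of_ne ht.2 fun h => hnot ?_
    rw [h, he]; exact ⟨0, hσ.mem, rfl⟩
  have hT2 : IsCompact (T ∩ Iic t) := hTc.inter_right isClosed_Iic
  obtain ⟨t', ht'T, hmax⟩ := hT2.exists_isGreatest ⟨ti, htiT, ht.1⟩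
  have hit' : ti ≤ t' := hmin ht'T.1
  have ht's : s ≤ t' := hsti.le.trans hit'
  have ht't : t' < t := by
    refine lt_of_le_of_ne ht'T.2 fun h => hnot ?_
    rw [← h]; exact ht'T.1.2
  obtain ⟨u', hu', hσu'⟩ := ht'T.1.2
  have hafter : ∀ v ∈ Icc t' t, ∀ u ∈ Icc 0 u0, γ v = σ u → v = t' := by
    intro v hv u hu h
    have : v ∈ T ∩ Iic t := ⟨⟨⟨ht's.trans hv.1, hv.2.trans ht.2⟩, u, hu, h.symm⟩, hv.2⟩
    exact le_antisymm (hmax this) hv.1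
  have B1 : ArcAt C γ t' t t' := hγ.mono ht's ht.2 ht't ⟨le_rfl, ht't.le⟩
  rcases hit'.eq_or_lt with heq | hlt
  · subst heq
    refine hT (triod_mk (x := γ ti) A1 A2 B1 rfl hσui rfl ?_ ?_ ?_)
    · intro v hv w hw h
      rw [hbefore v hv w ⟨hw.1, hw.2.trans hui.2⟩ h]
    · intro v hv w hw h
      have := hγ.inj ⟨hv.1, hv.2.trans htib.le⟩ ⟨ht's.trans hw.1, hw.2.trans ht.2⟩ h
      rw [show v = ti from le_antisymm hv.2 (this ▸ hw.1)]
    · intro v hv w hw h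
      rw [h, hafter w hw v ⟨hv.1, hv.2.trans hui.2⟩ h.symm]
  · have hu'0 : 0 < u' := hposof u' hu' t' ht'T.1.1 (ht't.trans htb) hσu'
    have hu'i : u' < ui := by
      rw [huiu0]
      refine lt_of_le_of_ne hu'.2 fun h => ?_
      rw [h, ← huiu0, hσui] at hσu'
      have := hγ.inj htiT.1 ht'T.1.1 hσu'
      linarith
    have B2 : ArcAt C σ 0 u' u' := hσ.mono le_rfl hu'.2 hu'0 ⟨hu'0.le, le_rfl⟩
    have B3 : ArcAt C σ u' ui u' := hσ.mono hu'0.le hui.2 hu'i ⟨le_rfl, hu'i.le⟩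
    refine hT (triod_mk (x := γ t') B1 B2 B3 rfl hσu' hσu' ?_ ?_ ?_)
    · intro v hv w hw h
      rw [hafter v hv w ⟨hw.1, hw.2.trans hu'.2⟩ h]
    · intro v hv w hw h
      rw [hafter v hv w ⟨hu'0.le.trans hw.1, hw.2.trans hui.2⟩ h]
    · intro v hv w hw h
      have := hσ.inj ⟨hv.1, hv.2.trans hu'.2⟩ ⟨hu'0.le.trans hw.1, hw.2.trans hui.2⟩ h
      rw [show v = u' from le_antisymm hv.2 (this ▸ hw.1), hσu']

structure GoodPath (C : Set ℂ) (γ : ℝ → ℂ) (I : Set ℝ) : Prop where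
  lip : ∀ s ∈ I, ∀ t ∈ I, dist (γ s) (γ t) ≤ |s - t|
  inj : InjOn γ I
  maps : ∀ t ∈ I, γ t ∈ C
  ord : OrdConnected I
  opn : IsOpen I
  meas : ∀ s ∈ I, ∀ t ∈ I, s ≤ t → ENNReal.ofReal (t - s) ≤ 4 * μH[1] (γ '' Icc s t)

/-- graph version, used with Zorn. -/
structure GoodGraph (C : Set ℂ) (G : Set (ℝ × ℂ)) : Prop where
  lip : ∀ p ∈ G, ∀ q ∈ G, dist p.2 q.2 ≤ |p.1 - q.1|
  inj : ∀ p ∈ G, ∀ q ∈ G, p.2 = q.2 → p.1 = q.1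
  maps : ∀ p ∈ G, p.2 ∈ C
  ord : ∀ p ∈ G, ∀ q ∈ G, Icc p.1 q.1 ⊆ Prod.fst '' G
  opn : IsOpen (Prod.fst '' G)
  meas : ∀ p ∈ G, ∀ q ∈ G, p.1 ≤ q.1 →
    ENNReal.ofReal (q.1 - p.1) ≤ 4 * μH[1] {x | ∃ u ∈ Icc p.1 q.1, (u, x) ∈ G}

lemma fst_graph (γ : ℝ → ℂ) (I : Set ℝ) : Prod.fst '' ((fun t => (t, γ t)) '' I) = I := by
  rw [image_image]; simp

lemma GoodPath.graph {C : Set ℂ} {γ : ℝ → ℂ} {I : Set ℝ} (h : GoodPath C γ I) :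
    GoodGraph C ((fun t => (t, γ t)) '' I) where
  lip := by rintro _ ⟨s, hs, rfl⟩ _ ⟨t, ht, rfl⟩; exact h.lip s hs t ht
  inj := by rintro _ ⟨s, hs, rfl⟩ _ ⟨t, ht, rfl⟩ e; exact h.inj hs ht e
  maps := by rintro _ ⟨s, hs, rfl⟩; exact h.maps s hs
  ord := by
    rw [fst_graph]
    rintro _ ⟨s, hs, rfl⟩ _ ⟨t, ht, rfl⟩; exact h.ord.out hs ht
  opn := by rw [fst_graph]; exact h.opn
  meas := by
    rintro _ ⟨s, hs, rfl⟩ _ ⟨t, ht, rfl⟩ hst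
    refine (h.meas s hs t ht hst).trans ?_
    gcongr
    rintro _ ⟨u, hu, rfl⟩
    exact ⟨u, hu, u, h.ord.out hs ht hu, rfl⟩

lemma GoodGraph.path {C : Set ℂ} {G : Set (ℝ × ℂ)} (h : GoodGraph C G) :
    ∃ γ : ℝ → ℂ, GoodPath C γ (Prod.fst '' G) ∧ G = (fun t => (t, γ t)) '' (Prod.fst '' G) := by
  classical
  have hex : ∀ t : ℝ, ∃ x : ℂ, t ∈ Prod.fst '' G → (t, x) ∈ G := by
    intro t
    by_cases ht : t ∈ Prod.fst '' G
    · obtain ⟨⟨t, x⟩, hp, rfl⟩ := ht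
      exact ⟨x, fun _ => hp⟩
    · exact ⟨0, fun h => absurd h ht⟩
  choose γ hγ using hex
  have huniq : ∀ t x, (t, x) ∈ G → x = γ t := by
    intro t x hx
    have h1 := hγ t ⟨_, hx, rfl⟩
    have := h.lip _ hx _ h1
    simpa using this
  refine ⟨γ, ⟨?_, ?_, ?_, ?_, h.opn, ?_⟩, ?_⟩
  · intro s hs t ht; exact h.lip _ (hγ s hs) _ (hγ t ht)
  · intro s hs t ht e; exact h.inj _ (hγ s hs) _ (hγ t ht) e
  · intro t ht; exact h.maps _ (hγ t ht)
  · exact ⟨fun s hs t ht => h.ord _ (hγ s hs) _ (hγ t ht)⟩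
  · intro s hs t ht hst
    refine (h.meas _ (hγ s hs) _ (hγ t ht) hst).trans ?_
    gcongr
    rintro x ⟨u, hu, hux⟩
    exact ⟨u, hu, (huniq u x hux).symm⟩
  · ext ⟨t, x⟩
    constructor
    · intro hx; exact ⟨t, ⟨_, hx, rfl⟩, congrArg (Prod.mk t) (huniq t x hx).symm⟩
    · rintro ⟨s, hs, e⟩
      rw [← e]; exact hγ s hs

lemma exists_maximal_path {C : Set ℂ} {γ0 : ℝ → ℂ} {I0 : Set ℝ} (h0 : GoodPath C γ0 I0) :
    ∃ γ I, I0 ⊆ I ∧ GoodPath C γ I ∧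
      ∀ γ' I', GoodPath C γ' I' → I ⊆ I' → EqOn γ γ' I → I' ⊆ I := by
  obtain ⟨G, hG0, hG⟩ := zorn_subset_nonempty {G | GoodGraph C G} (by
    intro c hc hch hne
    refine ⟨⋃₀ c, ?_, fun s hs => subset_sUnion_of_mem hs⟩
    have htwo : ∀ p ∈ ⋃₀ c, ∀ q ∈ ⋃₀ c, ∃ G ∈ c, p ∈ G ∧ q ∈ G := by
      rintro p ⟨G1, h1, hp⟩ q ⟨G2, h2, hq⟩
      rcases hch.total h1 h2 with h | h
      · exact ⟨G2, h2, h hp, hq⟩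
      · exact ⟨G1, h1, hp, h hq⟩
    refine ⟨?_, ?_, ?_, ?_, ?_, ?_⟩
    · intro p hp q hq
      obtain ⟨G, hG, h1, h2⟩ := htwo p hp q hq
      exact (hc hG).lip p h1 q h2
    · intro p hp q hq
      obtain ⟨G, hG, h1, h2⟩ := htwo p hp q hq
      exact (hc hG).inj p h1 q h2
    · rintro p ⟨G, hG, h1⟩; exact (hc hG).maps p h1
    · intro p hp q hq
      obtain ⟨G, hG, h1, h2⟩ := htwo p hp q hq
      exact ((hc hG).ord p h1 q h2).trans (image_mono (subset_sUnion_of_mem hG))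
    · rw [sUnion_eq_biUnion, image_iUnion₂]
      exact isOpen_biUnion fun G hG => (hc hG).opn
    · intro p hp q hq hpq
      obtain ⟨G, hG, h1, h2⟩ := htwo p hp q hq
      refine ((hc hG).meas p h1 q h2 hpq).trans ?_
      refine mul_le_mul' le_rfl (measure_mono ?_)
      rintro x ⟨u, hu, hx⟩
      exact ⟨u, hu, G, hG, hx⟩) _ h0.graph
  obtain ⟨γ, hγ, hGγ⟩ := GoodGraph.path hG.prop
  refine ⟨γ, Prod.fst '' G, ?_, hγ, ?_⟩
  · have := image_mono (f := Prod.fst) hG0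
    rwa [fst_graph] at this
  · intro γ' I' h' hI he
    have hsub : G ⊆ (fun t => (t, γ' t)) '' I' := by
      rw [hGγ]
      rintro _ ⟨t, ht, rfl⟩
      exact ⟨t, hI ht, by simp [he ht]⟩
    have := hG.le_of_ge (y := (fun t => (t, γ' t)) '' I') h'.graph hsub
    have := image_mono (f := Prod.fst) this
    rwa [fst_graph] at this

end P5

section P6

lemma GoodPath.neg {C : Set ℂ} {γ : ℝ → ℂ} {a b : ℝ} (h : GoodPath C γ (Ioo a b)) :
    GoodPath C (fun t => γ (-t)) (Ioo (-b) (-a)) := by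
  have hm : ∀ t ∈ Ioo (-b) (-a), -t ∈ Ioo a b := fun t ht => ⟨by linarith [ht.2], by linarith [ht.1]⟩
  refine ⟨?_, ?_, ?_, ordConnected_Ioo, isOpen_Ioo, ?_⟩
  · intro s hs t ht
    refine (h.lip _ (hm s hs) _ (hm t ht)).trans_eq ?_
    rw [show -s - -t = -(s - t) by ring, abs_neg]
  · intro s hs t ht e
    exact neg_injective (h.inj (hm s hs) (hm t ht) e)
  · intro t ht; exact h.maps _ (hm t ht)
  · intro s hs t ht hst
    have := h.meas _ (hm t ht) _ (hm s hs) (by linarith)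
    rw [show -s - -t = t - s by ring] at this
    refine this.trans (mul_le_mul' le_rfl (measure_mono ?_))
    rintro _ ⟨u, hu, rfl⟩
    exact ⟨-u, ⟨by linarith [hu.2], by linarith [hu.1]⟩, by simp⟩

lemma GoodPath.lip_Icc {C : Set ℂ} {γ : ℝ → ℂ} {a b : ℝ} (hab : a < b) (h : GoodPath C γ (Ioo a b))
    (hc : Continuous γ) : ∀ s ∈ Icc a b, ∀ t ∈ Icc a b, dist (γ s) (γ t) ≤ |s - t| := by
  have hcl : IsClosed {p : ℝ × ℝ | dist (γ p.1) (γ p.2) ≤ |p.1 - p.2|} :=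
    isClosed_le (by fun_prop) (by fun_prop)
  have hsub : (Ioo a b) ×ˢ (Ioo a b) ⊆ {p : ℝ × ℝ | dist (γ p.1) (γ p.2) ≤ |p.1 - p.2|} :=
    fun p hp => h.lip _ hp.1 _ hp.2
  have := closure_minimal hsub hcl
  rw [closure_prod_eq, closure_Ioo hab.ne] at this
  intro s hs t ht
  exact this (show (s, t) ∈ Icc a b ×ˢ Icc a b from ⟨hs, ht⟩)

lemma GoodPath.meas_Ioc {C : Set ℂ} {γ : ℝ → ℂ} {a b : ℝ} (h : GoodPath C γ (Ioo a b))
    {s t : ℝ} (hs : a < s) (hst : s ≤ t) (ht : t ≤ b) :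
    ENNReal.ofReal (t - s) ≤ 4 * μH[1] (γ '' Icc s t) := by
  rcases hst.eq_or_lt with rfl | hlt
  · simp
  refine ENNReal.le_of_forall_pos_le_add ?_ |> fun f => f
  intro ε hε _
  set δ := min (ε:ℝ) ((t - s)/2) with hδ
  have hδ0 : 0 < δ := lt_min (by exact_mod_cast hε) (by linarith)
  have hδ1 : δ ≤ ε := min_le_left _ _
  have hδ2 : δ ≤ (t-s)/2 := min_le_right _ _
  have h1 := h.meas s ⟨hs, by linarith⟩ (t - δ) ⟨by linarith, by linarith⟩ (by linarith)
  calc ENNReal.ofReal (t - s) ≤ ENNReal.ofReal ((t - δ - s) + ε) := ENNReal.ofReal_le_ofReal (by linarith)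
    _ ≤ ENNReal.ofReal (t - δ - s) + ENNReal.ofReal ε := ENNReal.ofReal_add_le
    _ ≤ 4 * μH[1] (γ '' Icc s t) + ε := by
      refine add_le_add (h1.trans (mul_le_mul' le_rfl (measure_mono (image_mono
        (Icc_subset_Icc_right (by linarith)))))) ?_
      rw [ENNReal.ofReal_coe_nnreal]

/-- the right end point is not on the open arc -/
lemma end_not_mem {C : Set ℂ} (hT : ¬ Triod C) {γ : ℝ → ℂ} {a b : ℝ}
    (h : GoodPath C γ (Ioo a b)) (hc : Continuous γ) (hbC : γ b ∈ C) :
    ∀ t ∈ Ioo a b, γ t ≠ γ b := by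
  intro t ht e
  obtain ⟨s, hs1, hs2⟩ := exists_between ht.1
  obtain ⟨t2, h21, h22⟩ := exists_between ht.2
  obtain ⟨t3, h31, h32⟩ := exists_between h22
  have A1 : ArcAt C γ s t t := ⟨hs2, hc.continuousOn, h.inj.mono (show Icc s t ⊆ Ioo a b from fun v hv => ⟨by linarith [hv.1], by linarith [hv.2, ht.2]⟩),
    fun v hv => h.maps v ⟨by linarith [hv.1], by linarith [hv.2, ht.2]⟩, ⟨hs2.le, le_rfl⟩⟩
  have A2 : ArcAt C γ t t2 t := ⟨h21, hc.continuousOn, h.inj.mono (show Icc t t2 ⊆ Ioo a b from fun v hv => ⟨by linarith [hv.1, ht.1], by linarith [hv.2]⟩),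
    fun v hv => h.maps v ⟨by linarith [hv.1, ht.1], by linarith [hv.2]⟩, ⟨le_rfl, h21.le⟩⟩
  have hne : ∀ v ∈ Ico t3 b, γ v ≠ γ b := by
    intro v hv e2
    have := h.inj ⟨by linarith [hv.1, ht.1], hv.2⟩ ht (e2.trans e.symm)
    linarith [hv.1]
  have A3 : ArcAt C γ t3 b b := by
    refine ⟨h32, hc.continuousOn, ?_, ?_, ⟨h32.le, le_rfl⟩⟩
    · intro v hv w hw e2
      rcases hv.2.eq_or_lt with hv2 | hv2 <;> rcases hw.2.eq_or_lt with hw2 | hw2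
      · rw [hv2, hw2]
      · rw [hv2] at e2; exact absurd e2.symm (hne w ⟨hw.1, hw2⟩)
      · rw [hw2] at e2; exact absurd e2 (hne v ⟨hv.1, hv2⟩)
      · exact h.inj ⟨by linarith [hv.1, ht.1], hv2⟩ ⟨by linarith [hw.1, ht.1], hw2⟩ e2
    · intro v hv
      rcases hv.2.eq_or_lt with hv2 | hv2
      · rw [hv2]; exact hbC
      · exact h.maps v ⟨by linarith [hv.1, ht.1], hv2⟩
  have key : ∀ v, a < v → v ≤ t2 → ∀ w ∈ Icc t3 b, γ v = γ w → γ v = γ t := by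
    intro v hv1 hv2 w hw e2
    rcases hw.2.eq_or_lt with hw2 | hw2
    · rw [e2, hw2, e]
    · have := h.inj ⟨hv1, by linarith⟩ ⟨by linarith [hw.1, ht.1], hw2⟩ e2
      linarith [hw.1]
  refine hT (triod_mk (x := γ t) A1 A2 A3 rfl rfl e.symm ?_ ?_ ?_)
  · intro v hv w hw e2
    have := h.inj ⟨by linarith [hv.1], by linarith [hv.2]⟩ ⟨by linarith [hw.1, ht.1], by linarith [hw.2]⟩ e2
    rw [show v = t from le_antisymm hv.2 (this ▸ hw.1)]
  · intro v hv w hw e2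
    exact key v (by linarith [hv.1]) (by linarith [hv.2]) w hw e2
  · intro v hv w hw e2
    exact key v (by linarith [hv.1, ht.1]) (by linarith [hv.2]) w hw e2

lemma inj_Ioc {γ : ℝ → ℂ} {a b : ℝ} (h : InjOn γ (Ioo a b)) (hne : ∀ t ∈ Ioo a b, γ t ≠ γ b) :
    InjOn γ (Ioc a b) := by
  intro v hv w hw e2
  rcases hv.2.eq_or_lt with hv2 | hv2 <;> rcases hw.2.eq_or_lt with hw2 | hw2
  · rw [hv2, hw2]
  · rw [hv2] at e2; exact absurd e2.symm (hne w ⟨hw.1, hw2⟩)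
  · rw [hw2] at e2; exact absurd e2 (hne v ⟨hv.1, hv2⟩)
  · exact h ⟨hv.1, hv2⟩ ⟨hw.1, hw2⟩ e2

/-- concatenation -/
lemma GoodPath.concat {C : Set ℂ} {γ σ : ℝ → ℂ} {a b u : ℝ} (hab : a < b) (hu : 0 < u)
    (h : GoodPath C γ (Ioo a b)) (hc : Continuous γ) (hbC : γ b ∈ C)
    (hne : ∀ t ∈ Ioo a b, γ t ≠ γ b)
    (hσ0 : σ 0 = γ b) (hσl : ∀ s ∈ Icc 0 u, ∀ t ∈ Icc 0 u, dist (σ s) (σ t) ≤ |s - t|)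
    (hσi : InjOn σ (Icc 0 u)) (hσC : ∀ t ∈ Icc 0 u, σ t ∈ C)
    (hσm : ∀ s t, 0 ≤ s → s ≤ t → t ≤ u → ENNReal.ofReal (t - s) ≤ 4 * μH[1] (σ '' Icc s t))
    (hav : ∀ s ∈ Ioc 0 u, ∀ t ∈ Ioc a b, σ s ≠ γ t) :
    ∃ γ', GoodPath C γ' (Ioo a (b + u)) ∧ EqOn γ γ' (Ioo a b) := by
  classical
  set γ' : ℝ → ℂ := fun t => if t ≤ b then γ t else σ (t - b) with hγ'
  have e1 : ∀ t, t ≤ b → γ' t = γ t := fun t ht => by simp [hγ', ht]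
  have e2 : ∀ t, b ≤ t → γ' t = σ (t - b) := by
    intro t ht
    rcases ht.eq_or_lt with rfl | hlt
    · simp [hγ', hσ0]
    · simp [hγ', not_le.2 hlt]
  have hinj := inj_Ioc h.inj hne
  have hl := h.lip_Icc hab hc
  have lipaux : ∀ s ∈ Ioo a (b+u), ∀ t ∈ Ioo a (b+u), s ≤ t → dist (γ' s) (γ' t) ≤ t - s := by
    intro s hs t ht hst
    rcases le_total t b with htb | htb
    · rw [e1 s (hst.trans htb), e1 t htb]
      refine (hl s ⟨hs.1.le, hst.trans htb⟩ t ⟨ht.1.le, htb⟩).trans_eq ?_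
      rw [abs_sub_comm, abs_of_nonneg (by linarith)]
    · rcases le_total s b with hsb | hsb
      · have h1 := hl s ⟨hs.1.le, hsb⟩ b ⟨hab.le, le_rfl⟩
        have h2 := hσl 0 ⟨le_rfl, hu.le⟩ (t - b) ⟨by linarith, by linarith [ht.2]⟩
        rw [abs_sub_comm, abs_of_nonneg (by linarith)] at h1 h2
        rw [e1 s hsb, e2 t htb]
        have := dist_triangle (γ s) (γ b) (σ (t - b))
        rw [hσ0] at h2
        linarith
      · rw [e2 s hsb, e2 t htb]
        refine (hσl _ ⟨by linarith, by linarith [hs.2]⟩ _ ⟨by linarith, by linarith [ht.2]⟩).trans_eq ?_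
        rw [abs_sub_comm, abs_of_nonneg (by linarith)]; ring
  have injaux : ∀ s ∈ Ioo a (b+u), ∀ t ∈ Ioo a (b+u), s ≤ t → γ' s = γ' t → s = t := by
    intro s hs t ht hst e
    rcases le_or_gt t b with htb | htb
    · rw [e1 s (hst.trans htb), e1 t htb] at e
      exact hinj ⟨hs.1, hst.trans htb⟩ ⟨ht.1, htb⟩ e
    · rcases le_total s b with hsb | hsb
      · rw [e1 s hsb, e2 t htb.le] at e
        exact absurd e.symm (hav _ ⟨by linarith, by linarith [ht.2]⟩ s ⟨hs.1, hsb⟩)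
      · rw [e2 s hsb, e2 t htb.le] at e
        have := hσi ⟨by linarith, by linarith [hs.2]⟩ ⟨by linarith, by linarith [ht.2]⟩ e
        linarith
  have im1 : ∀ s t, t ≤ b → γ '' Icc s t ⊆ γ' '' Icc s t := by
    rintro s t ht _ ⟨v, hv, rfl⟩
    exact ⟨v, hv, e1 v (hv.2.trans ht)⟩
  have im2 : ∀ s t, b ≤ s → σ '' Icc (s - b) (t - b) ⊆ γ' '' Icc s t := by
    rintro s t hs _ ⟨v, hv, rfl⟩
    refine ⟨v + b, ⟨by linarith [hv.1], by linarith [hv.2]⟩, ?_⟩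
    rw [e2 _ (by linarith [hv.1])]; simp
  refine ⟨γ', ⟨?_, ?_, ?_, ordConnected_Ioo, isOpen_Ioo, ?_⟩, fun t ht => (e1 t ht.2.le).symm⟩
  · intro s hs t ht
    rcases le_total s t with hst | hst
    · rw [abs_sub_comm, abs_of_nonneg (sub_nonneg.2 hst)]; exact lipaux s hs t ht hst
    · rw [abs_of_nonneg (sub_nonneg.2 hst), dist_comm]; exact lipaux t ht s hs hst
  · intro s hs t ht e
    rcases le_total s t with hst | hst
    · exact injaux s hs t ht hst e
    · exact (injaux t ht s hs hst e.symm).symm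
  · intro t ht
    rcases lt_trichotomy t b with htb | htb | htb
    · rw [e1 t htb.le]; exact h.maps t ⟨ht.1, htb⟩
    · rw [e1 t htb.le, htb]; exact hbC
    · rw [e2 t htb.le]; exact hσC _ ⟨by linarith, by linarith [ht.2]⟩
  · intro s hs t ht hst
    rcases le_total t b with htb | htb
    · exact (h.meas_Ioc hs.1 hst htb).trans (mul_le_mul' le_rfl (measure_mono (im1 s t htb)))
    · rcases le_total s b with hsb | hsb
      · have h1 := h.meas_Ioc hs.1 hsb le_rfl
        have h2 := hσm 0 (t - b) le_rfl (by linarith) (by linarith [ht.2])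
        have hd : AEDisjoint μH[1] (γ '' Icc s b) (σ '' Icc 0 (t - b)) := by
          have : γ '' Icc s b ∩ σ '' Icc 0 (t - b) ⊆ {γ b} := by
            rintro _ ⟨⟨v, hv, rfl⟩, ⟨w, hw, e⟩⟩
            rcases hw.1.eq_or_lt with h0 | h0
            · rw [← h0, hσ0] at e; exact e.symm
            · exact absurd e (hav w ⟨h0, by linarith [hw.2, ht.2]⟩ v ⟨hs.1.trans_le hv.1, hv.2⟩)
          refine measure_mono_null this ?_
          have : NullSingletonClass (μH[1] : Measure ℂ) := Measure.nullSingletonClass_hausdorff ℂ one_pos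
          exact measure_singleton _
        have hm : NullMeasurableSet (σ '' Icc 0 (t - b)) (μH[1] : Measure ℂ) := by
          have hcσ : ContinuousOn σ (Icc 0 (t - b)) := by
            have : LipschitzOnWith 1 σ (Icc 0 (t - b)) := LipschitzOnWith.of_dist_le_mul (by
              intro x hx y hy
              rw [Real.dist_eq]; simp only [NNReal.coe_one, one_mul]
              exact hσl x ⟨hx.1, by linarith [hx.2, ht.2]⟩ y ⟨hy.1, by linarith [hy.2, ht.2]⟩)
            exact this.continuousOn
          exact (isCompact_Icc.image_of_continuousOn hcσ).measurableSet.nullMeasurableSet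
        calc ENNReal.ofReal (t - s) = ENNReal.ofReal ((b - s) + (t - b - 0)) := by congr 1; ring
          _ = ENNReal.ofReal (b - s) + ENNReal.ofReal (t - b - 0) :=
              ENNReal.ofReal_add (by linarith) (by linarith)
          _ ≤ 4 * μH[1] (γ '' Icc s b) + 4 * μH[1] (σ '' Icc 0 (t - b)) := add_le_add h1 h2
          _ = 4 * μH[1] (γ '' Icc s b ∪ σ '' Icc 0 (t - b)) := by
              rw [measure_union₀ hm hd, mul_add]
          _ ≤ 4 * μH[1] (γ' '' Icc s t) := by
              refine mul_le_mul' le_rfl (measure_mono (union_subset ?_ ?_))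
              · exact (im1 s b le_rfl).trans (image_mono (Icc_subset_Icc_right htb))
              · have := im2 b t le_rfl
                rw [sub_self] at this
                exact this.trans (image_mono (Icc_subset_Icc_left hsb))
      · have := hσm (s - b) (t - b) (by linarith) (by linarith) (by linarith [ht.2])
        rw [show t - b - (s - b) = t - s by ring] at this
        exact this.trans (mul_le_mul' le_rfl (measure_mono (im2 s t hsb)))

end P6

section P7

lemma leg_follow {C : Set ℂ} (hfin : μH[1] C ≠ ⊤) (hT : ¬ Triod C) {γ : ℝ → ℂ} {a b : ℝ} (hab : a < b)
    (h : GoodPath C γ (Ioo a b)) (hc : Continuous γ) (hne : γ a ≠ γ b) {K : Set ℂ}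
    (hK : Leg C (γ b) K) (hno : ¬ ∃ γ' b', b < b' ∧ GoodPath C γ' (Ioo a b') ∧ EqOn γ γ' (Ioo a b)) :
    ∃ t1 ∈ Ioo a b, ∀ t ∈ Icc t1 b, γ t ∈ K := by
  have hbC : γ b ∈ C := hK.sub hK.mem
  have hend := end_not_mem hT h hc hbC
  have hinj := inj_Ioc h.inj hend
  obtain ⟨z, hz, hzb⟩ := hK.nontriv
  obtain ⟨ℓ, hℓ, σ, hσ, hσi, hσm⟩ := exists_arc hK.comp hK.conn
    (ne_top_of_le_ne_top hfin (measure_mono hK.sub)) hK.mem hz hzb.symm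
  have hσc := hσ.continuousOn
  obtain ⟨-, hσ0, -, hσK, hσl⟩ := hσ
  obtain ⟨s, has, hsb⟩ := exists_between hab
  have hcl : IsClosed (γ '' Icc a s) := (isCompact_Icc.image hc).isClosed
  have hbn : γ b ∉ γ '' Icc a s := by
    rintro ⟨v, hv, e⟩
    rcases hv.1.eq_or_lt with h1 | h1
    · exact hne (h1 ▸ e)
    · exact hend v ⟨h1, hv.2.trans_lt hsb⟩ e
  have hev : ∀ᶠ u in 𝓝[Icc 0 ℓ] (0:ℝ), σ u ∉ γ '' Icc a s := by
    have := hσc 0 ⟨le_rfl, hℓ.le⟩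
    refine Tendsto.eventually (p := fun z => z ∉ γ '' Icc a s) this ?_
    rw [hσ0]
    exact hcl.isOpen_compl.mem_nhds hbn
  rw [eventually_nhdsWithin_iff, Metric.eventually_nhds_iff] at hev
  obtain ⟨ε, hε, hev⟩ := hev
  set u0 := min ℓ (ε/2) with hu0
  have hu00 : 0 < u0 := lt_min hℓ (by linarith)
  have hu0ℓ : u0 ≤ ℓ := min_le_left _ _
  have hu0ε : u0 ≤ ε/2 := min_le_right _ _
  have hav0 : ∀ u ∈ Icc 0 u0, σ u ∉ γ '' Icc a s := by
    intro u hu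
    refine hev ?_ ⟨hu.1, hu.2.trans hu0ℓ⟩
    rw [Real.dist_eq, sub_zero, abs_of_nonneg hu.1]; linarith [hu.2]
  have Aσ : ArcAt C σ 0 u0 0 := ⟨hu00, hσc.mono (Icc_subset_Icc_right hu0ℓ),
    hσi.mono (Icc_subset_Icc_right hu0ℓ), fun v hv => hK.sub (hσK v ⟨hv.1, hv.2.trans hu0ℓ⟩),
    ⟨le_rfl, hu00.le⟩⟩
  have Aγ : ArcAt C γ s b b := ⟨hsb, hc.continuousOn,
    hinj.mono (show Icc s b ⊆ Ioc a b from fun v hv => ⟨has.trans_le hv.1, hv.2⟩), (by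
      intro v hv
      rcases hv.2.eq_or_lt with h1 | h1
      · rw [h1]; exact hbC
      · exact h.maps v ⟨has.trans_le hv.1, h1⟩), ⟨hsb.le, le_rfl⟩⟩
  rcases two_arcs hT Aγ Aσ hσ0.symm (fun u hu e => hav0 u hu ⟨s, ⟨has.le, le_rfl⟩, e.symm⟩) with h1 | h1
  · exfalso
    apply hno
    obtain ⟨γ', hγ', heq⟩ := GoodPath.concat hab hu00 h hc hbC hend hσ0
      (fun s hs t ht => hσl s ⟨hs.1, hs.2.trans hu0ℓ⟩ t ⟨ht.1, ht.2.trans hu0ℓ⟩) Aσ.inj Aσ.maps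
      (fun s t hs hst ht => hσm s t hs hst (ht.trans hu0ℓ)) (by
        intro u hu t ht e
        rcases le_total t s with hts | hts
        · exact hav0 u ⟨hu.1.le, hu.2⟩ ⟨t, ⟨ht.1.le, hts⟩, e.symm⟩
        · exact h1 u hu t ⟨hts, ht.2⟩ e)
    exact ⟨γ', b + u0, by linarith, hγ', heq⟩
  · obtain ⟨t1, ht1, hsub⟩ := h1
    refine ⟨t1, ⟨has.trans_le ht1.1, ht1.2⟩, fun t ht => ?_⟩
    obtain ⟨u, hu, e⟩ := hsub t ht
    rw [← e]
    exact hσK u ⟨hu.1, hu.2.trans hu0ℓ⟩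

lemma extend_right {C : Set ℂ} (hfin : μH[1] C ≠ ⊤) (hT : ¬ Triod C) {γ : ℝ → ℂ} {a b : ℝ} (hab : a < b)
    (h : GoodPath C γ (Ioo a b)) (hc : Continuous γ) (hne : γ a ≠ γ b) {K1 K2 : Set ℂ}
    (hK1 : Leg C (γ b) K1) (hK2 : Leg C (γ b) K2) (h12 : K1 ∩ K2 ⊆ {γ b}) :
    ∃ γ' b', b < b' ∧ GoodPath C γ' (Ioo a b') ∧ EqOn γ γ' (Ioo a b) := by
  by_contra hno
  obtain ⟨t1, ht1, h1⟩ := leg_follow hfin hT hab h hc hne hK1 hno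
  obtain ⟨t2, ht2, h2⟩ := leg_follow hfin hT hab h hc hne hK2 hno
  have hm : max t1 t2 < b := max_lt ht1.2 ht2.2
  have := h12 ⟨h1 (max t1 t2) ⟨le_max_left _ _, hm.le⟩, h2 (max t1 t2) ⟨le_max_right _ _, hm.le⟩⟩
  exact end_not_mem hT h hc (hK1.sub hK1.mem) (max t1 t2) ⟨ht1.1.trans_le (le_max_left _ _), hm⟩ this

lemma GoodPath.congr {C : Set ℂ} {γ γ' : ℝ → ℂ} {I : Set ℝ} (h : GoodPath C γ I) (he : EqOn γ γ' I) :
    GoodPath C γ' I := by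
  refine ⟨?_, h.inj.congr he, ?_, h.ord, h.opn, ?_⟩
  · intro s hs t ht; rw [← he hs, ← he ht]; exact h.lip s hs t ht
  · intro t ht; rw [← he ht]; exact h.maps t ht
  · intro s hs t ht hst
    rw [← (he.mono (h.ord.out hs ht)).image_eq]; exact h.meas s hs t ht hst

lemma ord_open_Ioo {I : Set ℝ} (ho : IsOpen I) (hI : OrdConnected I) (hne : I.Nonempty)
    (hb : BddBelow I) (hb' : BddAbove I) : ∃ a b, a < b ∧ I = Ioo a b := by
  refine ⟨sInf I, sSup I, ?_, ?_⟩
  · have h2 : I ⊆ Ioo (sInf I) (sSup I) := ?_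
    · obtain ⟨x, hx⟩ := hne
      exact (h2 hx).1.trans (h2 hx).2
    intro t ht
    obtain ⟨ε, hε, hball⟩ := Metric.isOpen_iff.1 ho t ht
    have h1 : t - ε/2 ∈ I := hball (by rw [Metric.mem_ball, Real.dist_eq, abs_lt]; constructor <;> linarith)
    have h2 : t + ε/2 ∈ I := hball (by rw [Metric.mem_ball, Real.dist_eq, abs_lt]; constructor <;> linarith)
    exact ⟨by linarith [csInf_le hb h1], by linarith [le_csSup hb' h2]⟩
  · apply Subset.antisymm
    · intro t ht
      obtain ⟨ε, hε, hball⟩ := Metric.isOpen_iff.1 ho t ht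
      have h1 : t - ε/2 ∈ I := hball (by rw [Metric.mem_ball, Real.dist_eq, abs_lt]; constructor <;> linarith)
      have h2 : t + ε/2 ∈ I := hball (by rw [Metric.mem_ball, Real.dist_eq, abs_lt]; constructor <;> linarith)
      exact ⟨by linarith [csInf_le hb h1], by linarith [le_csSup hb' h2]⟩
    · intro t ht
      obtain ⟨x, hx, hxt⟩ := exists_lt_of_csInf_lt hne ht.1
      obtain ⟨y, hy, hty⟩ := exists_lt_of_lt_csSup hne ht.2
      exact hI.out hx hy ⟨hxt.le, hty.le⟩

/-- If an arc meets interior point of an open good path from outside, there is a triod. -/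
lemma cover_aux {C : Set ℂ} (hfin : μH[1] C ≠ ⊤) (hT : ¬ Triod C)
    (hjoin : ∀ x ∈ C, ∀ y ∈ C, ∃ K ⊆ C, IsCompact K ∧ IsPreconnected K ∧ x ∈ K ∧ y ∈ K)
    {γ : ℝ → ℂ} {a b : ℝ} (hab : a < b) (h : GoodPath C γ (Ioo a b)) (hc : Continuous γ)
    (hends : (γ a ∉ C ∧ γ b ∉ C) ∨ (γ b ∈ C ∧ γ a = γ b)) : C ⊆ γ '' Icc a b := by
  intro z hzC
  by_contra hz
  obtain ⟨m, ham, hmb⟩ := exists_between hab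
  have hmC : γ m ∈ C := h.maps m ⟨ham, hmb⟩
  obtain ⟨K, hKC, hKc, hKp, hzK, hmK⟩ := hjoin z hzC _ hmC
  have hzm : z ≠ γ m := fun e => hz ⟨m, ⟨ham.le, hmb.le⟩, e.symm⟩
  obtain ⟨ℓ, hℓ, σ, hσ, hσi, -⟩ := exists_arc hKc hKp
    (ne_top_of_le_ne_top hfin (measure_mono hKC)) hzK hmK hzm
  have hσc := hσ.continuousOn
  obtain ⟨-, hσ0, hσe, hσK, -⟩ := hσ
  have hcl : IsClosed (γ '' Icc a b) := (isCompact_Icc.image hc).isClosed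
  have hTc : IsCompact (Icc 0 ℓ ∩ σ ⁻¹' (γ '' Icc a b)) :=
    isCompact_Icc.of_isClosed_subset (hσc.preimage_isClosed_of_isClosed isClosed_Icc hcl)
      inter_subset_left
  obtain ⟨u, ⟨hu, t, ht, hut⟩, hmin⟩ := hTc.exists_isLeast
    ⟨ℓ, ⟨hℓ.le, le_rfl⟩, m, ⟨ham.le, hmb.le⟩, hσe.symm⟩
  have hu0 : 0 < u := by
    refine lt_of_le_of_ne hu.1 fun e => hz ?_
    rw [← hσ0, e, ← hut]; exact ⟨t, ht, rfl⟩
  have hfirst : ∀ v ∈ Icc 0 u, ∀ w ∈ Icc a b, σ v = γ w → v = u := by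
    intro v hv w hw e
    exact le_antisymm hv.2 (hmin ⟨⟨hv.1, hv.2.trans hu.2⟩, w, hw, e.symm⟩)
  have hC1 : γ t ∈ C := by rw [hut]; exact hKC (hσK u hu)
  have A1 : ArcAt C σ 0 u u := ⟨hu0, hσc.mono (Icc_subset_Icc_right hu.2),
    hσi.mono (Icc_subset_Icc_right hu.2), fun v hv => hKC (hσK v ⟨hv.1, hv.2.trans hu.2⟩),
    ⟨hu0.le, le_rfl⟩⟩
  have caseint : ∀ t ∈ Ioo a b, γ t = σ u → False := by
    intro t ht hut
    obtain ⟨t1, h11, h12⟩ := exists_between ht.1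
    obtain ⟨t2, h21, h22⟩ := exists_between ht.2
    have A2 : ArcAt C γ t1 t t := ⟨h12, hc.continuousOn,
      h.inj.mono (show Icc t1 t ⊆ Ioo a b from fun v hv => ⟨by linarith [hv.1], by linarith [hv.2, ht.2]⟩),
      fun v hv => h.maps v ⟨by linarith [hv.1], by linarith [hv.2, ht.2]⟩, ⟨h12.le, le_rfl⟩⟩
    have A3 : ArcAt C γ t t2 t := ⟨h21, hc.continuousOn,
      h.inj.mono (show Icc t t2 ⊆ Ioo a b from fun v hv => ⟨by linarith [hv.1, ht.1], by linarith [hv.2, ht.2]⟩),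
      fun v hv => h.maps v ⟨by linarith [hv.1, ht.1], by linarith [hv.2, ht.2]⟩, ⟨le_rfl, h21.le⟩⟩
    refine hT (triod_mk (x := σ u) A1 A2 A3 rfl hut hut ?_ ?_ ?_)
    · intro v hv w hw e
      rw [hfirst v hv w ⟨by linarith [hw.1], by linarith [hw.2, ht.2]⟩ e]
    · intro v hv w hw e
      rw [hfirst v hv w ⟨by linarith [hw.1, ht.1], by linarith [hw.2]⟩ e]
    · intro v hv w hw e
      have := h.inj ⟨by linarith [hv.1], by linarith [hv.2, ht.2]⟩ ⟨by linarith [hw.1, ht.1], by linarith [hw.2]⟩ e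
      rw [show v = t from le_antisymm hv.2 (this ▸ hw.1), hut]
  rcases hends with ⟨ha, hb⟩ | ⟨hbC, hab'⟩
  · refine caseint t ⟨lt_of_le_of_ne ht.1 ?_, lt_of_le_of_ne ht.2 ?_⟩ hut
    · rintro rfl; exact ha hC1
    · rintro rfl; exact hb hC1
  · by_cases hint : t ∈ Ioo a b
    · exact caseint t hint hut
    have hub : σ u = γ b := by
      rw [← hut]
      rcases ht.1.eq_or_lt with h1 | h1
      · rw [← h1, hab']
      · rcases ht.2.eq_or_lt with h2 | h2
        · rw [h2]
        · exact absurd ⟨h1, h2⟩ hint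
    have hend := end_not_mem hT h hc hbC
    have hinj := inj_Ioc h.inj hend
    obtain ⟨t1, h11, h12⟩ := exists_between ham
    obtain ⟨t2, h21, h22⟩ := exists_between hmb
    have A2 : ArcAt C γ a t1 a := by
      refine ⟨h11, hc.continuousOn, ?_, ?_, ⟨le_rfl, h11.le⟩⟩
      · intro v hv w hw e
        rcases hv.1.eq_or_lt with hv2 | hv2 <;> rcases hw.1.eq_or_lt with hw2 | hw2
        · rw [← hv2, ← hw2]
        · rw [← hv2, hab'] at e; exact absurd e.symm (hend w ⟨hw2, by linarith [hw.2]⟩)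
        · rw [← hw2, hab'] at e; exact absurd e (hend v ⟨hv2, by linarith [hv.2]⟩)
        · exact h.inj ⟨hv2, by linarith [hv.2]⟩ ⟨hw2, by linarith [hw.2]⟩ e
      · intro v hv
        rcases hv.1.eq_or_lt with hv2 | hv2
        · rw [← hv2, hab']; exact hbC
        · exact h.maps v ⟨hv2, by linarith [hv.2]⟩
    have A3 : ArcAt C γ t2 b b := by
      refine ⟨h22, hc.continuousOn,
        hinj.mono (show Icc t2 b ⊆ Ioc a b from fun v hv => ⟨by linarith [hv.1], hv.2⟩), ?_, ⟨h22.le, le_rfl⟩⟩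
      intro v hv
      rcases hv.2.eq_or_lt with hv2 | hv2
      · rw [hv2]; exact hbC
      · exact h.maps v ⟨by linarith [hv.1], hv2⟩
    refine hT (triod_mk (x := σ u) A1 A2 A3 rfl (hab'.trans hub.symm) hub.symm ?_ ?_ ?_)
    · intro v hv w hw e
      rw [hfirst v hv w ⟨by linarith [hw.1], by linarith [hw.2]⟩ e]
    · intro v hv w hw e
      rw [hfirst v hv w ⟨by linarith [hw.1], by linarith [hw.2]⟩ e]
    · intro v hv w hw e
      rcases hv.1.eq_or_lt with hv2 | hv2
      · rw [← hv2, hab', hub]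
      · have := hinj ⟨hv2, by linarith [hv.2]⟩ ⟨by linarith [hw.1], hw.2⟩ e
        linarith [hv.2, hw.1]

theorem classification {C : Set ℂ} (hfin : μH[1] C ≠ ⊤) (hT : ¬ Triod C)
    (hjoin : ∀ x ∈ C, ∀ y ∈ C, ∃ K ⊆ C, IsCompact K ∧ IsPreconnected K ∧ x ∈ K ∧ y ∈ K)
    (hlegs : ∀ a ∈ C, ∃ K1 K2, Leg C a K1 ∧ Leg C a K2 ∧ K1 ∩ K2 ⊆ {a})
    (hns : ¬ C.Subsingleton) :
    ∃ (γ : ℝ → ℂ) (L : ℝ≥0) (a b : ℝ), a < b ∧ LipschitzWith L γ ∧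
      ((γ a = γ b ∧ InjOn γ (Ico a b) ∧ C = γ '' Ico a b) ∨
        (γ a ∉ C ∧ γ b ∉ C ∧ InjOn γ (Ioo a b) ∧ C = γ '' Ioo a b)) := by
  rw [not_subsingleton_iff] at hns
  obtain ⟨x, hx, y, hy, hxy⟩ := hns
  obtain ⟨K, hKC, hKc, hKp, hxK, hyK⟩ := hjoin x hx y hy
  obtain ⟨ℓ, hℓ, σ, hσ, hσi, hσm⟩ := exists_arc hKc hKp
    (ne_top_of_le_ne_top hfin (measure_mono hKC)) hxK hyK hxy
  have h0 : GoodPath C σ (Ioo 0 ℓ) := by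
    refine ⟨?_, hσi.mono Ioo_subset_Icc_self, ?_, ordConnected_Ioo, isOpen_Ioo, ?_⟩
    · intro s hs t ht
      exact hσ.2.2.2.2 s (Ioo_subset_Icc_self hs) t (Ioo_subset_Icc_self ht)
    · intro t ht; exact hKC (hσ.2.2.2.1 t (Ioo_subset_Icc_self ht))
    · intro s hs t ht hst; exact hσm s t hs.1.le hst ht.2.le
  obtain ⟨γ0, I, hI0, hγ0, hmax⟩ := exists_maximal_path h0
  have hne : I.Nonempty := ⟨ℓ/2, hI0 ⟨by linarith, by linarith⟩⟩
  have hbound : ∀ s ∈ I, ∀ t ∈ I, t - s ≤ (4 * μH[1] C).toReal := by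
    intro s hs t ht
    have htop : 4 * μH[1] C ≠ ⊤ := ENNReal.mul_ne_top (by norm_num) hfin
    rcases le_total s t with hst | hst
    · have := (hγ0.meas s hs t ht hst).trans (mul_le_mul' le_rfl (measure_mono (show γ0 '' Icc s t ⊆ C by
        rintro _ ⟨u, hu, rfl⟩; exact hγ0.maps u (hγ0.ord.out hs ht hu))))
      exact (ENNReal.ofReal_le_iff_le_toReal htop).1 this
    · exact (sub_nonpos.2 hst).trans ENNReal.toReal_nonneg
  obtain ⟨x1, hx1⟩ := hne
  obtain ⟨a, b, hab, rfl⟩ := ord_open_Ioo hγ0.opn hγ0.ord ⟨x1, hx1⟩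
    ⟨x1 - (4 * μH[1] C).toReal, fun t ht => by linarith [hbound t ht x1 hx1]⟩
    ⟨x1 + (4 * μH[1] C).toReal, fun t ht => by linarith [hbound x1 hx1 t ht]⟩
  have hlip0 : LipschitzOnWith 1 γ0 (Ioo a b) := LipschitzOnWith.of_dist_le_mul (by
    intro x hx y hy
    rw [Real.dist_eq]; simp only [NNReal.coe_one, one_mul]
    exact hγ0.lip x hx y hy)
  obtain ⟨γ, hγlip, hγeq⟩ := hlip0.extend_finite_dimension
  have hc : Continuous γ := hγlip.continuous
  have h : GoodPath C γ (Ioo a b) := hγ0.congr hγeq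
  have hmax' : ∀ γ' I', GoodPath C γ' I' → Ioo a b ⊆ I' → EqOn γ γ' (Ioo a b) → I' ⊆ Ioo a b :=
    fun γ' I' h1 h2 h3 => hmax γ' I' h1 h2 (hγeq.trans h3)
  have hb : γ b ∈ C → γ a = γ b := by
    intro hbC
    by_contra hne
    obtain ⟨K1, K2, hK1, hK2, h12⟩ := hlegs _ hbC
    obtain ⟨γ', b', hb', hg', he'⟩ := extend_right hfin hT hab h hc hne hK1 hK2 h12
    have := hmax' γ' _ hg' (Ioo_subset_Ioo_right hb'.le) he' ⟨hab, hb'⟩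
    exact lt_irrefl _ this.2
  have ha : γ a ∈ C → γ a = γ b := by
    intro haC
    by_contra hne
    obtain ⟨K1, K2, hK1, hK2, h12⟩ := hlegs _ haC
    obtain ⟨γ', b', hb', hg', he'⟩ := extend_right (γ := fun t => γ (-t)) (a := -b) (b := -a) hfin hT
      (by linarith) h.neg (by fun_prop) (by simpa using fun e => hne e.symm) (by simpa using hK1)
      (by simpa using hK2) (by simpa using h12)
    have hg2 := hg'.neg
    rw [neg_neg] at hg2
    have := hmax' _ _ hg2 (Ioo_subset_Ioo_left (by linarith)) (by
      intro t ht
      have := he' (x := -t) ⟨by linarith [ht.2], by linarith [ht.1]⟩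
      simpa using this) (show a ∈ Ioo (-b') b from ⟨by linarith, hab⟩)
    exact lt_irrefl _ this.1
  refine ⟨γ, _, a, b, hab, hγlip, ?_⟩
  by_cases hbC : γ b ∈ C
  · left
    have hab' := hb hbC
    have hend := end_not_mem hT h hc hbC
    refine ⟨hab', ?_, Subset.antisymm ?_ ?_⟩
    · intro v hv w hw e
      rcases hv.1.eq_or_lt with hv2 | hv2 <;> rcases hw.1.eq_or_lt with hw2 | hw2
      · rw [← hv2, ← hw2]
      · rw [← hv2, hab'] at e; exact absurd e.symm (hend w ⟨hw2, hw.2⟩)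
      · rw [← hw2, hab'] at e; exact absurd e (hend v ⟨hv2, hv.2⟩)
      · exact h.inj ⟨hv2, hv.2⟩ ⟨hw2, hw.2⟩ e
    · intro z hz
      obtain ⟨t, ht, rfl⟩ := cover_aux hfin hT hjoin hab h hc (Or.inr ⟨hbC, hab'⟩) hz
      rcases ht.2.eq_or_lt with h1 | h1
      · exact ⟨a, ⟨le_rfl, hab⟩, by rw [h1, hab']⟩
      · exact ⟨t, ⟨ht.1, h1⟩, rfl⟩
    · rintro _ ⟨t, ht, rfl⟩
      rcases ht.1.eq_or_lt with h1 | h1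
      · rw [← h1, hab']; exact hbC
      · exact h.maps t ⟨h1, ht.2⟩
  · right
    have haC : γ a ∉ C := fun h1 => hbC (ha h1 ▸ h1)
    refine ⟨haC, hbC, h.inj, Subset.antisymm ?_ ?_⟩
    · intro z hz
      obtain ⟨t, ht, rfl⟩ := cover_aux hfin hT hjoin hab h hc (Or.inl ⟨haC, hbC⟩) hz
      refine ⟨t, ⟨lt_of_le_of_ne ht.1 ?_, lt_of_le_of_ne ht.2 ?_⟩, rfl⟩
      · rintro rfl; exact haC hz
      · rintro rfl; exact hbC hz
    · rintro _ ⟨t, ht, rfl⟩; exact h.maps t ht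

end P7

section P8

def CurveData (Ω C : Set ℂ) (len : ℝ) (γ : ℝ → ℂ) (K : ℝ≥0) : Prop :=
  0 < len ∧ LipschitzWith K γ ∧
    ((Function.Periodic γ len ∧ InjOn γ (Ico 0 len) ∧ C = γ '' Ico 0 len) ∨
      (InjOn γ (Ioo 0 len) ∧ C = γ '' Ioo 0 len ∧ γ 0 ∈ frontier Ω ∧ γ len ∈ frontier Ω ∧
        γ '' Icc 0 len ⊆ closure Ω))

lemma periodic_param {γ : ℝ → ℂ} {K : ℝ≥0} {a L : ℝ} (hL : 0 < L) (hγ : LipschitzWith K γ)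
    (he : γ a = γ (a + L)) :
    ∃ δ : ℝ → ℂ, LipschitzWith K δ ∧ Function.Periodic δ L ∧ ∀ t ∈ Ico 0 L, δ t = γ (a + t) := by
  set δ : ℝ → ℂ := fun t => γ (a + (t - L * ⌊t / L⌋)) with hδ
  have hfl : ∀ t, L * ⌊t / L⌋ ≤ t ∧ t < L * ⌊t / L⌋ + L := by
    intro t
    have h1 := Int.floor_le (t / L)
    have h2 := Int.lt_floor_add_one (t / L)
    rw [le_div_iff₀ hL] at h1
    rw [div_lt_iff₀ hL] at h2
    constructor <;> nlinarith
  have aux : ∀ s t, s ≤ t → dist (δ s) (δ t) ≤ K * (t - s) := by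
    intro s t hst
    have hmono : ⌊s / L⌋ ≤ ⌊t / L⌋ := Int.floor_mono (by gcongr)
    rcases hmono.eq_or_lt with heq | hlt
    · simp only [hδ]
      rw [heq]
      refine (hγ.dist_le_mul _ _).trans_eq ?_
      rw [Real.dist_eq, abs_sub_comm, abs_of_nonneg (by linarith)]; ring
    · have hlt' : (⌊s / L⌋ : ℝ) + 1 ≤ ⌊t / L⌋ := by exact_mod_cast hlt
      have h1 : dist (δ s) (γ (a + L)) ≤ K * (L * ⌊s / L⌋ + L - s) := by
        refine (hγ.dist_le_mul _ _).trans_eq ?_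
        rw [Real.dist_eq, abs_sub_comm, abs_of_nonneg (by linarith [(hfl s).2])]; ring
      have h2 : dist (γ a) (δ t) ≤ K * (t - L * ⌊t / L⌋) := by
        refine (hγ.dist_le_mul _ _).trans_eq ?_
        rw [Real.dist_eq, abs_sub_comm, abs_of_nonneg (by linarith [(hfl t).1])]; ring
      rw [he] at h2
      have h3 := dist_triangle (δ s) (γ (a + L)) (δ t)
      have h4 : L * ⌊s / L⌋ + L ≤ L * ⌊t / L⌋ := by nlinarith
      have h5 : (K:ℝ) * (L * ⌊s / L⌋ + L - s) + K * (t - L * ⌊t / L⌋) ≤ K * (t - s) := by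
        rw [← mul_add]
        exact mul_le_mul_of_nonneg_left (by linarith) K.2
      linarith
  refine ⟨δ, LipschitzWith.of_dist_le_mul fun s t => ?_, ?_, ?_⟩
  · rw [Real.dist_eq]
    rcases le_total s t with h | h
    · rw [abs_sub_comm, abs_of_nonneg (by linarith)]; exact aux s t h
    · rw [abs_of_nonneg (by linarith), dist_comm]; exact aux t s h
  · intro t
    simp only [hδ]
    rw [add_div, div_self hL.ne', Int.floor_add_one]
    push_cast
    congr 1; ring
  · intro t ht
    simp only [hδ]
    have : ⌊t / L⌋ = 0 := by
      rw [Int.floor_eq_zero_iff]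
      exact ⟨div_nonneg ht.1 hL.le, (div_lt_one hL).2 ht.2⟩
    rw [this]; simp

lemma curve_of_class {Ω F C : Set ℂ} (hΩ : IsOpen Ω) (hF : IsClosed F) (hC : C = closure C ∩ (Ω ∩ F))
    {γ : ℝ → ℂ} {L : ℝ≥0} {a b : ℝ} (hab : a < b) (hlip : LipschitzWith L γ)
    (h : (γ a = γ b ∧ InjOn γ (Ico a b) ∧ C = γ '' Ico a b) ∨
        (γ a ∉ C ∧ γ b ∉ C ∧ InjOn γ (Ioo a b) ∧ C = γ '' Ioo a b)) :
    ∃ len γ K, CurveData Ω C len γ K := by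
  have hCΩ : C ⊆ Ω := by rw [hC]; exact fun x hx => hx.2.1
  have hCF : C ⊆ F := by rw [hC]; exact fun x hx => hx.2.2
  rcases h with ⟨he, hi, him⟩ | ⟨ha, hb, hi, him⟩
  · obtain ⟨δ, hδl, hδp, hδe⟩ := periodic_param (a := a) (sub_pos.2 hab) hlip (by simpa using he)
    refine ⟨b - a, δ, L, sub_pos.2 hab, hδl, Or.inl ⟨hδp, ?_, ?_⟩⟩
    · intro s hs t ht e
      rw [hδe s hs, hδe t ht] at e
      have := hi ⟨by linarith [hs.1], by linarith [hs.2]⟩ ⟨by linarith [ht.1], by linarith [ht.2]⟩ e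
      linarith
    · rw [him]
      ext z
      constructor
      · rintro ⟨t, ht, rfl⟩
        have hm : t - a ∈ Ico 0 (b - a) := ⟨by linarith [ht.1], by linarith [ht.2]⟩
        exact ⟨t - a, hm, by rw [hδe _ hm]; congr 1; ring⟩
      · rintro ⟨t, ht, rfl⟩
        exact ⟨a + t, ⟨by linarith [ht.1], by linarith [ht.2]⟩, (hδe t ht).symm⟩
  · have hcl : γ '' Icc a b ⊆ closure C := by
      rw [him, ← closure_Ioo hab.ne]
      exact image_closure_subset_closure_image hlip.continuous
    have hfr : ∀ t ∈ Icc a b, γ t ∉ C → γ t ∈ frontier Ω := by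
      intro t ht hn
      have h1 := hcl ⟨t, ht, rfl⟩
      rw [hΩ.frontier_eq]
      refine ⟨closure_mono hCΩ h1, fun h2 => hn ?_⟩
      rw [hC]
      exact ⟨h1, h2, closure_minimal hCF hF h1⟩
    refine ⟨b - a, fun t => γ (a + t), L, sub_pos.2 hab, ?_, Or.inr ⟨?_, ?_, ?_, ?_, ?_⟩⟩
    · refine LipschitzWith.of_dist_le_mul fun s t => ?_
      refine (hlip.dist_le_mul _ _).trans_eq ?_
      rw [dist_add_left]
    · intro s hs t ht e
      have := hi ⟨by linarith [hs.1], by linarith [hs.2]⟩ ⟨by linarith [ht.1], by linarith [ht.2]⟩ e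
      linarith
    · rw [him]
      ext z
      constructor
      · rintro ⟨t, ht, rfl⟩
        exact ⟨t - a, ⟨by linarith [ht.1], by linarith [ht.2]⟩, by simp⟩
      · rintro ⟨t, ht, rfl⟩
        exact ⟨a + t, ⟨by linarith [ht.1], by linarith [ht.2]⟩, rfl⟩
    · simpa using hfr a ⟨le_rfl, hab.le⟩ ha
    · simpa using hfr b ⟨hab.le, le_rfl⟩ hb
    · rintro _ ⟨t, ht, rfl⟩
      exact closure_mono hCΩ (hcl ⟨a + t, ⟨by linarith [ht.1], by linarith [ht.2]⟩, rfl⟩)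

theorem main_complex {Ω : Set ℂ} (hΩ : IsOpen Ω) {f : ℂ → ℝ} {K : ℝ≥0} (hf : LipschitzWith K f)
    (hS : Bornology.IsBounded {x | x ∈ Ω ∧ f x ≠ 0}) :
    ∀ᵐ h : ℝ, μH[1] (Ω ∩ f ⁻¹' {h}) ≠ ⊤ ∧
      μH[1] ((Ω ∩ f ⁻¹' {h}) \ {x | ¬ (connectedComponentIn (Ω ∩ f ⁻¹' {h}) x).Subsingleton}) = 0 ∧
      ∀ x ∈ Ω ∩ f ⁻¹' {h}, ¬ (connectedComponentIn (Ω ∩ f ⁻¹' {h}) x).Subsingleton →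
        ∃ len γ L, CurveData Ω (connectedComponentIn (Ω ∩ f ⁻¹' {h}) x) len γ L := by
  have hz : ∀ᵐ h : ℝ, h ≠ 0 := by
    have := (Set.countable_singleton (0:ℝ)).ae_notMem volume
    filter_upwards [this] with h hh
    simpa using hh
  filter_upwards [level_ae hf hS, (moore_countable (Ω := Ω) f).ae_notMem volume, hz] with h h1 h2 h3
  set S := {x | x ∈ Ω ∧ f x ≠ 0} with hSdef
  have hSE : S ∩ f ⁻¹' {h} = Ω ∩ f ⁻¹' {h} := by
    ext x
    constructor
    · rintro ⟨⟨a, -⟩, b⟩; exact ⟨a, b⟩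
    · rintro ⟨a, b⟩
      have hb : f x = h := b
      exact ⟨⟨a, by rw [hb]; exact h3⟩, b⟩
  obtain ⟨hfin, hnull⟩ := h1
  rw [hSE] at hfin
  have hT : ¬ Triod (Ω ∩ f ⁻¹' {h}) := fun hT => h2 ⟨hfin, hT⟩
  have hreg : μH[1] (Ω ∩ {x | ¬ ∃ w r0, Reg f x w r0} ∩ f ⁻¹' {h}) = 0 := by
    refine measure_mono_null ?_ hnull
    rintro x ⟨⟨hx1, hx2⟩, hx3⟩
    have hxS : x ∈ S ∩ f ⁻¹' {h} := by rw [hSE]; exact ⟨hx1, hx3⟩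
    exact ⟨⟨hxS.1, fun hd => hx2 (reg_of_diff hd.1 hd.2)⟩, hx3⟩
  have hFcl : IsClosed (f ⁻¹' {h}) := isClosed_singleton.preimage hf.continuous
  refine ⟨hfin, ?_, ?_⟩
  · refine measure_mono_null ?_ hreg
    rintro x ⟨hx, hn⟩
    refine ⟨⟨hx.1, fun hr => hn ?_⟩, hx.2⟩
    obtain ⟨w, r0, hr⟩ := hr
    exact reg_nontrivial hΩ hf.continuous hfin hx hr
  · intro x hx hns
    set C := connectedComponentIn (Ω ∩ f ⁻¹' {h}) x with hC
    have hCE : C ⊆ Ω ∩ f ⁻¹' {h} := connectedComponentIn_subset _ _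
    have hCfin : μH[1] C ≠ ⊤ := ne_top_of_le_ne_top hfin (measure_mono hCE)
    have hTC : ¬ Triod C := by
      rintro ⟨a, K1, K2, K3, L1, L2, L3, I⟩
      exact hT ⟨a, K1, K2, K3, L1.mono (L1.sub.trans hCE), L2.mono (L2.sub.trans hCE),
        L3.mono (L3.sub.trans hCE), I⟩
    obtain ⟨γ, L, a, b, hab, hlip, hcl⟩ := classification hCfin hTC
      (fun y hy z hz => cont_joined hΩ hFcl hfin hy hz) (by
        intro a ha
        rw [not_subsingleton_iff] at hns
        obtain ⟨b, hb, hab⟩ := hns.exists_ne a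
        exact nonend hΩ hf.continuous hfin hT hreg ha hb hab.symm) hns
    exact curve_of_class hΩ hFcl (cc_eq_closure hx) hab hlip hcl

end P8

/-- **Structure of level sets of Lipschitz functions, II (connected components).**
Let `Ω ⊆ ℝ²` be open and `H : Ω → ℝ` Lipschitz with bounded support.  Then for a.e.
`h ∈ H(Ω)`: the family `Conn*(E_h)` of nontrivial connected components of the level set
`E_h = H⁻¹(h)` is countable, `H¹(E_h \ E_h^*) = 0` where `E_h^* = ⋃ Conn*(E_h)`, and
every `C ∈ Conn*(E_h)` is a simple `Ω`-closed Lipschitz curve. -/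
theorem level_sets_connected_components
    (Ω : Set (EuclideanSpace ℝ (Fin 2))) (hΩ : IsOpen Ω)
    (H : EuclideanSpace ℝ (Fin 2) → ℝ) (K : ℝ≥0) (hlip : LipschitzOnWith K H Ω)
    (hsupp : Bornology.IsBounded {x ∈ Ω | H x ≠ 0}) :
    ∀ᵐ h ∂(volume : Measure ℝ), h ∈ H '' Ω →
      (ConnStar {x ∈ Ω | H x = h}).Countable ∧
      μH[1] ({x ∈ Ω | H x = h} \ ⋃₀ ConnStar {x ∈ Ω | H x = h}) = 0 ∧
      ∀ C ∈ ConnStar {x ∈ Ω | H x = h}, Nonempty (SimpleOmegaClosedCurve Ω C) := by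
  obtain ⟨g, hg, hgH⟩ := hlip.extend_real
  set e := Complex.orthonormalBasisOneI.repr with he
  have hiso : Isometry e := e.isometry
  have hΩ' : IsOpen (e ⁻¹' Ω) := hΩ.preimage e.continuous
  have hf : LipschitzWith (K * 1) (fun z => g (e z)) := hg.comp hiso.lipschitz
  have hS : Bornology.IsBounded {x | x ∈ e ⁻¹' Ω ∧ g (e x) ≠ 0} := by
    refine (hiso.antilipschitz.isBounded_preimage hsupp).subset ?_
    rintro x ⟨hx, hx2⟩
    refine ⟨hx, ?_⟩
    rw [hgH hx]; exact hx2
  filter_upwards [main_complex hΩ' hf hS] with h hh _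
  obtain ⟨hfin, hnull, hcurve⟩ := hh
  set E : Set ℂ := e ⁻¹' Ω ∩ (fun z => g (e z)) ⁻¹' {h} with hE
  set E' : Set (EuclideanSpace ℝ (Fin 2)) := {x ∈ Ω | H x = h} with hE'
  have hEg : E' = Ω ∩ g ⁻¹' {h} := by
    ext x
    constructor
    · rintro ⟨h1, h2⟩; exact ⟨h1, show g x = h by rw [← hgH h1]; exact h2⟩
    · rintro ⟨h1, h2⟩
      have h3 : g x = h := h2
      exact ⟨h1, by rw [hgH h1]; exact h3⟩
  have hEE : e '' E = E' := by
    rw [hEg]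
    ext x
    constructor
    · rintro ⟨z, hz, rfl⟩; exact hz
    · intro hx
      exact ⟨e.symm x, by simpa [hE] using hx, by simp⟩
  have hcc : ∀ z ∈ E, connectedComponentIn E' (e z) = e '' connectedComponentIn E z := by
    intro z hz
    rw [← hEE]
    exact (e.toHomeomorph.image_connectedComponentIn hz).symm
  have hmeas : ∀ s : Set ℂ, μH[1] (e '' s) = μH[1] s := fun s =>
    hiso.hausdorffMeasure_image (Or.inl zero_le_one) s
  have hfin' : μH[1] E' ≠ ⊤ := by rw [← hEE, hmeas]; exact hfin
  have hsubs : ∀ s : Set ℂ, (e '' s).Subsingleton ↔ s.Subsingleton := fun s =>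
    ⟨fun hs => Set.subsingleton_of_image e.injective s hs, fun hs => hs.image e⟩
  refine ⟨?_, ?_, ?_⟩
  · refine connstar_countable ?_ hfin'
    rw [hEg]
    exact hΩ.measurableSet.inter (isClosed_singleton.preimage hg.continuous).measurableSet
  · refine measure_mono_null ?_ ((hmeas _).trans hnull)
    rintro x ⟨hx, hn⟩
    rw [← hEE] at hx
    obtain ⟨z, hz, rfl⟩ := hx
    refine ⟨z, ⟨hz, fun hns => hn ?_⟩, rfl⟩
    have hz' : e z ∈ E' := hEE ▸ ⟨z, hz, rfl⟩
    refine ⟨connectedComponentIn E' (e z), ⟨⟨e z, hz', rfl⟩, ?_⟩, mem_connectedComponentIn hz'⟩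
    rw [hcc z hz, hsubs]; exact hns
  · rintro C ⟨⟨x, hx, rfl⟩, hns⟩
    have hx' := hx
    rw [← hEE] at hx'
    obtain ⟨z, hz, rfl⟩ := hx'
    have hsubE : connectedComponentIn E' (e z) ⊆ E' := connectedComponentIn_subset _ _
    have hfinC : μH[1] (connectedComponentIn E' (e z)) ≠ ⊤ :=
      ne_top_of_le_ne_top hfin' (measure_mono hsubE)
    have hsubΩ : connectedComponentIn E' (e z) ⊆ Ω := hsubE.trans fun y hy => hy.1
    rw [hcc z hz, hsubs] at hns
    obtain ⟨len, γ, L, hlen, hγ, hcases⟩ := hcurve z hz hns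
    have hlip' : LipschitzWith (1 * L) (fun t => e (γ t)) := hiso.lipschitz.comp hγ
    have hfr : ∀ w, w ∈ frontier (e ⁻¹' Ω) → e w ∈ frontier Ω := by
      intro w hw
      have h1 := e.toHomeomorph.preimage_frontier Ω
      have h2 : w ∈ e.toHomeomorph ⁻¹' frontier Ω := by rw [h1]; exact hw
      exact h2
    have hclos : ∀ w, w ∈ closure (e ⁻¹' Ω) → e w ∈ closure Ω := by
      intro w hw
      have h1 := e.toHomeomorph.preimage_closure Ω
      have h2 : w ∈ e.toHomeomorph ⁻¹' closure Ω := by rw [h1]; exact hw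
      exact h2
    rcases hcases with ⟨hp, hi, him⟩ | ⟨hi, him, hf0, hf1, hcl⟩
    · refine ⟨⟨len, hlen, fun t => e (γ t), 1 * L, hlip', Ico 0 len, Or.inl ⟨?_, rfl, ?_, ?_⟩,
        hsubΩ, hfinC⟩⟩
      · intro t; simp only [hp t]
      · intro s hs t ht hst; exact hi hs ht (e.injective hst)
      · rw [hcc z hz, him, image_image]
    · refine ⟨⟨len, hlen, fun t => e (γ t), 1 * L, hlip', Ioo 0 len,
        Or.inr ⟨rfl, ?_, ?_, hfr _ hf0, hfr _ hf1, ?_⟩, hsubΩ, hfinC⟩⟩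
      · intro s hs t ht hst; exact hi hs ht (e.injective hst)
      · rw [hcc z hz, him, image_image]
      · rintro _ ⟨t, ht, rfl⟩
        exact hclos _ (hcl ⟨t, ht, rfl⟩)
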